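/- Let n ≥ 2 and let a, b be two distinct points in the closed unit ball of ℂⁿ. Let f be a real-analytic function on the unit sphere ∂Bⁿ. Suppose that for every complex line L containing at least one of the points a, b, there exists a function F_L continuous on L ∩ cl(Bⁿ), holomorphic in L ∩ Bⁿ, with f(z) = F_L(z) for z ∈ L ∩ ∂Bⁿ. Then f ∈ A(∂Bⁿ), i.e., there exists F continuous on the closed unit ball, holomorphic in the open unit ball Bⁿ, with F = f on ∂Bⁿ. -/

import Mathlib

open Metric Set

/-- Fourier coefficient of a function of an angle. -/
noncomputable def fc (u : ℝ → ℂ) (n : ℤ) : ℂ :=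
  (2 * (Real.pi : ℂ))⁻¹ * ∫ θ in (0:ℝ)..(2 * Real.pi), u θ * Complex.exp (-(n * θ * Complex.I))

lemma tpi_ne : (2 * (Real.pi : ℂ)) ≠ 0 := by
  have := Real.pi_ne_zero
  simp [this]

lemma fc_const_mul (c : ℂ) (u : ℝ → ℂ) (n : ℤ) : fc (fun θ => c * u θ) n = c * fc u n := by
  unfold fc
  simp_rw [mul_assoc c]
  rw [intervalIntegral.integral_const_mul]
  ring

lemma fc_congr {u v : ℝ → ℂ} (h : ∀ θ, u θ = v θ) (n : ℤ) : fc u n = fc v n := by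
  have : u = v := funext h
  rw [this]

lemma fc_add {u v : ℝ → ℂ} (hu : Continuous u) (hv : Continuous v) (n : ℤ) :
    fc (fun θ => u θ + v θ) n = fc u n + fc v n := by
  unfold fc
  simp_rw [add_mul]
  rw [intervalIntegral.integral_add]
  · ring
  · exact (by fun_prop : Continuous _).intervalIntegrable _ _
  · exact (by fun_prop : Continuous _).intervalIntegrable _ _

lemma fc_sub {u v : ℝ → ℂ} (hu : Continuous u) (hv : Continuous v) (n : ℤ) :
    fc (fun θ => u θ - v θ) n = fc u n - fc v n := by
  unfold fc
  simp_rw [sub_mul]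
  rw [intervalIntegral.integral_sub]
  · ring
  · exact (by fun_prop : Continuous _).intervalIntegrable _ _
  · exact (by fun_prop : Continuous _).intervalIntegrable _ _

lemma fc_norm_le {u : ℝ → ℂ} {B : ℝ} (h : ∀ θ, ‖u θ‖ ≤ B) (n : ℤ) : ‖fc u n‖ ≤ B := by
  unfold fc
  have hpi := Real.pi_pos
  have h1 : ‖∫ θ in (0:ℝ)..(2 * Real.pi), u θ * Complex.exp (-(n * θ * Complex.I))‖
      ≤ B * |2 * Real.pi - 0| := by
    apply intervalIntegral.norm_integral_le_of_norm_le_const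
    intro x _
    rw [norm_mul, Complex.norm_exp]
    simpa using h x
  rw [norm_mul, norm_inv]
  have h2 : ‖(2 * (Real.pi:ℂ))‖ = 2 * Real.pi := by
    simp [abs_of_pos hpi]
  rw [h2]
  rw [sub_zero, abs_of_pos (by positivity)] at h1
  rw [inv_mul_le_iff₀ (by positivity)]
  linarith

lemma fc_mul_exp (u : ℝ → ℂ) (k n : ℤ) :
    fc (fun θ => u θ * Complex.exp (k * θ * Complex.I)) n = fc u (n - k) := by
  unfold fc
  congr 2
  ext θ
  rw [mul_assoc, ← Complex.exp_add]
  congr 2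
  push_cast
  ring

lemma exp_two_pi_int (n : ℤ) : Complex.exp (-(n * ((2 * Real.pi : ℝ) : ℂ) * Complex.I)) = 1 := by
  rw [Complex.exp_eq_one_iff]
  exact ⟨-n, by push_cast; ring⟩

lemma fc_one (n : ℤ) : fc (fun _ => 1) n = if n = 0 then 1 else 0 := by
  unfold fc
  split_ifs with h
  · subst h
    have := tpi_ne
    simp only [Int.cast_zero, zero_mul, neg_zero, Complex.exp_zero, mul_one,
      intervalIntegral.integral_const, sub_zero, Complex.real_smul]
    push_cast
    exact inv_mul_cancel₀ this
  · have hc : (-(n * Complex.I) : ℂ) ≠ 0 := by simp [h]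
    have := integral_exp_mul_complex (a := 0) (b := 2 * Real.pi) hc
    have e : ∀ θ : ℝ, (1:ℂ) * Complex.exp (-(n * θ * Complex.I))
        = Complex.exp (-(n * Complex.I) * θ) := by
      intro θ; rw [one_mul]; congr 1; ring
    simp_rw [e]
    rw [this]
    have e2 : Complex.exp (-(n * Complex.I) * ((2 * Real.pi : ℝ) : ℂ)) = 1 := by
      rw [← exp_two_pi_int n]; congr 1; ring
    rw [e2]; simp

lemma fc_exp (k n : ℤ) :
    fc (fun θ => Complex.exp (k * θ * Complex.I)) n = if n = k then 1 else 0 := by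
  have := fc_mul_exp (fun _ => 1) k n
  simp only [one_mul] at this
  rw [this, fc_one]
  simp [sub_eq_zero]

lemma fc_hasSum {ι : Type*} [Countable ι] {U : ι → ℝ → ℂ} {u : ℝ → ℂ} {b : ι → ℝ}
    (hc : ∀ i, Continuous (U i)) (hb : ∀ i θ, ‖U i θ‖ ≤ b i) (hs : Summable b)
    (hu : ∀ θ, HasSum (fun i => U i θ) (u θ)) (n : ℤ) :
    HasSum (fun i => fc (U i) n) (fc u n) := by
  unfold fc
  apply HasSum.mul_left
  apply intervalIntegral.hasSum_integral_of_dominated_convergence (fun i _ => b i)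
  · intro i
    exact (by have := hc i; fun_prop : Continuous _).aestronglyMeasurable
  · intro i
    refine Filter.Eventually.of_forall (fun t _ => ?_)
    rw [norm_mul, Complex.norm_exp]
    simpa using hb i t
  · exact Filter.Eventually.of_forall (fun t _ => hs)
  · simp
  · exact Filter.Eventually.of_forall (fun t _ => (hu t).mul_right _)

lemma iint_swap {G : ℝ → ℝ → ℂ} (hG : Continuous (fun p : ℝ × ℝ => G p.1 p.2)) {a b c d : ℝ} :
    (∫ x in a..b, ∫ y in c..d, G x y) = ∫ y in c..d, ∫ x in a..b, G x y := by
  apply MeasureTheory.intervalIntegral_intervalIntegral_swap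
  have h : ContinuousOn (Function.uncurry G) (uIcc a b ×ˢ uIcc c d) := by
    exact Continuous.continuousOn hG
  exact (h.integrableOn_compact (isCompact_uIcc.prod isCompact_uIcc)).mono_set
    (Set.prod_mono uIoc_subset_uIcc uIoc_subset_uIcc)

lemma fc_swap {G : ℝ → ℝ → ℂ} (hG : Continuous (fun p : ℝ × ℝ => G p.1 p.2)) (n m : ℤ) :
    fc (fun θ => fc (fun φ => G θ φ) m) n = fc (fun φ => fc (fun θ => G θ φ) n) m := by
  unfold fc
  simp_rw [mul_assoc (2 * (Real.pi:ℂ))⁻¹]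
  rw [intervalIntegral.integral_const_mul, intervalIntegral.integral_const_mul]
  congr 2
  simp_rw [← intervalIntegral.integral_mul_const]
  rw [iint_swap (G := fun θ φ => G θ φ * Complex.exp (-(m * φ * Complex.I)) *
    Complex.exp (-(n * θ * Complex.I))) (by fun_prop)]
  congr 1; ext φ; congr 1; ext θ; ring

lemma fc_deriv {u u1 : ℝ → ℂ} (hu : ∀ θ, HasDerivAt u (u1 θ) θ) (hc : Continuous u1)
    (hp : u (2 * Real.pi) = u 0) (n : ℤ) : fc u1 n = n * Complex.I * fc u n := by
  unfold fc
  have hv : ∀ θ : ℝ, HasDerivAt (fun θ : ℝ => Complex.exp (-(n * θ * Complex.I)))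
      (Complex.exp (-(n * θ * Complex.I)) * (-(n * Complex.I))) θ := by
    intro θ
    have h0 : HasDerivAt (fun θ : ℝ => (-(n * θ * Complex.I) : ℂ)) (-(n * Complex.I)) θ := by
      have := (((Complex.ofRealCLM.hasDerivAt (x := θ)).const_mul (n:ℂ)).mul_const Complex.I).neg
      simpa [Pi.neg_def] using this
    exact h0.cexp
  have := intervalIntegral.integral_mul_deriv_eq_deriv_mul (a := 0) (b := 2 * Real.pi)
    (u := u) (u' := u1) (fun θ _ => hu θ) (fun θ _ => hv θ)
    (hc.intervalIntegrable _ _) ((by fun_prop : Continuous _).intervalIntegrable _ _)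
  rw [exp_two_pi_int n, hp] at this
  simp only [Complex.ofReal_zero, mul_zero, zero_mul, neg_zero, Complex.exp_zero, sub_self,
    zero_sub] at this
  simp_rw [← mul_assoc] at this
  rw [intervalIntegral.integral_mul_const] at this
  linear_combination (2 * (Real.pi:ℂ))⁻¹ * this

lemma fc_bound {u u1 u2 : ℝ → ℂ} (hu : ∀ θ, HasDerivAt u (u1 θ) θ)
    (hu1 : ∀ θ, HasDerivAt u1 (u2 θ) θ) (hc : Continuous u2)
    (hp : u (2 * Real.pi) = u 0) (hp1 : u1 (2 * Real.pi) = u1 0) {B : ℝ} (hB : ∀ θ, ‖u2 θ‖ ≤ B)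
    (n : ℤ) : (n:ℝ)^2 * ‖fc u n‖ ≤ B := by
  have hc1 : Continuous u1 := continuous_iff_continuousAt.2 fun θ => (hu1 θ).continuousAt
  have h1 := fc_deriv hu hc1 hp n
  have h2 := fc_deriv hu1 hc hp1 n
  have h3 := fc_norm_le hB n
  rw [h2, h1] at h3
  simp only [norm_mul, Complex.norm_I, mul_one] at h3
  have : ‖(n:ℂ)‖ = |(n:ℝ)| := by simp
  rw [this, ← mul_assoc, abs_mul_abs_self, ← sq] at h3
  exact h3

lemma summable_of_sq_bound {a : ℤ → ℂ} {B : ℝ} (h : ∀ n : ℤ, (n:ℝ)^2 * ‖a n‖ ≤ B) :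
    Summable (fun n => ‖a n‖) := by
  have hB : 0 ≤ B := by simpa using h 0
  have hs : Summable (fun n : ℤ => B * (1 / (n:ℝ)^2)) :=
    (Real.summable_one_div_int_pow.2 one_lt_two).mul_left B
  refine Summable.of_norm_bounded_eventually (g := fun n : ℤ => B * (1 / (n:ℝ)^2)) hs ?_
  have : ({0}ᶜ : Set ℤ) ∈ Filter.cofinite := (Set.finite_singleton _).compl_mem_cofinite
  filter_upwards [this] with n hn
  have hn' : (n:ℝ) ≠ 0 := by simpa using hn
  have := h n
  rw [norm_norm, mul_one_div, le_div_iff₀ (by positivity)]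
  linarith

lemma fc_series {u : ℝ → ℂ} (hc : Continuous u) (hp : ∀ θ, u (θ + 2 * Real.pi) = u θ)
    (hs : Summable (fun n => ‖fc u n‖)) (θ : ℝ) :
    HasSum (fun n : ℤ => fc u n * Complex.exp (n * θ * Complex.I)) (u θ) := by
  have : Fact (0 < 2 * Real.pi) := ⟨by positivity⟩
  have hper : Function.Periodic u (2 * Real.pi) := hp
  let U : C(AddCircle (2 * Real.pi), ℂ) := ⟨hper.lift, by
    rw [(QuotientAddGroup.isQuotientMap_mk (AddSubgroup.zmultiples (2 * Real.pi))).continuous_iff]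
    exact hc⟩
  have hU : ∀ t : ℝ, U (t : AddCircle (2 * Real.pi)) = u t := fun t => hper.lift_coe t
  have hco : ∀ n, fourierCoeff U n = fc u n := by
    intro n
    rw [fourierCoeff_eq_intervalIntegral _ n 0]
    unfold fc
    rw [zero_add, Complex.real_smul]
    congr 1
    · push_cast; rw [one_div]
    · congr 1; ext t
      rw [hU, fourier_coe_apply, smul_eq_mul, mul_comm]
      congr 2
      have := Real.pi_ne_zero
      have : (Real.pi : ℂ) ≠ 0 := by exact_mod_cast this
      push_cast
      field_simp
  have := has_pointwise_sum_fourier_series_of_summable (f := U)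
    (by rw [(funext hco : fourierCoeff U = fc u)]; exact hs.of_norm) (θ : AddCircle (2 * Real.pi))
  rw [hU] at this
  convert this using 2 with n
  rw [hco, fourier_coe_apply, smul_eq_mul]
  congr 2
  have : (Real.pi : ℂ) ≠ 0 := by exact_mod_cast Real.pi_ne_zero
  push_cast
  field_simp

/-- Holomorphic extension from the unit circle for a function with summable Fourier
coefficients vanishing for negative indices. -/
lemma fc_ext {u : ℝ → ℂ} (hc : Continuous u) (hp : ∀ θ, u (θ + 2 * Real.pi) = u θ)
    (hs : Summable (fun n => ‖fc u n‖)) (hneg : ∀ n : ℤ, n < 0 → fc u n = 0) :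
    ∃ Ψ : ℂ → ℂ, DiffContOnCl ℂ Ψ (ball 0 1) ∧
      ∀ θ : ℝ, Ψ (Complex.exp (θ * Complex.I)) = u θ := by
  have hsN : Summable (fun n : ℕ => ‖fc u n‖) := hs.comp_injective Nat.cast_injective
  refine ⟨fun z => ∑' n : ℕ, fc u n * z ^ n, ⟨?_, ?_⟩, ?_⟩
  · apply Complex.differentiableOn_tsum_of_summable_norm hsN (fun n => by fun_prop) isOpen_ball
    intro n w hw
    rw [norm_mul, norm_pow]
    have : ‖w‖ ≤ 1 := by simpa using (mem_ball_zero_iff.1 hw).le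
    exact mul_le_of_le_one_right (norm_nonneg _) (pow_le_one₀ (norm_nonneg _) this)
  · rw [closure_ball _ one_ne_zero]
    apply continuousOn_tsum (fun n => by fun_prop) hsN
    intro n w hw
    rw [norm_mul, norm_pow]
    have : ‖w‖ ≤ 1 := by simpa using hw
    exact mul_le_of_le_one_right (norm_nonneg _) (pow_le_one₀ (norm_nonneg _) this)
  · intro θ
    have h := fc_series hc hp hs θ
    have h2 : HasSum ((fun n : ℤ => fc u n * Complex.exp (n * θ * Complex.I)) ∘ (fun n : ℕ => (n:ℤ)))
        (u θ) := by
      rw [Function.Injective.hasSum_iff Nat.cast_injective]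
      · exact h
      · intro x hx
        have : x < 0 := by
          by_contra hh
          exact hx ⟨x.toNat, by simp; omega⟩
        simp [hneg x this]
    rw [← h2.tsum_eq]
    refine tsum_congr fun n => ?_
    simp only [Function.comp]
    rw [← Complex.exp_nat_mul]
    congr 2
    push_cast; ring

/-- Translation rule. -/
lemma fc_translate {u : ℝ → ℂ} (hp : ∀ θ, u (θ + 2 * Real.pi) = u θ) (α : ℝ) (n : ℤ) :
    fc (fun θ => u (θ + α)) n = Complex.exp (n * α * Complex.I) * fc u n := by
  unfold fc
  rw [mul_left_comm]
  congr 1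
  rw [← intervalIntegral.integral_const_mul]
  let w : ℝ → ℂ := fun θ => Complex.exp (n * α * Complex.I) *
      (u θ * Complex.exp (-(n * θ * Complex.I)))
  have hw : Function.Periodic w (2 * Real.pi) := by
    intro θ
    simp only [w, hp]
    congr 2
    have := exp_two_pi_int n
    rw [← mul_one (Complex.exp (-(n * θ * Complex.I))), ← this, ← Complex.exp_add]
    congr 1; push_cast; ring
  have h1 : ∀ θ : ℝ, u (θ + α) * Complex.exp (-(n * θ * Complex.I)) = w (θ + α) := by
    intro θ
    simp only [w]
    rw [mul_left_comm, ← Complex.exp_add]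
    congr 2; push_cast; ring
  simp_rw [h1]
  rw [intervalIntegral.integral_comp_add_right (fun θ => w θ) α]
  have := hw.intervalIntegral_add_eq (0 + α) 0
  rw [add_comm (2 * Real.pi) α, zero_add]
  rw [zero_add, zero_add] at this
  exact this

lemma PI_local {E : Type*} [NormedAddCommGroup E] [NormedSpace ℝ E] {G : E × ℝ → ℂ} {x0 : E}
    {θ0 : ℝ} (hG : AnalyticAt ℝ G (x0, θ0)) : ∃ δ > 0, ∀ s ∈ Icc (θ0 - δ) (θ0 + δ),
      ∀ e ∈ Icc (θ0 - δ) (θ0 + δ), AnalyticAt ℝ (fun x => ∫ t in s..e, G (x, t)) x0 := by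
  obtain ⟨p, R, hp⟩ := hG
  obtain ⟨δ3, hδ3, hδR⟩ : ∃ δ : NNReal, 0 < δ ∧ (δ : ENNReal) < R := by
    obtain ⟨δ, h1, h2⟩ := ENNReal.lt_iff_exists_nnreal_btwn.1 hp.r_pos
    exact ⟨δ, by exact_mod_cast h1, h2⟩
  set δ : NNReal := δ3 / 2 with hδdef
  have hδ : 0 < δ := by positivity
  have h2δ : (δ + δ : ENNReal) < R := by
    rw [← ENNReal.coe_add, hδdef, add_halves]; exact hδR
  have h2r : (δ + δ : ENNReal) < p.radius := h2δ.trans_le hp.r_le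
  have h1r : (δ : ENNReal) < p.radius := lt_of_le_of_lt le_self_add h2r
  have h1R : (δ : ENNReal) < R := lt_of_le_of_lt le_self_add h2δ
  refine ⟨δ, hδ, ?_⟩
  intro s hs e he
  have hse : ∀ t ∈ uIcc s e, ‖((0 : E), t - θ0)‖₊ ≤ δ := by
    intro t ht
    have h1 : t ∈ Icc (θ0 - δ) (θ0 + δ) := (uIcc_subset_Icc hs he) ht
    rw [← NNReal.coe_le_coe]
    simp only [coe_nnnorm, Prod.norm_mk, norm_zero, Real.norm_eq_abs]
    refine max_le δ.2 (abs_le.2 ⟨by linarith [h1.1], by linarith [h1.2]⟩)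
  let K : ℝ → FormalMultilinearSeries ℝ E ℂ := fun t n =>
    (p.changeOrigin ((0 : E), t - θ0) n).compContinuousLinearMap
      (fun _ => ContinuousLinearMap.inl ℝ E ℝ)
  let Q : FormalMultilinearSeries ℝ E ℂ := fun n => ∫ t in s..e, K t n
  let a : ℕ → NNReal := fun k => ∑' s : Σ l : ℕ, { s : Finset (Fin (k + l)) // s.card = l },
    ‖p (k + s.1)‖₊ * δ ^ s.1
  have ha : Summable (fun k => (a k * δ ^ k : NNReal)) := by
    have := (NNReal.summable_sigma.1 (p.changeOriginSeries_summable_aux₁ h2r)).2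
    simpa only [NNReal.tsum_mul_right] using this
  have hK : ∀ t ∈ uIcc s e, ∀ n, ‖K t n‖₊ ≤ a n := by
    intro t ht n
    have hb := hse t ht
    have h1 : ‖K t n‖₊ ≤ ‖p.changeOrigin ((0 : E), t - θ0) n‖₊ := by
      have := ContinuousMultilinearMap.norm_compContinuousLinearMap_le
        (p.changeOrigin ((0 : E), t - θ0) n) (fun _ => ContinuousLinearMap.inl ℝ E ℝ)
      rw [← NNReal.coe_le_coe]
      refine this.trans ?_
      refine mul_le_of_le_one_right (norm_nonneg _) ?_
      refine Finset.prod_le_one (fun _ _ => norm_nonneg _)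
        (fun _ _ => ContinuousLinearMap.norm_inl_le_one ℝ E ℝ)
    refine h1.trans ?_
    have h2 : (‖((0 : E), t - θ0)‖₊ : ENNReal) < p.radius :=
      lt_of_le_of_lt (by exact_mod_cast hb) h1r
    refine (p.nnnorm_changeOrigin_le n h2).trans ?_
    have hs2 := p.changeOriginSeries_summable_aux₂ h1r n
    have hle : ∀ q : Σ l : ℕ, { s : Finset (Fin (n + l)) // s.card = l },
        ‖p (n + q.1)‖₊ * ‖((0 : E), t - θ0)‖₊ ^ q.1 ≤ ‖p (n + q.1)‖₊ * δ ^ q.1 := by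
      intro q; gcongr
    exact Summable.tsum_le_tsum hle (NNReal.summable_of_le hle hs2) hs2
  have hKc : ∀ n, ContinuousOn (fun t => K t n) (uIcc s e) := by
    intro n
    have h1 : ContinuousOn (fun w => p.changeOrigin w n) (Metric.eball 0 p.radius) :=
      (p.hasFPowerSeriesOnBall_changeOrigin n (lt_of_le_of_lt bot_le h1r)).continuousOn
    have h2 : ContinuousOn (fun t => p.changeOrigin ((0 : E), t - θ0) n) (uIcc s e) := by
      refine h1.comp (f := fun t : ℝ => ((0 : E), t - θ0)) (by fun_prop) ?_
      intro t ht
      rw [Metric.mem_eball, edist_zero_right]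
      exact lt_of_le_of_lt (by exact_mod_cast hse t ht) h1r
    exact (ContinuousMultilinearMap.compContinuousLinearMapL (𝕜 := ℝ) (F := ℂ)
      (fun _ : Fin n => ContinuousLinearMap.inl ℝ E ℝ)).continuous.comp_continuousOn h2
  have hKi : ∀ n, IntervalIntegrable (fun t => K t n) MeasureTheory.volume s e :=
    fun n => (hKc n).intervalIntegrable
  have hQn : ∀ n, ‖Q n‖ ≤ a n * |e - s| := by
    intro n
    apply intervalIntegral.norm_integral_le_of_norm_le_const
    intro t ht
    exact_mod_cast hK t (uIoc_subset_uIcc ht) n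
  have hQa : ∀ n y, Q n (fun _ => y) = ∫ t in s..e, K t n (fun _ => y) := by
    intro n y
    exact ((ContinuousMultilinearMap.apply ℝ (fun _ : Fin n => E) ℂ
      (fun _ => y)).intervalIntegral_comp_comm (hKi n)).symm
  refine ⟨Q, δ, ?_, by exact_mod_cast hδ, ?_⟩
  · refine Q.le_radius_of_summable ?_
    have hs2 : Summable (fun n => (a n * δ ^ n : ℝ) * |e - s|) := by
      refine Summable.mul_right _ ?_
      exact_mod_cast NNReal.summable_coe.2 ha
    refine Summable.of_nonneg_of_le (fun n => by positivity) (fun n => ?_) hs2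
    have := hQn n
    calc ‖Q n‖ * (δ:ℝ) ^ n ≤ (a n * |e - s|) * (δ:ℝ)^n := by gcongr
      _ = _ := by ring
  · intro y hy
    have hy' : ‖y‖₊ < δ := by
      rw [Metric.mem_eball, edist_zero_right] at hy
      exact_mod_cast hy
    simp_rw [hQa]
    apply intervalIntegral.hasSum_integral_of_dominated_convergence (fun n _ => (a n * δ ^ n : ℝ))
    · intro n
      have : ContinuousOn (fun t => K t n (fun _ => y)) (uIcc s e) :=
        (ContinuousMultilinearMap.apply ℝ (fun _ : Fin n => E) ℂ
          (fun _ => y)).continuous.comp_continuousOn (hKc n)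
      exact (intervalIntegrable_iff.1 this.intervalIntegrable).aestronglyMeasurable
    · intro n
      refine Filter.Eventually.of_forall (fun t ht => ?_)
      refine ((K t n).le_opNorm _).trans ?_
      simp only [Finset.prod_const, Finset.card_univ, Fintype.card_fin]
      have h1 : ‖K t n‖ ≤ a n := by exact_mod_cast hK t (uIoc_subset_uIcc ht) n
      have h2 : ‖y‖ ≤ δ := by exact_mod_cast hy'.le
      gcongr
    · refine Filter.Eventually.of_forall (fun t ht => ?_)
      exact_mod_cast NNReal.summable_coe.2 ha
    · simp
    · refine Filter.Eventually.of_forall (fun t ht => ?_)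
      have hb := hse t (uIoc_subset_uIcc ht)
      have h3 : (‖((0 : E), t - θ0)‖₊ : ENNReal) < R :=
        lt_of_le_of_lt (by exact_mod_cast hb) h1R
      have := (hp.changeOrigin h3).hasSum (y := (y, 0)) (by
        rw [Metric.mem_eball, edist_zero_right, lt_tsub_iff_right]
        refine lt_of_le_of_lt (add_le_add ?_ ?_) h2δ
        · have : ‖(y, (0:ℝ))‖₊ = ‖y‖₊ := by
            ext; simp [Prod.norm_mk]
          change ((‖(y, (0:ℝ))‖₊ : NNReal) : ENNReal) ≤ δ
          rw [this]; exact_mod_cast hy'.le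
        · exact_mod_cast hb)
      simp only [Prod.mk_add_mk, add_zero, add_sub_cancel] at this
      exact this

/-- Integrals of real-analytic functions depending on a parameter are real-analytic. -/
lemma PI {E : Type*} [NormedAddCommGroup E] [NormedSpace ℝ E] {G : E × ℝ → ℂ} {x0 : E}
    {α β : ℝ} (hαβ : α ≤ β) (hG : ∀ θ ∈ Icc α β, AnalyticAt ℝ G (x0, θ)) :
    AnalyticAt ℝ (fun x => ∫ t in α..β, G (x, t)) x0 := by
  choose! d hd hloc using fun θ hθ => PI_local (hG θ hθ)
  have hev : ∀ᶠ x in nhds x0, ∀ θ ∈ Icc α β, AnalyticAt ℝ G (x, θ) := by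
    apply isCompact_Icc.eventually_forall_of_forall_eventually
    intro θ hθ
    exact (hG θ hθ).eventually_analyticAt
  have hint : ∀ᶠ x in nhds x0, ContinuousOn (fun t => G (x, t)) (Icc α β) := by
    filter_upwards [hev] with x hx θ hθ
    exact (((hx θ hθ).continuousAt).comp (f := fun t : ℝ => (x, t))
      (by fun_prop)).continuousWithinAt
  let c : Icc α β → Set (Icc α β) := fun i => {j | (j:ℝ) ∈ Ioo ((i:ℝ) - d i) ((i:ℝ) + d i)}
  obtain ⟨t, ht0, hmono, ⟨n, hn⟩, hcov⟩ := exists_monotone_Icc_subset_open_cover_Icc hαβ (c := c)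
    (fun i => isOpen_Ioo.preimage continuous_subtype_val)
    (fun j _ => mem_iUnion.2 ⟨j, by simp [c, hd j j.2]⟩)
  have key : ∀ k, AnalyticAt ℝ (fun x => ∫ s in α..(t k : ℝ), G (x, s)) x0 := by
    intro k
    induction k with
    | zero =>
      rw [ht0]; simp only [intervalIntegral.integral_same]; exact analyticAt_const
    | succ k ih =>
      obtain ⟨i, hi⟩ := hcov k
      have hm : t k ≤ t (k+1) := hmono (Nat.le_succ k)
      have h1 := hi (left_mem_Icc.2 hm)
      have h2 := hi (right_mem_Icc.2 hm)
      have h3 := hloc i i.2 (t k) (Ioo_subset_Icc_self h1) (t (k+1)) (Ioo_subset_Icc_self h2)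
      refine (ih.add h3).congr ?_
      filter_upwards [hint] with x hx
      simp only [Pi.add_apply]
      apply intervalIntegral.integral_add_adjacent_intervals
      · exact (hx.mono (by
          rw [uIcc_of_le (t k).2.1]
          exact Icc_subset_Icc le_rfl (t k).2.2)).intervalIntegrable
      · exact (hx.mono (by
          rw [uIcc_of_le (by exact_mod_cast hm)]
          exact Icc_subset_Icc (t k).2.1 (t (k+1)).2.2)).intervalIntegrable
  have := key n
  rwa [hn n le_rfl] at this

lemma AnalyticAt.rcexp {E : Type*} [NormedAddCommGroup E] [NormedSpace ℝ E] {f : E → ℂ} {x : E}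
    (h : AnalyticAt ℝ f x) : AnalyticAt ℝ (fun y => Complex.exp (f y)) x :=
  AnalyticAt.fun_comp (g := Complex.exp) ((analyticAt_cexp (z := f x)).restrictScalars) h

lemma fc_analyticAt {E : Type*} [NormedAddCommGroup E] [NormedSpace ℝ E] {G : E × ℝ → ℂ} {x0 : E}
    (hG : ∀ θ, AnalyticAt ℝ G (x0, θ)) (n : ℤ) :
    AnalyticAt ℝ (fun x => fc (fun θ => G (x, θ)) n) x0 := by
  unfold fc
  refine analyticAt_const.mul ?_
  refine PI (G := fun p : E × ℝ => G p * Complex.exp (-(n * p.2 * Complex.I)))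
    (by positivity) (fun θ _ => (hG θ).mul ?_)
  have h1 : AnalyticAt ℝ (fun p : E × ℝ => (p.2 : ℂ)) (x0, θ) :=
    (Complex.ofRealCLM.comp (ContinuousLinearMap.snd ℝ E ℝ)).analyticAt _
  have h2 : AnalyticAt ℝ (fun p : E × ℝ => (-(n * p.2 * Complex.I) : ℂ)) (x0, θ) :=
    ((analyticAt_const.mul h1).mul analyticAt_const).neg
  exact h2.rcexp

lemma multi_expand {E ρ ι J : Type*} [NormedAddCommGroup E] [NormedSpace ℝ E]
    [Fintype ρ] [Fintype ι] (e : ρ → E) (x : ρ → E → ℝ)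
    (a : ρ → ι → ℂ) (l : ι → E → ℂ) (hv : ∀ v, ∑ r, x r v • e r = v)
    (hx : ∀ r v, (x r v : ℂ) = ∑ i, a r i * l i v)
    (cnt : ∀ n, (Fin n → ι) → J) (deg : J → ℕ) (hdeg : ∀ n s, deg (cnt n s) = n)
    (mon : J → E → ℂ) (hmon : ∀ n (s : Fin n → ι) v, ∏ k, l (s k) v = mon (cnt n s) v)
    (hmb : ∀ j v, ‖mon j v‖ ≤ ‖v‖ ^ deg j)
    {f : E → ℂ} {x0 : E} (hf : AnalyticAt ℝ f x0) :
    ∃ R > 0, ∃ c : J → ℂ, Summable (fun j => ‖c j‖ * R ^ deg j) ∧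
      ∀ v, ‖v‖ < R → HasSum (fun j => c j * mon j v) (f (x0 + v)) := by
  classical
  obtain ⟨p, r, hp⟩ := hf
  obtain ⟨δ, hδ0, hδr⟩ : ∃ δ : NNReal, 0 < δ ∧ (δ : ENNReal) < r := by
    obtain ⟨δ, h1, h2⟩ := ENNReal.lt_iff_exists_nnreal_btwn.1 hp.r_pos
    exact ⟨δ, by exact_mod_cast h1, h2⟩
  let w : ι → ℝ := fun i => ∑ r, ‖a r i‖ * ‖e r‖
  have hw : ∀ i, 0 ≤ w i := fun i => Finset.sum_nonneg fun r _ => by positivity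
  let K : ℝ := ∑ i, w i
  have hK : 0 ≤ K := Finset.sum_nonneg fun i _ => hw i
  let C : ∀ n, (Fin n → ι) → ℂ := fun n s =>
    ∑ r : Fin n → ρ, (∏ k, a (r k) (s k)) * p n (fun k => e (r k))
  have hCb : ∀ n s, ‖C n s‖ ≤ ‖p n‖ * ∏ k, w (s k) := by
    intro n s
    have h1 : ∏ k, w (s k) = ∑ r : Fin n → ρ, ∏ k, (‖a (r k) (s k)‖ * ‖e (r k)‖) := by
      simp only [w]
      rw [Finset.prod_univ_sum, Fintype.piFinset_univ]
    rw [h1, Finset.mul_sum]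
    refine (norm_sum_le _ _).trans (Finset.sum_le_sum fun r _ => ?_)
    rw [norm_mul, norm_prod, Finset.prod_mul_distrib]
    have := (p n).le_opNorm (fun k => e (r k))
    calc (∏ k, ‖a (r k) (s k)‖) * ‖p n fun k => e (r k)‖
        ≤ (∏ k, ‖a (r k) (s k)‖) * (‖p n‖ * ∏ k, ‖e (r k)‖) := by gcongr
      _ = _ := by ring
  have hCs : ∀ n, ∑ s, ‖C n s‖ ≤ ‖p n‖ * K ^ n := by
    intro n
    refine (Finset.sum_le_sum fun s _ => hCb n s).trans ?_
    rw [← Finset.mul_sum, Fintype.sum_pow]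
  have hCv : ∀ n v, p n (fun _ => v) = ∑ s, C n s * ∏ k, l (s k) v := by
    intro n v
    conv_lhs => rw [show (fun _ : Fin n => v) = fun _ : Fin n => ∑ r, x r v • e r by
      ext; rw [hv]]
    rw [(p n).map_sum]
    simp_rw [C, Finset.sum_mul]
    rw [Finset.sum_comm]
    refine Finset.sum_congr rfl fun r _ => ?_
    rw [(p n).map_smul_univ (fun k => x (r k) v) (fun k => e (r k))]
    rw [Complex.real_smul, Complex.ofReal_prod]
    simp_rw [hx]
    rw [Finset.prod_univ_sum, Fintype.piFinset_univ, Finset.sum_mul]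
    refine Finset.sum_congr rfl fun s _ => ?_
    rw [Finset.prod_mul_distrib]; ring
  obtain ⟨R, hR0, hRK, hRδ⟩ : ∃ R : ℝ, 0 < R ∧ K * R ≤ δ ∧ R ≤ δ := by
    have hδ' : (0:ℝ) < δ := hδ0
    refine ⟨δ / (K + 1), by positivity, ?_, ?_⟩
    · rw [mul_div_assoc', div_le_iff₀ (by positivity)]; nlinarith
    · rw [div_le_iff₀ (by positivity)]; nlinarith
  have hps : Summable (fun n => ‖p n‖ * (δ:ℝ) ^ n) :=
    p.summable_norm_mul_pow (hδr.trans_le hp.r_le)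
  have hsum : Summable (fun q : Σ n, (Fin n → ι) => ‖C q.1 q.2‖ * R ^ q.1) := by
    rw [summable_sigma_of_nonneg (fun q => by positivity)]
    refine ⟨fun n => Summable.of_finite, ?_⟩
    refine Summable.of_nonneg_of_le (fun n => tsum_nonneg fun s => by positivity) (fun n => ?_) hps
    simp only
    rw [tsum_fintype, ← Finset.sum_mul]
    calc (∑ s, ‖C n s‖) * R ^ n ≤ (‖p n‖ * K ^ n) * R ^ n := by gcongr; exact hCs n
      _ = ‖p n‖ * (K * R) ^ n := by ring
      _ ≤ _ := by gcongr
  let π : (Σ n, (Fin n → ι)) → J := fun q => cnt q.1 q.2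
  let eq := Equiv.sigmaFiberEquiv π
  have hsum2 : Summable (fun y : Σ j, {q // π q = j} => ‖C (y.2:Σ n, (Fin n → ι)).1 (y.2:Σ n, (Fin n → ι)).2‖
      * R ^ deg y.1) := by
    rw [← eq.summable_iff] at hsum
    refine hsum.congr ?_
    rintro ⟨j, q, hq⟩
    simp [eq, Equiv.sigmaFiberEquiv, ← hq, π, hdeg]
  have hsC : ∀ j, Summable (fun q : {q // π q = j} => ‖C q.1.1 q.1.2‖) := by
    intro j
    have := hsum2.sigma_factor j
    simp only at this
    exact (summable_mul_right_iff (by positivity)).1 this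
  refine ⟨R, hR0, fun j => ∑' q : {q // π q = j}, C q.1.1 q.1.2, ?_, ?_⟩
  · refine Summable.of_nonneg_of_le (fun j => by positivity) (fun j => ?_) hsum2.sigma
    simp only
    rw [tsum_mul_right]
    gcongr
    exact norm_tsum_le_tsum_norm (hsC j)
  · intro v hvR
    have h1 : HasSum (fun n => p n (fun _ => v)) (f (x0 + v)) := by
      refine hp.hasSum ?_
      rw [Metric.mem_eball, edist_zero_right]
      refine lt_trans ?_ hδr
      have : ‖v‖₊ < δ := by
        rw [← NNReal.coe_lt_coe]; exact hvR.trans_le hRδ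
      exact_mod_cast this
    have hs3 : Summable (fun q : Σ n, (Fin n → ι) => C q.1 q.2 * mon (π q) v) := by
      refine Summable.of_norm_bounded hsum (fun q => ?_)
      rw [norm_mul]
      have := hmb (π q) v
      rw [hdeg] at this
      gcongr
      exact this.trans (by gcongr)
    have h2 : HasSum (fun q : Σ n, (Fin n → ι) => C q.1 q.2 * mon (π q) v) (f (x0 + v)) := by
      have h3 := hs3.hasSum
      have h4 := h3.sigma (g := fun n => p n (fun _ => v)) (fun n => by
        rw [hCv]
        simp_rw [hmon]
        exact hasSum_fintype _)
      rw [h1.unique h4]; exact h3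
    have h5 : HasSum (fun y : Σ j, {q // π q = j} => C (y.2:Σ n, (Fin n → ι)).1 (y.2:Σ n, (Fin n → ι)).2
      * mon y.1 v) (f (x0 + v)) := by
      rw [← eq.hasSum_iff] at h2
      convert h2 using 2 with y
      obtain ⟨j, q, hq⟩ := y
      simp [eq, Equiv.sigmaFiberEquiv, ← hq]
    have h6 : ∀ j, HasSum (fun q : {q // π q = j} => C q.1.1 q.1.2 * mon j v)
        ((∑' q : {q // π q = j}, C q.1.1 q.1.2) * mon j v) :=
      fun j => ((hsC j).of_norm.hasSum).mul_right _
    exact HasSum.sigma h5 h6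

/-- Expansion of a real-analytic function of one complex variable in `z, z̄`. -/
lemma expand_C {f : ℂ → ℂ} {x0 : ℂ} (hf : AnalyticAt ℝ f x0) :
    ∃ R > 0, ∃ c : ℕ × ℕ → ℂ, Summable (fun j : ℕ × ℕ => ‖c j‖ * R ^ (j.1 + j.2)) ∧
      ∀ v, ‖v‖ < R → HasSum (fun j : ℕ × ℕ => c j * (v ^ j.1 * (starRingEnd ℂ v) ^ j.2))
        (f (x0 + v)) := by
  classical
  refine multi_expand (ρ := Bool) (ι := Bool) (fun b => if b then 1 else Complex.I)
    (fun b v => if b then v.re else v.im)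
    (fun r i => if r then 1 / 2 else (if i then -Complex.I / 2 else Complex.I / 2))
    (fun i v => if i then v else starRingEnd ℂ v) ?_ ?_
    (fun n s => (Finset.card {k | s k = true}, Finset.card {k | s k = false}))
    (fun j => j.1 + j.2) ?_ (fun j v => v ^ j.1 * (starRingEnd ℂ v) ^ j.2) ?_ ?_ hf
  · intro v; simp
  · intro r v
    cases r
    · simp; apply Complex.ext <;> simp <;> ring
    · simp; apply Complex.ext <;> simp <;> ring
  · intro n s
    have := Finset.card_filter_add_card_filter_not (s := (Finset.univ : Finset (Fin n))) (fun k => s k = true)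
    simpa using this
  · intro n s v
    simp only
    rw [← Finset.prod_filter_mul_prod_filter_not Finset.univ (fun k => s k = true)]
    congr 1
    · rw [Finset.prod_congr rfl (g := fun _ => v), Finset.prod_const]
      intro k hk; simp at hk; simp [hk]
    · rw [Finset.prod_congr rfl (g := fun _ => starRingEnd ℂ v), Finset.prod_const]
      · simp
      · intro k hk; simp at hk; simp [hk]
  · intro j v; simp [pow_add]

lemma expand_RC {f : ℝ × ℂ → ℂ} {x0 : ℝ × ℂ} (hf : AnalyticAt ℝ f x0) :
    ∃ R > 0, ∃ c : ℕ × ℕ × ℕ → ℂ, Summable (fun j : ℕ × ℕ × ℕ => ‖c j‖ * R ^ (j.1 + j.2.1 + j.2.2)) ∧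
      ∀ v, ‖v‖ < R → HasSum (fun j : ℕ × ℕ × ℕ =>
        c j * ((v.1 : ℂ) ^ j.1 * v.2 ^ j.2.1 * (starRingEnd ℂ v.2) ^ j.2.2)) (f (x0 + v)) := by
  classical
  refine multi_expand (ρ := Fin 3) (ι := Fin 3) ![(1, 0), (0, 1), (0, Complex.I)]
    ![fun v => v.1, fun v => v.2.re, fun v => v.2.im]
    ![![1, 0, 0], ![0, 1 / 2, 1 / 2], ![0, -Complex.I / 2, Complex.I / 2]]
    ![fun v => (v.1 : ℂ), fun v => v.2, fun v => starRingEnd ℂ v.2] ?_ ?_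
    (fun n s => (Finset.card {k | s k = 0}, Finset.card {k | s k = 1}, Finset.card {k | s k = 2}))
    (fun j => j.1 + j.2.1 + j.2.2) ?_
    (fun j v => (v.1 : ℂ) ^ j.1 * v.2 ^ j.2.1 * (starRingEnd ℂ v.2) ^ j.2.2) ?_ ?_ hf
  · intro v; simp [Fin.sum_univ_three]
  · intro r v
    fin_cases r
    · simp [Fin.sum_univ_three]
    · simp [Fin.sum_univ_three]; apply Complex.ext <;> simp <;> ring
    · simp [Fin.sum_univ_three]; apply Complex.ext <;> simp <;> ring
  · intro n s
    have h := Finset.card_eq_sum_card_fiberwise (s := (Finset.univ : Finset (Fin n)))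
      (t := (Finset.univ : Finset (Fin 3))) (f := s) (by intro _ _; simp)
    simp [Fin.sum_univ_three] at h
    exact h.symm
  · intro n s v
    rw [← Finset.prod_fiberwise_of_maps_to (s := (Finset.univ : Finset (Fin n)))
      (t := (Finset.univ : Finset (Fin 3))) (g := s) (by intro _ _; simp), Fin.prod_univ_three]
    congr 1
    · congr 1
      · rw [Finset.prod_congr rfl (g := fun _ => (v.1:ℂ)), Finset.prod_const]
        intro k hk; simp at hk; simp [hk]
      · rw [Finset.prod_congr rfl (g := fun _ => v.2), Finset.prod_const]
        intro k hk; simp at hk; simp [hk]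
    · rw [Finset.prod_congr rfl (g := fun _ => starRingEnd ℂ v.2), Finset.prod_const]
      intro k hk; simp at hk; simp [hk]
  · intro j v
    simp only [norm_mul, norm_pow, RCLike.norm_conj, pow_add]
    have h1 : ‖(v.1:ℂ)‖ ≤ ‖v‖ := by simpa using norm_fst_le v
    have h2 := norm_snd_le v
    gcongr

lemma regroup {J K : Type*} (π : J → K) (a : J → ℂ) (W : K → ℝ) (hW : ∀ k, 0 < W k)
    (hs : Summable (fun j => ‖a j‖ * W (π j))) :
    (∀ k, Summable (fun j : {j // π j = k} => a j)) ∧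
    Summable (fun k => ‖∑' j : {j // π j = k}, a j‖ * W k) ∧
    ∀ (w : K → ℂ) (s : ℂ), HasSum (fun j => a j * w (π j)) s →
      HasSum (fun k => (∑' j : {j // π j = k}, a j) * w k) s := by
  let eq := Equiv.sigmaFiberEquiv π
  have hsum2 : Summable (fun y : Σ k, {j // π j = k} => ‖a y.2‖ * W y.1) := by
    rw [← eq.summable_iff] at hs
    refine hs.congr ?_
    rintro ⟨j, q, hq⟩
    simp [eq, Equiv.sigmaFiberEquiv, ← hq]
  have hsC : ∀ k, Summable (fun j : {j // π j = k} => ‖a j‖) := by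
    intro k
    exact (summable_mul_right_iff (hW k).ne').1 (hsum2.sigma_factor k)
  refine ⟨fun k => (hsC k).of_norm, ?_, ?_⟩
  · refine Summable.of_nonneg_of_le (fun k => mul_nonneg (norm_nonneg _) (hW k).le) (fun k => ?_) hsum2.sigma
    simp only
    rw [tsum_mul_right]
    have := hW k
    gcongr
    exact norm_tsum_le_tsum_norm (hsC k)
  · intro w s h2
    have h5 : HasSum (fun y : Σ k, {j // π j = k} => a y.2 * w y.1) s := by
      rw [← eq.hasSum_iff] at h2
      convert h2 using 2 with y
      obtain ⟨j, q, hq⟩ := y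
      simp [eq, Equiv.sigmaFiberEquiv, ← hq]
    have h6 : ∀ k, HasSum (fun j : {j // π j = k} => a j * w k)
        ((∑' j : {j // π j = k}, a j) * w k) :=
      fun k => ((hsC k).of_norm.hasSum).mul_right _
    exact HasSum.sigma h5 h6

lemma pser_zero {b : ℕ → ℂ} {R R' : ℝ} (hR' : 0 < R') (hR : 0 < R)
    (hs : Summable (fun n => ‖b n‖ * R ^ n))
    (h : ∀ ρ : ℝ, 0 < ρ → ρ < R' → HasSum (fun n => b n * (ρ:ℂ) ^ n) 0) : ∀ n, b n = 0 := by
  intro n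
  induction n using Nat.strong_induction_on with
  | _ n ih =>
  let S : ℝ → ℂ := fun ρ => ∑' k, b (k + n) * (ρ:ℂ) ^ k
  have hs2 : Summable (fun k => ‖b (k + n)‖ * R ^ k) := by
    have := (summable_nat_add_iff n).2 hs
    have h2 := this.mul_right ((R ^ n)⁻¹)
    refine h2.congr fun k => ?_
    rw [pow_add]; field_simp
  have hbd : ∀ k (ρ : ℝ), ρ ∈ Icc 0 R → ‖b (k + n) * (ρ:ℂ) ^ k‖ ≤ ‖b (k + n)‖ * R ^ k := by
    intro k ρ hρ
    rw [norm_mul, norm_pow, Complex.norm_real, Real.norm_of_nonneg hρ.1]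
    have := hρ.1; have := hρ.2
    gcongr
  have hS : ContinuousOn S (Icc 0 R) := by
    apply continuousOn_tsum (fun k => by fun_prop) hs2 hbd
  have hS0 : S 0 = b n := by
    simp only [S]
    rw [tsum_eq_single 0]
    · simp
    · intro k hk; simp [hk]
  have hz : ∀ ρ ∈ Ioo 0 (min R R'), S ρ = 0 := by
    intro ρ hρ
    have h1 := h ρ hρ.1 (hρ.2.trans_le (min_le_right _ _))
    have h2 : HasSum (fun k => b (k + n) * (ρ:ℂ) ^ (k + n)) 0 := by
      rw [hasSum_nat_add_iff (f := fun n => b n * (ρ:ℂ)^n) n, Finset.sum_eq_zero, add_zero]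
      · exact h1
      · intro i hi; simp [ih i (Finset.mem_range.1 hi)]
    have hρ0 : (ρ:ℂ) ≠ 0 := by exact_mod_cast hρ.1.ne'
    have h3 := h2.mul_right (((ρ:ℂ) ^ n)⁻¹)
    rw [zero_mul] at h3
    have h4 : HasSum (fun k => b (k + n) * (ρ:ℂ) ^ k) 0 := by
      refine h3.congr_fun fun k => ?_
      rw [pow_add]; field_simp
    exact h4.tsum_eq
  have hm : 0 < min R R' := lt_min hR hR'
  have hc : Filter.Tendsto S (nhdsWithin 0 (Ioo 0 (min R R'))) (nhds (S 0)) :=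
    (hS 0 ⟨le_rfl, hR.le⟩).mono (fun ρ hρ => ⟨hρ.1.le, (hρ.2.trans_le (min_le_left _ _)).le⟩)
  have hne : (nhdsWithin (0:ℝ) (Ioo 0 (min R R'))).NeBot := by
    rw [← mem_closure_iff_nhdsWithin_neBot, closure_Ioo hm.ne]
    exact ⟨le_rfl, hm.le⟩
  have hc0 : Filter.Tendsto S (nhdsWithin 0 (Ioo 0 (min R R'))) (nhds 0) :=
    tendsto_const_nhds.congr' (by
      filter_upwards [self_mem_nhdsWithin] with ρ hρ using (hz ρ hρ).symm)
  rw [← hS0]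
  exact tendsto_nhds_unique hc hc0

lemma polar_pow (ρ θ : ℝ) (p q : ℕ) :
    ((ρ:ℂ) * Complex.exp (θ * Complex.I)) ^ p * (starRingEnd ℂ ((ρ:ℂ) * Complex.exp (θ * Complex.I))) ^ q
      = (ρ:ℂ) ^ (p + q) * Complex.exp (((p:ℤ) - (q:ℤ) : ℤ) * θ * Complex.I) := by
  rw [map_mul, Complex.conj_ofReal, ← Complex.exp_conj, map_mul, Complex.conj_ofReal, Complex.conj_I,
    mul_pow, mul_pow, ← Complex.exp_nat_mul, ← Complex.exp_nat_mul]
  have : Complex.exp ((((p:ℤ) - (q:ℤ) : ℤ) : ℂ) * θ * Complex.I)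
      = Complex.exp (p * (θ * Complex.I)) * Complex.exp (q * (θ * -Complex.I)) := by
    rw [← Complex.exp_add]; congr 1; push_cast; ring
  rw [this, pow_add]; ring

lemma fc_expand {c : ℕ × ℕ → ℂ} {R : ℝ}
    (hs : Summable (fun j : ℕ × ℕ => ‖c j‖ * R ^ (j.1 + j.2))) {h : ℂ → ℂ}
    (hh : ∀ v, ‖v‖ < R → HasSum (fun j : ℕ × ℕ => c j * (v ^ j.1 * (starRingEnd ℂ v) ^ j.2)) (h v))
    (l : ℤ) {ρ : ℝ} (hρ0 : 0 ≤ ρ) (hρ : ρ < R) :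
    HasSum (fun j : ℕ × ℕ => (if (j.1:ℤ) - j.2 = l then c j else 0) * (ρ:ℂ) ^ (j.1 + j.2))
      (fc (fun θ => h (ρ * Complex.exp (θ * Complex.I))) l) := by
  have hn : ∀ θ : ℝ, ‖(ρ:ℂ) * Complex.exp (θ * Complex.I)‖ = ρ := by
    intro θ
    rw [norm_mul, Complex.norm_exp_ofReal_mul_I, mul_one, Complex.norm_real, Real.norm_of_nonneg hρ0]
  have := fc_hasSum (U := fun (j : ℕ × ℕ) (θ : ℝ) => c j * ((ρ:ℂ) ^ (j.1 + j.2) *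
      Complex.exp (((j.1:ℤ) - (j.2:ℤ) : ℤ) * θ * Complex.I)))
    (u := fun θ => h (ρ * Complex.exp (θ * Complex.I))) (b := fun j => ‖c j‖ * R ^ (j.1 + j.2))
    (fun j => by fun_prop) (fun j θ => by
      rw [norm_mul, norm_mul, norm_pow, Complex.norm_real, Real.norm_of_nonneg hρ0]
      have : ‖Complex.exp (((j.1:ℤ) - (j.2:ℤ) : ℤ) * θ * Complex.I)‖ = 1 := by
        have := Complex.norm_exp_ofReal_mul_I ((((j.1:ℤ) - (j.2:ℤ) : ℤ):ℝ) * θ)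
        push_cast at this ⊢; exact this
      rw [this, mul_one]
      gcongr) hs (fun θ => by
      have := hh (ρ * Complex.exp (θ * Complex.I)) (by rw [hn]; exact hρ)
      simp_rw [polar_pow] at this
      exact this) l
  convert this using 2 with j
  simp_rw [← mul_assoc]
  rw [fc_const_mul, fc_exp]
  split_ifs with h1 h2 h2
  · ring
  · exact absurd h1.symm h2
  · exact absurd h2.symm h1
  · ring

lemma uniq2 {c : ℕ × ℕ → ℂ} {R R' : ℝ} (hR : 0 < R) (hR' : 0 < R')
    (hs : Summable (fun j : ℕ × ℕ => ‖c j‖ * R ^ (j.1 + j.2))) (l : ℤ)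
    (h0 : ∀ ρ : ℝ, 0 < ρ → ρ < R' →
      HasSum (fun j : ℕ × ℕ => (if (j.1:ℤ) - j.2 = l then c j else 0) * (ρ:ℂ) ^ (j.1 + j.2)) 0)
    (p q : ℕ) (hpq : (p:ℤ) - q = l) : c (p, q) = 0 := by
  let a : ℕ × ℕ → ℂ := fun j => if (j.1:ℤ) - j.2 = l then c j else 0
  have ha : Summable (fun j : ℕ × ℕ => ‖a j‖ * R ^ (j.1 + j.2)) := by
    refine Summable.of_nonneg_of_le (fun j => by positivity) (fun j => ?_) hs
    gcongr
    simp only [a]; split_ifs <;> simp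
  obtain ⟨h1, h2, h3⟩ := regroup (fun j : ℕ × ℕ => j.1 + j.2) a (fun n => R ^ n)
    (fun n => by positivity) ha
  have h4 := pser_zero hR' hR h2 (fun ρ hρ hρ' => h3 (fun n => (ρ:ℂ)^n) 0 (h0 ρ hρ hρ')) (p + q)
  rw [tsum_eq_single ⟨(p, q), rfl⟩] at h4
  · simpa [a, hpq] using h4
  · rintro ⟨⟨p', q'⟩, hj⟩ hne
    simp only [a]
    rw [if_neg]
    intro h5
    apply hne
    simp only at hj h5
    simp only [Subtype.mk.injEq, Prod.mk.injEq]
    omega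

lemma fc_growth {c : ℕ × ℕ → ℂ} {R : ℝ} (hR : 0 < R)
    (hs : Summable (fun j : ℕ × ℕ => ‖c j‖ * R ^ (j.1 + j.2))) {h : ℂ → ℂ}
    (hh : ∀ v, ‖v‖ < R → HasSum (fun j : ℕ × ℕ => c j * (v ^ j.1 * (starRingEnd ℂ v) ^ j.2)) (h v))
    (l : ℤ) : ∃ C, ∀ ρ : ℝ, 0 ≤ ρ → ρ < R →
      ‖fc (fun θ => h (ρ * Complex.exp (θ * Complex.I))) l‖ ≤ C * ρ ^ l.natAbs := by
  refine ⟨(∑' j : ℕ × ℕ, ‖c j‖ * R ^ (j.1 + j.2)) * (R ^ l.natAbs)⁻¹, fun ρ hρ0 hρ => ?_⟩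
  have h1 := fc_expand hs hh l hρ0 hρ
  rw [← h1.tsum_eq]
  rw [← tsum_mul_right, ← tsum_mul_right]
  refine tsum_of_norm_bounded (Summable.hasSum ?_) (fun j => ?_)
  · exact (hs.mul_right _).mul_right _
  split_ifs with hj
  · rw [norm_mul, norm_pow, Complex.norm_real, Real.norm_of_nonneg hρ0]
    obtain ⟨k, hk⟩ : ∃ k, j.1 + j.2 = l.natAbs + k := ⟨j.1 + j.2 - l.natAbs, by omega⟩
    rw [hk, pow_add, pow_add]
    have : ρ ^ k ≤ R ^ k := by gcongr
    calc ‖c j‖ * (ρ ^ l.natAbs * ρ ^ k) ≤ ‖c j‖ * (ρ ^ l.natAbs * R ^ k) := by gcongr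
      _ = _ := by field_simp
  · simp; positivity

lemma analytic_hol_extend {h : ℂ → ℂ} {U : Set ℂ} (hU : IsPreconnected U)
    (hh : AnalyticOnNhd ℝ h U) {z0 : ℂ} (hz0 : z0 ∈ U)
    (hd : ∀ᶠ w in nhds z0, DifferentiableAt ℂ h w) :
    DifferentiableOn ℂ h U := by
  have ha : AnalyticOnNhd ℝ (fun z => fderiv ℝ h z Complex.I - Complex.I • fderiv ℝ h z 1) U := by
    intro z hz
    have h1 := (hh z hz).fderiv
    have h2 : ∀ v : ℂ, AnalyticAt ℝ (fun z => fderiv ℝ h z v) z := fun v =>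
      ((ContinuousLinearMap.apply ℝ ℂ v).analyticAt _).fun_comp h1
    have h3 : AnalyticAt ℝ (fun z => Complex.I • fderiv ℝ h z 1) z :=
      analyticAt_const.fun_smul (h2 1)
    exact (h2 Complex.I).sub h3
  have h0 := ha.eqOn_of_preconnected_of_eventuallyEq (g := fun _ => 0) (fun z _ => analyticAt_const)
    hU hz0 (by
      filter_upwards [hd] with w hw
      rw [(differentiableAt_complex_iff_differentiableAt_real.1 hw).2, sub_self])
  intro z hz
  refine (differentiableAt_complex_iff_differentiableAt_real.2
    ⟨(hh z hz).differentiableAt, ?_⟩).differentiableWithinAt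
  exact sub_eq_zero.1 (h0 hz)

/-- A local boundary uniqueness statement for discs. -/
lemma local_uniq {D : ℂ → ℂ} {o c : ℂ} {r ρ : ℝ}
    (hc : ContinuousOn D (closedBall o r ∩ ball c ρ))
    (hd : DifferentiableOn ℂ D (ball o r ∩ ball c ρ))
    (h0 : ∀ z ∈ sphere o r ∩ ball c ρ, D z = 0)
    (hco : ‖c - o‖ < r) (hρ : 2 * (r - ‖c - o‖) < ρ) : D c = 0 := by
  set d := ‖c - o‖ with hdd
  have hd0 : 0 ≤ d := norm_nonneg _
  let L : ℕ → ℂ → ℂ := fun j ζ => c + Complex.I ^ j * (ζ - c)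
  have hLc : ∀ j, Continuous (L j) := fun j => by fun_prop
  have hLn : ∀ j ζ, ‖L j ζ - c‖ = ‖ζ - c‖ := by
    intro j ζ; simp [L]
  let Ω : Set ℂ := ⋂ j ∈ Finset.range 4, (L j) ⁻¹' ball o r
  let Ω' : Set ℂ := ⋂ j ∈ Finset.range 4, (L j) ⁻¹' closedBall o r
  have hΩo : IsOpen Ω := isOpen_biInter_finset fun j _ => isOpen_ball.preimage (hLc j)
  have hΩ'c : IsClosed Ω' := isClosed_biInter fun j _ => isClosed_closedBall.preimage (hLc j)
  have hcl : closure Ω ⊆ Ω' := closure_minimal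
    (iInter₂_mono fun j _ => preimage_mono ball_subset_closedBall) hΩ'c
  -- boundedness
  have hb : ∀ ζ ∈ Ω', ‖ζ - c‖ ≤ 2 * (r - d) := by
    intro ζ hζ
    have hm : ∀ j < 4, ‖L j ζ - o‖ ≤ r := by
      intro j hj
      have := mem_iInter₂.1 hζ j (Finset.mem_range.2 hj)
      simpa [dist_eq_norm] using this
    have hsq : ∀ j < 4, ‖L j ζ - o‖ ^ 2 ≤ r ^ 2 := fun j hj => by
      have := hm j hj
      gcongr
    have e0 := hsq 0 (by norm_num)
    have e1 := hsq 1 (by norm_num)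
    have e2 := hsq 2 (by norm_num)
    have e3 := hsq 3 (by norm_num)
    obtain ⟨y, hy⟩ : ∃ y, y = ζ - c := ⟨_, rfl⟩
    obtain ⟨e, he⟩ : ∃ e, e = c - o := ⟨_, rfl⟩
    have g : ∀ j, L j ζ - o = e + Complex.I ^ j * y := by intro j; simp [L, hy, he]; ring
    rw [g] at e0 e1 e2 e3
    have hde : d = ‖e‖ := by rw [he]
    rw [hde, ← hy]
    rw [hde] at hco
    have I3 : Complex.I ^ 3 = -Complex.I := by
      rw [pow_succ, Complex.I_sq]; ring
    rw [pow_zero, one_mul] at e0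
    rw [pow_one] at e1
    rw [Complex.I_sq] at e2
    rw [I3] at e3
    have hye := Complex.sq_norm y
    have hee := Complex.sq_norm e
    rw [Complex.normSq_apply] at hye hee
    simp only [Complex.sq_norm, Complex.normSq_apply, Complex.add_re, Complex.add_im,
      Complex.mul_re, Complex.mul_im, Complex.neg_re, Complex.neg_im, Complex.I_re, Complex.I_im,
      Complex.one_re, Complex.one_im] at e0 e1 e2 e3
    obtain ⟨Y, hY⟩ : ∃ Y, Y = ‖y‖ := ⟨_, rfl⟩
    obtain ⟨d', hd'⟩ : ∃ d', d' = ‖e‖ := ⟨_, rfl⟩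
    rw [← hY] at hye ⊢
    rw [← hd'] at hee ⊢
    rw [← hd'] at hco
    have hY0 : 0 ≤ Y := by rw [hY]; positivity
    have hd0 : 0 ≤ d' := by rw [hd']; positivity
    -- a = Re (conj e * y), b = Im
    obtain ⟨A, hA⟩ : ∃ A, A = e.re * y.re + e.im * y.im := ⟨_, rfl⟩
    obtain ⟨B, hB⟩ : ∃ B, B = e.im * y.re - e.re * y.im := ⟨_, rfl⟩
    have hAB : A ^ 2 + B ^ 2 = Y ^ 2 * d' ^ 2 := by rw [hA, hB, hye, hee]; ring
    have f0 : d' ^ 2 + 2 * A + Y ^ 2 ≤ r ^ 2 := by rw [hye, hee, hA]; linarith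
    have f1 : d' ^ 2 + 2 * B + Y ^ 2 ≤ r ^ 2 := by rw [hye, hee, hB]; linarith
    have f2 : d' ^ 2 - 2 * A + Y ^ 2 ≤ r ^ 2 := by rw [hye, hee, hA]; linarith
    have f3 : d' ^ 2 - 2 * B + Y ^ 2 ≤ r ^ 2 := by rw [hye, hee, hB]; linarith
    have hmax : d' ^ 2 + Y * d' + Y ^ 2 ≤ r ^ 2 := by
      by_contra hcon
      push Not at hcon
      have hYd : 0 ≤ Y * d' := by positivity
      have a1 : |2 * A| ≤ r^2 - d'^2 - Y^2 := abs_le.2 ⟨by linarith, by linarith⟩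
      have b1 : |2 * B| ≤ r^2 - d'^2 - Y^2 := abs_le.2 ⟨by linarith, by linarith⟩
      have a2 : |2 * A| < Y * d' := by linarith
      have b2 : |2 * B| < Y * d' := by linarith
      have a3 := sq_lt_sq' (by linarith [neg_abs_le (2*A), abs_nonneg (2*A)]) ((le_abs_self _).trans_lt a2)
      have b3 := sq_lt_sq' (by linarith [neg_abs_le (2*B), abs_nonneg (2*B)]) ((le_abs_self _).trans_lt b2)
      nlinarith
    by_contra hcon
    push Not at hcon
    nlinarith
  have hmem : ∀ ζ ∈ Ω', ∀ j, L j ζ ∈ ball c ρ := by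
    intro ζ hζ j
    rw [mem_ball, dist_eq_norm, hLn]
    exact (hb ζ hζ).trans_lt hρ
  let P : ℂ → ℂ := fun ζ => ∏ j ∈ Finset.range 4, D (L j ζ)
  have hΩΩ' : Ω ⊆ Ω' := subset_closure.trans hcl
  have hPc : ContinuousOn P Ω' := by
    refine continuousOn_finsetProd _ fun j hj => ?_
    refine hc.comp (hLc j).continuousOn fun ζ hζ => ⟨mem_iInter₂.1 hζ j hj, hmem ζ hζ j⟩
  have hPd : DifferentiableOn ℂ P Ω := by
    refine DifferentiableOn.fun_finsetProd fun j hj => ?_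
    refine hd.comp (f := L j) (by fun_prop) fun ζ hζ => ⟨mem_iInter₂.1 hζ j hj, hmem ζ (hΩΩ' hζ) j⟩
  have hcΩ : c ∈ Ω := by
    refine mem_iInter₂.2 fun j _ => ?_
    simpa [L, dist_eq_norm] using hco
  have hbd : Bornology.IsBounded Ω := by
    refine (isBounded_closedBall (x := c) (r := 2 * (r - d))).subset fun ζ hζ => ?_
    rw [mem_closedBall, dist_eq_norm]; exact hb ζ (hΩΩ' hζ)
  have hfr : ∀ ζ ∈ frontier Ω, ‖P ζ‖ ≤ 0 := by
    intro ζ hζ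
    have h1 := hcl (frontier_subset_closure hζ)
    have h2 : ζ ∉ Ω := by
      have := hζ.2
      rwa [hΩo.interior_eq] at this
    have : ∃ j ∈ Finset.range 4, L j ζ ∉ ball o r := by
      by_contra hcon
      push Not at hcon
      exact h2 (mem_iInter₂.2 hcon)
    obtain ⟨j, hj, hjn⟩ := this
    have h3 : L j ζ ∈ closedBall o r := mem_iInter₂.1 h1 j hj
    have h4 : D (L j ζ) = 0 := by
      apply h0 _ ⟨?_, hmem ζ h1 j⟩
      rw [mem_sphere]
      exact le_antisymm (mem_closedBall.1 h3) (not_lt.1 hjn)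
    have : P ζ = 0 := Finset.prod_eq_zero hj h4
    simp [this]
  have hfin := Complex.norm_le_of_forall_mem_frontier_norm_le hbd ⟨hPd, hPc.mono hcl⟩ hfr
    (subset_closure hcΩ)
  have hz : P c = 0 := norm_le_zero_iff.1 hfin
  simpa [P, L] using hz

/-- one-dimensional extension along complex lines through `(β, 0)` -/
def LineHyp (g : ℂ × ℂ → ℂ) (β : ℝ) : Prop := ∀ k : ℂ, ∃ F : ℂ → ℂ,
  ContinuousOn F {z : ℂ | ‖z‖ ^ 2 + ‖k‖ ^ 2 * ‖z - β‖ ^ 2 ≤ 1} ∧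
  DifferentiableOn ℂ F {z : ℂ | ‖z‖ ^ 2 + ‖k‖ ^ 2 * ‖z - β‖ ^ 2 < 1} ∧
  ∀ z : ℂ, ‖z‖ ^ 2 + ‖k‖ ^ 2 * ‖z - β‖ ^ 2 = 1 → F z = g (z, k * (z - β))

noncomputable def sq1 (z : ℂ) : ℝ := Real.sqrt (1 - ‖z‖ ^ 2)

/-- normalized Fourier coefficients in the second variable -/
noncomputable def hm (g : ℂ × ℂ → ℂ) (m : ℤ) (z : ℂ) : ℂ :=
  (sq1 z : ℂ) ^ (-m) * fc (fun φ => g (z, sq1 z * Complex.exp (φ * Complex.I))) m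

noncomputable def cen (β κ : ℝ) : ℝ := κ ^ 2 * β / (1 + κ ^ 2)
noncomputable def rad (β κ : ℝ) : ℝ := Real.sqrt (1 + κ ^ 2 - κ ^ 2 * β ^ 2) / (1 + κ ^ 2)
noncomputable def zc (β κ θ : ℝ) : ℂ := cen β κ + rad β κ * Complex.exp (θ * Complex.I)

lemma rad_pos {β κ : ℝ} (h0 : 0 ≤ β) (h1 : β ≤ 1) : 0 < rad β κ := by
  unfold rad
  have : β ^ 2 ≤ 1 := by nlinarith
  have : 0 < 1 + κ ^ 2 - κ ^ 2 * β ^ 2 := by nlinarith [sq_nonneg κ]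
  positivity

lemma circ_id {β κ : ℝ} (h0 : 0 ≤ β) (h1 : β ≤ 1) (z : ℂ) :
    ‖z‖ ^ 2 + κ ^ 2 * ‖z - β‖ ^ 2 - 1 = (1 + κ ^ 2) * (‖z - cen β κ‖ ^ 2 - rad β κ ^ 2) := by
  have : β ^ 2 ≤ 1 := by nlinarith
  have h3 : 0 ≤ 1 + κ ^ 2 - κ ^ 2 * β ^ 2 := by nlinarith [sq_nonneg κ]
  have h4 : 1 + κ ^ 2 ≠ 0 := by positivity
  rw [rad, div_pow, Real.sq_sqrt h3, cen]
  simp only [Complex.sq_norm, Complex.normSq_apply, Complex.sub_re, Complex.sub_im,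
    Complex.ofReal_re, Complex.ofReal_im]
  field_simp
  ring

lemma zc_norm {β κ : ℝ} (h0 : 0 ≤ β) (h1 : β ≤ 1) (θ : ℝ) : ‖zc β κ θ - cen β κ‖ = rad β κ := by
  simp [zc, abs_of_pos (rad_pos h0 h1), Complex.norm_exp_ofReal_mul_I]

lemma zc_mem {β κ : ℝ} (h0 : 0 ≤ β) (h1 : β ≤ 1) (θ : ℝ) :
    ‖zc β κ θ‖ ^ 2 + κ ^ 2 * ‖zc β κ θ - β‖ ^ 2 = 1 := by
  have := circ_id h0 h1 (κ := κ) (zc β κ θ)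
  rw [zc_norm h0 h1] at this
  linarith

lemma sq1_zc {β κ : ℝ} (h0 : 0 ≤ β) (h1 : β ≤ 1) (hκ : 0 ≤ κ) (θ : ℝ) :
    sq1 (zc β κ θ) = ‖(κ:ℂ) * (zc β κ θ - β)‖ := by
  rw [sq1, norm_mul, Complex.norm_real, Real.norm_of_nonneg hκ]
  rw [show 1 - ‖zc β κ θ‖ ^ 2 = (κ * ‖zc β κ θ - β‖) ^ 2 by
    have := zc_mem h0 h1 (κ := κ) θ
    rw [mul_pow]; linarith]
  rw [Real.sqrt_sq (by positivity)]

lemma zc_ne {β κ : ℝ} (h0 : 0 ≤ β) (h1 : β < 1) (θ : ℝ) : zc β κ θ - β ≠ 0 := by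
  intro h
  have h2 := zc_mem h0 h1.le (κ := κ) θ
  rw [h, sub_eq_zero.1 h] at h2
  simp at h2
  rcases h2 with h2 | h2 <;> linarith

lemma zc_lt_one {β κ : ℝ} (h0 : 0 ≤ β) (h1 : β < 1) (hκ : 0 < κ) (θ : ℝ) : ‖zc β κ θ‖ < 1 := by
  have h2 := zc_mem h0 h1.le (κ := κ) θ
  have h3 : 0 < ‖zc β κ θ - β‖ := norm_pos_iff.2 (zc_ne h0 h1 θ)
  have : 0 < κ ^ 2 * ‖zc β κ θ - β‖ ^ 2 := by positivity
  nlinarith [norm_nonneg (zc β κ θ)]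

lemma sq1_pos {z : ℂ} (hz : ‖z‖ < 1) : 0 < sq1 z := by
  unfold sq1
  apply Real.sqrt_pos.2
  nlinarith [norm_nonneg z]

lemma exp_per (θ : ℝ) : Complex.exp (((θ + 2 * Real.pi : ℝ) : ℂ) * Complex.I)
    = Complex.exp (θ * Complex.I) := by
  rw [Complex.exp_eq_exp_iff_exists_int]
  exact ⟨1, by push_cast; ring⟩

lemma fc_slice (g : ℂ × ℂ → ℂ) (m : ℤ) {z w : ℂ} (hz : ‖z‖ < 1) (hw : ‖w‖ = sq1 z) :
    fc (fun φ => g (z, w * Complex.exp (φ * Complex.I))) m = w ^ m * hm g m z := by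
  have hs := sq1_pos hz
  have hs' : (sq1 z : ℂ) ≠ 0 := by exact_mod_cast hs.ne'
  have hw' : w = sq1 z * Complex.exp (w.arg * Complex.I) := by
    rw [← hw, Complex.norm_mul_exp_arg_mul_I]
  have h1 := fc_translate (u := fun φ => g (z, sq1 z * Complex.exp (φ * Complex.I)))
    (fun θ => by rw [exp_per]) w.arg m
  have h2 : fc (fun φ => g (z, w * Complex.exp (φ * Complex.I))) m =
      fc (fun φ => g (z, sq1 z * Complex.exp (((φ + w.arg : ℝ):ℂ) * Complex.I))) m := by
    refine fc_congr (fun φ => ?_) m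
    conv_lhs => rw [hw']
    congr 2
    rw [mul_assoc, ← Complex.exp_add]
    congr 2; push_cast; ring
  rw [h2, h1, hm]
  conv_rhs => rw [hw', mul_zpow, ← Complex.exp_int_mul]
  have : (sq1 z : ℂ) ^ m * (sq1 z : ℂ) ^ (-m) = 1 := by
    rw [← zpow_add₀ hs']; simp
  calc _ = 1 * (Complex.exp (m * w.arg * Complex.I) *
        fc (fun φ => g (z, sq1 z * Complex.exp (φ * Complex.I))) m) := by rw [one_mul]
    _ = _ := by rw [← this, mul_assoc (m:ℂ)]; ring

lemma sphere_pt {z : ℂ} (hz : ‖z‖ ≤ 1) {w : ℂ} (hw : ‖w‖ = sq1 z) : ‖z‖ ^ 2 + ‖w‖ ^ 2 = 1 := by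
  rw [hw, sq1, Real.sq_sqrt]
  · ring
  · nlinarith [norm_nonneg z]

lemma analyticAt_normSq' (z : ℂ) : AnalyticAt ℝ (fun z : ℂ => ‖z‖ ^ 2) z := by
  have h1 : AnalyticAt ℝ (fun z : ℂ => z.re) z := Complex.reCLM.analyticAt z
  have h2 : AnalyticAt ℝ (fun z : ℂ => z.im) z := Complex.imCLM.analyticAt z
  simp only [Complex.sq_norm, Complex.normSq_apply]
  exact (h1.mul h1).add (h2.mul h2)

lemma analyticAt_rsqrt {x : ℝ} (hx : 0 < x) : AnalyticAt ℝ Real.sqrt x := by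
  have h : AnalyticAt ℝ (fun y => Real.exp (Real.log y / 2)) x := by
    refine AnalyticAt.rexp ?_
    exact ((analyticAt_log hx).div analyticAt_const two_ne_zero)
  refine h.congr ?_
  filter_upwards [lt_mem_nhds hx] with y hy
  rw [Real.sqrt_eq_rpow, Real.rpow_def_of_pos hy]
  congr 1; ring

lemma sq1_analytic {z : ℂ} (hz : ‖z‖ < 1) : AnalyticAt ℝ sq1 z := by
  have h1 : AnalyticAt ℝ (fun z : ℂ => 1 - ‖z‖ ^ 2) z := analyticAt_const.sub (analyticAt_normSq' z)
  have h2 : 0 < 1 - ‖z‖ ^ 2 := by nlinarith [norm_nonneg z]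
  exact AnalyticAt.fun_comp (g := Real.sqrt) (analyticAt_rsqrt h2) h1

lemma AnalyticAt.ofReal' {E : Type*} [NormedAddCommGroup E] [NormedSpace ℝ E] {f : E → ℝ} {x : E}
    (h : AnalyticAt ℝ f x) : AnalyticAt ℝ (fun y => (f y : ℂ)) x :=
  AnalyticAt.fun_comp (g := fun t : ℝ => (t : ℂ)) (Complex.ofRealCLM.analyticAt _) h

lemma analyticAt_expI (E : Type*) [NormedAddCommGroup E] [NormedSpace ℝ E] (x : E × ℝ) :
    AnalyticAt ℝ (fun p : E × ℝ => Complex.exp (p.2 * Complex.I)) x := by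
  have h1 : AnalyticAt ℝ (fun p : E × ℝ => p.2) x := analyticAt_snd
  exact (h1.ofReal'.mul analyticAt_const).rcexp

lemma AnalyticAt.zpow' {E : Type*} [NormedAddCommGroup E] [NormedSpace ℝ E] {f : E → ℂ} {x : E}
    (h : AnalyticAt ℝ f x) (h0 : f x ≠ 0) (m : ℤ) : AnalyticAt ℝ (fun y => f y ^ m) x := by
  cases m with
  | ofNat n => simpa using h.fun_pow n
  | negSucc n =>
    simp only [zpow_negSucc]
    exact (h.fun_pow (n+1)).fun_inv (by simp [h0])

lemma hm_analytic {g : ℂ × ℂ → ℂ} (hg : ∀ p : ℂ × ℂ, ‖p.1‖ ^ 2 + ‖p.2‖ ^ 2 = 1 → AnalyticAt ℝ g p)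
    (m : ℤ) {z : ℂ} (hz : ‖z‖ < 1) : AnalyticAt ℝ (hm g m) z := by
  have hs := sq1_pos hz
  unfold hm
  refine AnalyticAt.mul ((sq1_analytic hz).ofReal'.zpow' (by exact_mod_cast hs.ne') _) ?_
  refine fc_analyticAt (G := fun p : ℂ × ℝ => g (p.1, sq1 p.1 * Complex.exp (p.2 * Complex.I))) ?_ m
  intro θ
  have h1 : AnalyticAt ℝ (fun p : ℂ × ℝ => (p.1, (sq1 p.1 : ℂ) * Complex.exp (p.2 * Complex.I)))
      (z, θ) := by
    refine analyticAt_fst.prod (AnalyticAt.mul ?_ (analyticAt_expI _ _))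
    exact (AnalyticAt.fun_comp (g := sq1) (f := fun p : ℂ × ℝ => p.1)
      (sq1_analytic hz) analyticAt_fst).ofReal'
  refine AnalyticAt.fun_comp (g := g) (hg _ ?_) h1
  apply sphere_pt hz.le
  rw [norm_mul, Complex.norm_exp_ofReal_mul_I, mul_one, Complex.norm_real, Real.norm_of_nonneg hs.le]

lemma fc_summable_analytic {u : ℝ → ℂ} (hu : ∀ θ, AnalyticAt ℝ u θ)
    (hp : ∀ θ, u (θ + 2 * Real.pi) = u θ) : Summable (fun n => ‖fc u n‖) := by
  have d1 : ∀ θ, AnalyticAt ℝ (deriv u) θ := fun θ => (hu θ).deriv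
  have d2 : ∀ θ, AnalyticAt ℝ (deriv (deriv u)) θ := fun θ => (d1 θ).deriv
  have per : ∀ {v : ℝ → ℂ}, (∀ θ, v (θ + 2 * Real.pi) = v θ) →
      ∀ θ, deriv v (θ + 2 * Real.pi) = deriv v θ := by
    intro v hv θ
    rw [← deriv_comp_add_const]
    congr 1; ext t; exact hv t
  have p1 := per hp
  have p2 := per p1
  have c2 : Continuous (deriv (deriv u)) := continuous_iff_continuousAt.2 fun θ => (d2 θ).continuousAt
  obtain ⟨B, hB⟩ := (isCompact_Icc (a := (0:ℝ)) (b := 2 * Real.pi)).exists_bound_of_continuousOn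
    c2.continuousOn
  refine summable_of_sq_bound (B := B) (fun n => fc_bound (u1 := deriv u) (u2 := deriv (deriv u))
    (fun θ => (hu θ).differentiableAt.hasDerivAt) (fun θ => (d1 θ).differentiableAt.hasDerivAt) c2
    (by simpa using hp 0) (by simpa using p1 0) ?_ n)
  intro θ
  obtain ⟨y, hy, hy'⟩ := Function.Periodic.exists_mem_Ico₀ (f := deriv (deriv u)) p2
    (by positivity) θ
  rw [hy']
  exact hB y ⟨hy.1, hy.2.le⟩

lemma fc_circleInt (F : ℂ → ℂ) (c : ℂ) (r : ℝ) :
    fc (fun θ => F (c + r * Complex.exp (θ * Complex.I)) * (r * Complex.exp (θ * Complex.I))) 0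
      = (2 * Real.pi * Complex.I : ℂ)⁻¹ * ∮ z in C(c, r), F z := by
  unfold fc circleIntegral
  rw [mul_inv (2 * (Real.pi:ℂ)) Complex.I, mul_assoc, ← intervalIntegral.integral_const_mul Complex.I⁻¹]
  congr 1
  refine intervalIntegral.integral_congr (fun θ _ => ?_)
  simp only [deriv_circleMap, circleMap, smul_eq_mul, zero_add, Int.cast_zero, zero_mul, neg_zero,
    Complex.exp_zero, mul_one]
  field_simp

lemma fc_cauchy {F : ℂ → ℂ} {c w : ℂ} {r : ℝ} (hF : DiffContOnCl ℂ F (ball c r))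
    (hw : w ∈ ball c r) :
    fc (fun θ => F (c + r * Complex.exp (θ * Complex.I)) *
      (c + r * Complex.exp (θ * Complex.I) - w)⁻¹ * (r * Complex.exp (θ * Complex.I))) 0 = F w := by
  rw [← hF.two_pi_i_inv_smul_circleIntegral_sub_inv_smul hw, smul_eq_mul,
    ← fc_circleInt (fun z => (z - w)⁻¹ • F z)]
  refine fc_congr (fun θ => ?_) 0
  simp only [smul_eq_mul]; ring

lemma fc_circle_neg {F : ℂ → ℂ} {c : ℂ} {r : ℝ} (hr : 0 < r) (hF : DiffContOnCl ℂ F (ball c r))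
    {n : ℤ} (hn : n < 0) : fc (fun θ => F (c + r * Complex.exp (θ * Complex.I))) n = 0 := by
  obtain ⟨k, rfl⟩ := Int.eq_negSucc_of_lt_zero hn
  have hr' : (r : ℂ) ≠ 0 := by exact_mod_cast hr.ne'
  have h1 := fc_circleInt (fun z => F z * (z - c) ^ k) c r
  have h2 : DiffContOnCl ℂ (fun z => F z * (z - c) ^ k) (ball c r) := by
    have : Differentiable ℂ (fun z : ℂ => (z - c) ^ k) := by fun_prop
    exact hF.smul this.diffContOnCl
  rw [h2.circleIntegral_eq_zero hr.le, mul_zero] at h1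
  have h3 := fc_mul_exp (fun θ => F (c + r * Complex.exp (θ * Complex.I))) (k + 1 : ℕ) 0
  rw [show (Int.negSucc k) = 0 - ((k + 1 : ℕ) : ℤ) by rw [Int.negSucc_eq]; push_cast; ring, ← h3]
  have h4 := fc_const_mul ((r:ℂ)^(k+1)) (fun θ => F (c + r * Complex.exp (θ * Complex.I)) *
     Complex.exp (((k + 1 : ℕ) : ℤ) * θ * Complex.I)) 0
  have h5 : ((r:ℂ)^(k+1)) ≠ 0 := pow_ne_zero _ hr'
  refine (mul_eq_zero.1 (h4.symm.trans ?_)).resolve_left h5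
  rw [← h1]
  refine fc_congr (fun θ => ?_) 0
  rw [show (((((k + 1 : ℕ) : ℤ)) : ℂ) * θ * Complex.I) = ((k + 1 : ℕ) : ℂ) * (θ * Complex.I) by
    push_cast; ring, Complex.exp_nat_mul]
  simp only [add_sub_cancel_left]
  ring

lemma zc_continuous (β κ : ℝ) : Continuous (zc β κ) := by unfold zc; fun_prop

lemma zc_per (β κ θ : ℝ) : zc β κ (θ + 2 * Real.pi) = zc β κ θ := by
  simp only [zc]; rw [exp_per]

lemma line_disc {g : ℂ × ℂ → ℂ} {β : ℝ} (h0 : 0 ≤ β) (h1 : β ≤ 1) (hL : LineHyp g β) (k : ℂ) :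
    ∃ F : ℂ → ℂ, DiffContOnCl ℂ F (ball (cen β ‖k‖ : ℂ) (rad β ‖k‖)) ∧
      ∀ θ, F (zc β ‖k‖ θ) = g (zc β ‖k‖ θ, k * (zc β ‖k‖ θ - β)) := by
  obtain ⟨F, hF1, hF2, hF3⟩ := hL k
  have hr := rad_pos (κ := ‖k‖) h0 h1
  have e1 : ∀ z : ℂ, ‖z - cen β ‖k‖‖ ^ 2 - rad β ‖k‖ ^ 2 =
      (‖z‖ ^ 2 + ‖k‖ ^ 2 * ‖z - β‖ ^ 2 - 1) / (1 + ‖k‖ ^ 2) := by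
    intro z
    rw [circ_id h0 h1]
    field_simp
  have hk : 0 < 1 + ‖k‖ ^ 2 := by positivity
  refine ⟨F, ⟨hF2.mono ?_, (hF1.mono ?_)⟩, fun θ => hF3 _ (zc_mem h0 h1 θ)⟩
  · intro z hz
    rw [mem_ball, dist_eq_norm] at hz
    have := circ_id (κ := ‖k‖) h0 h1 z
    rw [mem_ofPred_eq]
    have h5 : ‖z - cen β ‖k‖‖ ^ 2 - rad β ‖k‖ ^ 2 < 0 := by nlinarith [norm_nonneg (z - cen β ‖k‖)]
    nlinarith [mul_neg_of_pos_of_neg hk h5]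
  · rw [closure_ball _ hr.ne']
    intro z hz
    rw [mem_closedBall, dist_eq_norm] at hz
    have := circ_id (κ := ‖k‖) h0 h1 z
    rw [mem_ofPred_eq]
    have h5 : ‖z - cen β ‖k‖‖ ^ 2 - rad β ‖k‖ ^ 2 ≤ 0 := by nlinarith [norm_nonneg (z - cen β ‖k‖)]
    nlinarith [mul_nonpos_of_nonneg_of_nonpos hk.le h5]

lemma line_cont {g : ℂ × ℂ → ℂ} (hg : ∀ p : ℂ × ℂ, ‖p.1‖ ^ 2 + ‖p.2‖ ^ 2 = 1 → AnalyticAt ℝ g p)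
    {β κ : ℝ} (h0 : 0 ≤ β) (h1 : β ≤ 1) :
    Continuous (fun p : ℝ × ℝ => g (zc β κ p.1, κ * Complex.exp (p.2 * Complex.I) * (zc β κ p.1 - β))) := by
  rw [continuous_iff_continuousAt]
  intro p
  have hz := (zc_continuous β κ)
  refine ContinuousAt.comp (g := g) (hg _ ?_).continuousAt ?_
  · simp only [norm_mul, Complex.norm_exp_ofReal_mul_I, Complex.norm_real, mul_one, mul_pow,
      Real.norm_eq_abs, sq_abs]
    exact zc_mem h0 h1 _
  · exact Continuous.continuousAt (by fun_prop)

lemma slice_moment {g : ℂ × ℂ → ℂ}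
    (hg : ∀ p : ℂ × ℂ, ‖p.1‖ ^ 2 + ‖p.2‖ ^ 2 = 1 → AnalyticAt ℝ g p)
    {β κ : ℝ} (h0 : 0 ≤ β) (h1 : β < 1) (hκ : 0 < κ) (hL : LineHyp g β) (m : ℤ) {n : ℤ} (hn : n < 0) :
    fc (fun θ => (zc β κ θ - β) ^ m * hm g m (zc β κ θ)) n = 0 := by
  have hsw := fc_swap (G := fun θ φ => g (zc β κ θ, κ * Complex.exp (φ * Complex.I) * (zc β κ θ - β)))
    (line_cont hg h0 h1.le (κ := κ)) n m
  have h2 : ∀ φ : ℝ, fc (fun θ => g (zc β κ θ, κ * Complex.exp (φ * Complex.I) * (zc β κ θ - β))) n = 0 := by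
    intro φ
    have hk : ‖(κ:ℂ) * Complex.exp (φ * Complex.I)‖ = κ := by
      rw [norm_mul, Complex.norm_exp_ofReal_mul_I, mul_one, Complex.norm_real, Real.norm_of_nonneg hκ.le]
    obtain ⟨F, hF, hFe⟩ := line_disc h0 h1.le hL ((κ:ℂ) * Complex.exp (φ * Complex.I))
    rw [hk] at hF hFe
    rw [← fc_circle_neg (rad_pos h0 h1.le) hF hn]
    exact fc_congr (fun θ => (hFe θ).symm) n
  have h3 : fc (fun φ : ℝ => fc (fun θ => g (zc β κ θ, κ * Complex.exp (φ * Complex.I) * (zc β κ θ - β))) n) m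
      = 0 := by
    rw [fc_congr (v := fun _ => 0) h2]; simp [fc]
  rw [h3] at hsw
  have h4 : ∀ θ, fc (fun φ : ℝ => g (zc β κ θ, κ * Complex.exp (φ * Complex.I) * (zc β κ θ - β))) m
      = (κ:ℂ) ^ m * ((zc β κ θ - β) ^ m * hm g m (zc β κ θ)) := by
    intro θ
    rw [← mul_assoc, ← mul_zpow, ← fc_slice g m (zc_lt_one h0 h1 hκ θ) (sq1_zc h0 h1.le hκ.le θ).symm]
    refine fc_congr (fun φ => ?_) m
    congr 2; ring
  rw [fc_congr h4, fc_const_mul] at hsw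
  have : (κ:ℂ) ^ m ≠ 0 := zpow_ne_zero _ (by exact_mod_cast hκ.ne')
  exact (mul_eq_zero.1 hsw).resolve_left this

/-- multiplication by an affine function of the exponential preserves vanishing of negative modes -/
lemma fc_neg_mul {u : ℝ → ℂ} (hu : Continuous u) (h : ∀ n : ℤ, n < 0 → fc u n = 0) (a b : ℂ) :
    ∀ n : ℤ, n < 0 → fc (fun θ => (a + b * Complex.exp (θ * Complex.I)) * u θ) n = 0 := by
  intro n hn
  have h1 : ∀ θ : ℝ, (a + b * Complex.exp (θ * Complex.I)) * u θ =
      a * u θ + b * (u θ * Complex.exp ((1:ℤ) * θ * Complex.I)) := by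
    intro θ; push_cast; rw [one_mul]; ring
  rw [fc_congr h1, fc_add (by fun_prop) (by fun_prop), fc_const_mul, fc_const_mul, fc_mul_exp,
    h n hn, h (n-1) (by lia)]
  simp

lemma fc_neg_mul_pow {u : ℝ → ℂ} (hu : Continuous u) (h : ∀ n : ℤ, n < 0 → fc u n = 0) (a b : ℂ)
    (M : ℕ) :
    ∀ n : ℤ, n < 0 → fc (fun θ => (a + b * Complex.exp (θ * Complex.I)) ^ M * u θ) n = 0 := by
  induction M with
  | zero => simpa using h
  | succ M ih =>
    intro n hn
    rw [← fc_neg_mul (by fun_prop) ih a b n hn]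
    exact fc_congr (fun θ => by ring) n

lemma hm_zc_continuous {g : ℂ × ℂ → ℂ}
    (hg : ∀ p : ℂ × ℂ, ‖p.1‖ ^ 2 + ‖p.2‖ ^ 2 = 1 → AnalyticAt ℝ g p)
    {β κ : ℝ} (h0 : 0 ≤ β) (h1 : β < 1) (hκ : 0 < κ) (m : ℤ) :
    Continuous (fun θ => hm g m (zc β κ θ)) := by
  rw [continuous_iff_continuousAt]
  intro θ
  exact ContinuousAt.comp (g := hm g m) (hm_analytic hg m (zc_lt_one h0 h1 hκ θ)).continuousAt
    (zc_continuous β κ).continuousAt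

lemma slice_moment' {g : ℂ × ℂ → ℂ}
    (hg : ∀ p : ℂ × ℂ, ‖p.1‖ ^ 2 + ‖p.2‖ ^ 2 = 1 → AnalyticAt ℝ g p)
    {β κ : ℝ} (h0 : 0 ≤ β) (h1 : β < 1) (hκ : 0 < κ) (hL : LineHyp g β) (m : ℤ) {n : ℤ} (hn : n < 0) :
    fc (fun θ => (zc β κ θ - β) ^ m.toNat * hm g m (zc β κ θ)) n = 0 := by
  have hc := hm_zc_continuous hg h0 h1 hκ m
  have hz := zc_continuous β κ
  rcases le_total 0 m with hm0 | hm0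
  · lift m to ℕ using hm0
    simpa using slice_moment hg h0 h1 hκ hL m hn
  · obtain ⟨k, rfl⟩ := Int.exists_eq_neg_ofNat hm0
    have hu : Continuous (fun θ => (zc β κ θ - β) ^ (-(k:ℤ)) * hm g (-(k:ℤ)) (zc β κ θ)) := by
      refine Continuous.mul ?_ hc
      exact (hz.sub continuous_const).zpow₀ _ (fun θ => Or.inl (zc_ne h0 h1 θ))
    have := fc_neg_mul_pow hu (fun n hn => slice_moment hg h0 h1 hκ hL (-(k:ℤ)) hn)
      (cen β κ - β) (rad β κ) k n hn
    rw [← this]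
    refine fc_congr (fun θ => ?_) n
    have e : (cen β κ - β + rad β κ * Complex.exp (θ * Complex.I) : ℂ) = zc β κ θ - β := by
      rw [zc]; ring
    rw [e, ← mul_assoc, zpow_neg, zpow_natCast, mul_inv_cancel₀ (pow_ne_zero _ (zc_ne h0 h1 θ))]
    simp

lemma fc_ext_disc {u : ℝ → ℂ} (hu : ∀ θ, AnalyticAt ℝ u θ) (hp : ∀ θ, u (θ + 2 * Real.pi) = u θ)
    (hneg : ∀ n : ℤ, n < 0 → fc u n = 0) (c : ℂ) {r : ℝ} (hr : 0 < r) :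
    ∃ Φ : ℂ → ℂ, DiffContOnCl ℂ Φ (ball c r) ∧
      ∀ θ : ℝ, Φ (c + r * Complex.exp (θ * Complex.I)) = u θ := by
  obtain ⟨Ψ, hΨ, hΨe⟩ := fc_ext (continuous_iff_continuousAt.2 fun θ => (hu θ).continuousAt) hp
    (fc_summable_analytic hu hp) hneg
  have hr' : (r : ℂ) ≠ 0 := by exact_mod_cast hr.ne'
  refine ⟨fun z => Ψ ((z - c) / r), ?_, fun θ => ?_⟩
  · have h1 : DiffContOnCl ℂ (fun z : ℂ => (z - c) / r) (ball c r) :=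
      Differentiable.diffContOnCl (by fun_prop)
    refine hΨ.comp h1 ?_
    intro z hz
    rw [mem_ball, dist_eq_norm] at hz
    rw [mem_ball_zero_iff, norm_div, Complex.norm_real, Real.norm_of_nonneg hr.le, div_lt_one hr]
    exact hz
  · rw [← hΨe]
    simp only [add_sub_cancel_left, mul_div_cancel_left₀ _ hr']

lemma sphere_param {z c : ℂ} {r : ℝ} (hz : ‖z - c‖ = r) :
    ∃ θ : ℝ, z = c + r * Complex.exp (θ * Complex.I) := by
  refine ⟨(z - c).arg, ?_⟩
  rw [← hz, Complex.norm_mul_exp_arg_mul_I]; ring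

lemma conj_circle {z : ℂ} {c r : ℝ} (hr : 0 < r) (hz : ‖z - c‖ = r) :
    (starRingEnd ℂ) z = c + (r:ℂ) ^ 2 / (z - c) := by
  have h1 : z - c ≠ 0 := by rw [← norm_pos_iff, hz]; exact hr
  rw [← hz, ← Complex.conj_mul']
  field_simp
  simp

lemma core_local {h : ℂ → ℂ} {c : ℕ × ℕ → ℂ} {R : ℝ} (hR : 0 < R)
    (hs : Summable (fun p : ℕ × ℕ => ‖c p‖ * R ^ (p.1 + p.2)))
    (hh : ∀ v : ℂ, ‖v‖ < R → HasSum (fun p : ℕ × ℕ => c p * (v ^ p.1 * (starRingEnd ℂ v) ^ p.2)) (h v))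
    {j K M : ℕ} (hc0 : ∀ i k, i < j → c (i, k) = 0) (hcK : ∀ k, K < k → c (j, k) = 0)
    {β c0 r ρ : ℝ} {Φ : ℂ → ℂ} (hΦ : DiffContOnCl ℂ Φ (ball (c0:ℂ) r))
    (hΦe : ∀ z : ℂ, ‖z - c0‖ = r → Φ z = (z - β) ^ M * h z)
    (hβ : 0 < β) (hβ1 : β < 1) (hcen : β / 2 ≤ c0) (hr1 : r ≤ 1) (hd : c0 < r)
    (hρ0 : 0 < ρ) (hρ1 : ρ ≤ β / 8) (hρ2 : ρ ≤ R * β / 32) (hdρ : r - c0 < ρ / 8) :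
    fc (fun θ => Φ (c0 + r * Complex.exp (θ * Complex.I)) *
      ((c0 + r * Complex.exp (θ * Complex.I)) ^ (j + 1))⁻¹ * (r * Complex.exp (θ * Complex.I))) 0
      = (-β : ℂ) ^ M * ∑ k ∈ Finset.range (K + 1), c (j, k) * ((c0 - r ^ 2 / c0 : ℝ) : ℂ) ^ k := by
  have hc0p : 0 < c0 := by linarith
  have hrp : 0 < r := by linarith
  set σ : ℂ → ℂ := fun z => c0 + (r:ℂ) ^ 2 / (z - c0) with hσ
  have hden : ∀ z : ℂ, ‖z‖ < ρ → β / 4 ≤ ‖z - c0‖ := by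
    intro z hz
    have := norm_sub_norm_le (c0:ℂ) z
    rw [Complex.norm_real, Real.norm_of_nonneg hc0p.le, norm_sub_rev] at this
    linarith
  have hden0 : ∀ z : ℂ, ‖z‖ < ρ → z - c0 ≠ 0 := by
    intro z hz
    rw [← norm_pos_iff]; linarith [hden z hz]
  have hσR : ∀ z : ℂ, ‖z‖ < ρ → ‖σ z‖ < R := by
    intro z hz
    have h1 : σ z = (c0 * z + ((r ^ 2 - c0 ^ 2 : ℝ) : ℂ)) / (z - c0) := by
      have := hden0 z hz
      simp only [hσ]; field_simp; push_cast; ring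
    rw [h1, norm_div, div_lt_iff₀ (by linarith [hden z hz])]
    have h2 : ‖(c0 * z + ((r ^ 2 - c0 ^ 2 : ℝ) : ℂ))‖ ≤ c0 * ‖z‖ + (r ^ 2 - c0 ^ 2) := by
      refine (norm_add_le _ _).trans ?_
      rw [norm_mul, Complex.norm_real, Complex.norm_real, Real.norm_of_nonneg hc0p.le,
        Real.norm_of_nonneg (by nlinarith)]
    have h3 : c0 * ‖z‖ ≤ ρ := by nlinarith [norm_nonneg z]
    have h4 : r ^ 2 - c0 ^ 2 ≤ ρ := by nlinarith
    have h5 : R * (β / 4) ≤ R * ‖z - c0‖ := by gcongr; exact hden z hz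
    have h6 : 0 < R * β := by positivity
    nlinarith
  have hRb : ρ < R := by nlinarith
  -- the function H
  set a : ℕ × ℕ → ℂ := fun p => c (p.1 + j, p.2) with ha
  have hinj : Function.Injective (fun p : ℕ × ℕ => ((p.1 + j, p.2) : ℕ × ℕ)) := by
    rintro ⟨p, q⟩ ⟨p', q'⟩ h
    simp only [Prod.mk.injEq] at h ⊢
    exact ⟨by lia, h.2⟩
  have hsa : Summable (fun p : ℕ × ℕ => ‖a p‖ * R ^ (p.1 + p.2)) := by
    have := (hs.comp_injective hinj).mul_right ((R ^ j)⁻¹)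
    refine this.congr (fun p => ?_)
    simp only [ha, Function.comp]
    rw [show p.1 + j + p.2 = (p.1 + p.2) + j by ring, pow_add]
    field_simp
  have hbd : ∀ (p : ℕ × ℕ) (z : ℂ), z ∈ ball (0:ℂ) ρ →
      ‖a p * (z ^ p.1 * σ z ^ p.2)‖ ≤ ‖a p‖ * R ^ (p.1 + p.2) := by
    intro p z hz
    rw [mem_ball_zero_iff] at hz
    rw [norm_mul, norm_mul, norm_pow, norm_pow, pow_add]
    have := (hσR z hz).le
    have : ‖z‖ ≤ R := by linarith
    gcongr
  set H : ℂ → ℂ := fun z => ∑' p : ℕ × ℕ, a p * (z ^ p.1 * σ z ^ p.2) with hH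
  have hσd : DifferentiableOn ℂ σ (ball 0 ρ) := by
    intro z hz
    rw [mem_ball_zero_iff] at hz
    have := hden0 z hz
    apply DifferentiableAt.differentiableWithinAt
    simp only [hσ]
    fun_prop (disch := assumption)
  have hHd : DifferentiableOn ℂ H (ball 0 ρ) := by
    apply Complex.differentiableOn_tsum_of_summable_norm hsa _ isOpen_ball hbd
    intro p
    exact ((differentiableOn_id.pow _).mul (hσd.pow _)).const_mul _
  have hHsum : ∀ z : ℂ, ‖z‖ < ρ → ‖z - c0‖ = r → h z = z ^ j * H z := by
    intro z hz hzr
    have h1 := hh z (by linarith)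
    rw [conj_circle hrp hzr] at h1
    rw [← hinj.hasSum_iff] at h1
    · have h2 : Summable (fun p : ℕ × ℕ => a p * (z ^ p.1 * σ z ^ p.2)) :=
        Summable.of_norm_bounded hsa (fun p => hbd p z (mem_ball_zero_iff.2 hz))
      refine h1.unique ?_
      refine (h2.hasSum.mul_left (z ^ j)).congr_fun ?_
      intro p
      simp only [ha, hσ, Function.comp]
      rw [pow_add]; ring
    · rintro ⟨i, k⟩ hik
      rw [hc0 i k, zero_mul]
      by_contra hij
      exact hik ⟨(i - j, k), by simp; lia⟩
  have hH0 : H 0 = ∑ k ∈ Finset.range (K + 1), c (j, k) * ((c0 - r ^ 2 / c0 : ℝ) : ℂ) ^ k := by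
    have e1 : σ 0 = ((c0 - r ^ 2 / c0 : ℝ) : ℂ) := by
      simp only [hσ]; push_cast; rw [zero_sub, div_neg]; ring
    simp only [hH]
    rw [tsum_eq_sum (s := (Finset.range (K+1)).image (fun k => (0, k)))]
    · rw [Finset.sum_image (by intro x _ y _ h; simpa using h)]
      refine Finset.sum_congr rfl fun k _ => ?_
      simp [ha, e1]
    · rintro ⟨i, k⟩ hik
      by_cases hi : i = 0
      · subst hi
        have : K < k := by
          by_contra hk
          apply hik
          simp; lia
        simp [ha, hcK k this]
      · simp [hi]
  -- local uniqueness
  set Y : ℂ → ℂ := fun z => (z - β) ^ M * H z with hY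
  have hYd : DifferentiableOn ℂ Y (ball 0 ρ) := by
    refine DifferentiableOn.mul (by fun_prop) hHd
  set δ : ℝ := (r - c0) / 2 with hδ
  have hδ0 : 0 < δ := by simp only [hδ]; linarith
  have hloc : ∀ z : ℂ, ‖z‖ < δ → Φ z = z ^ j * Y z := by
    intro z hz
    have hn1 : ‖z - c0‖ ≤ ‖z‖ + c0 := by
      refine (norm_sub_le _ _).trans ?_
      rw [Complex.norm_real, Real.norm_of_nonneg hc0p.le]
    have hn2 : c0 - ‖z‖ ≤ ‖z - c0‖ := by
      have := norm_sub_norm_le (c0:ℂ) z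
      rwa [Complex.norm_real, Real.norm_of_nonneg hc0p.le, norm_sub_rev] at this
    have hsub : ball z (ρ / 2) ⊆ ball (0:ℂ) ρ := by
      apply ball_subset_ball'
      rw [dist_zero_right]; linarith
    have hq : DifferentiableOn ℂ (fun z => z ^ j * Y z) (ball 0 ρ) :=
      DifferentiableOn.mul (by fun_prop) hYd
    have hcl : closure (ball (c0:ℂ) r) = closedBall (c0:ℂ) r := closure_ball _ hrp.ne'
    have h1 := hΦ.continuousOn
    rw [hcl] at h1
    have := local_uniq (D := fun z => Φ z - z ^ j * Y z) (o := (c0:ℂ)) (r := r) (c := z) (ρ := ρ / 2)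
      ((h1.mono inter_subset_left).sub (hq.continuousOn.mono (inter_subset_right.trans hsub)))
      ((hΦ.differentiableOn.mono inter_subset_left).sub (hq.mono (inter_subset_right.trans hsub)))
      ?_ (by linarith) (by linarith)
    · exact sub_eq_zero.1 this
    · rintro w ⟨hw1, hw2⟩
      rw [mem_sphere, dist_eq_norm] at hw1
      have hw3 := mem_ball_zero_iff.1 (hsub hw2)
      simp only [hY]
      rw [hΦe w hw1, hHsum w hw3 hw1]
      ring
  classical
  set Rf : ℂ → ℂ := fun z => if ‖z‖ < δ then Y z else Φ z * (z ^ j)⁻¹ with hRf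
  have hRf1 : ∀ z : ℂ, ‖z‖ < δ → Rf =ᶠ[nhds z] Y := by
    intro z hz
    filter_upwards [continuous_norm.continuousAt.eventually_lt_const hz] with w hw
    simp [hRf, hw]
  have hRfe : ∀ z : ℂ, z ≠ 0 → Rf z = Φ z * (z ^ j)⁻¹ := by
    intro z hz
    simp only [hRf]
    split_ifs with h1
    · rw [hloc z h1]
      have : z ^ j ≠ 0 := pow_ne_zero _ hz
      field_simp
    · rfl
  have hRf2 : ∀ z : ℂ, z ≠ 0 → Rf =ᶠ[nhds z] fun z => Φ z * (z ^ j)⁻¹ := by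
    intro z hz
    filter_upwards [isOpen_ne.mem_nhds hz] with w hw
    exact hRfe w hw
  have hYat : DifferentiableAt ℂ Y 0 :=
    (hYd 0 (mem_ball_self hρ0)).differentiableAt (ball_mem_nhds 0 hρ0)
  have hRd : DiffContOnCl ℂ Rf (ball (c0:ℂ) r) := by
    refine ⟨?_, ?_⟩
    · intro z hz
      apply DifferentiableAt.differentiableWithinAt
      by_cases hz0 : z = 0
      · subst hz0
        exact hYat.congr_of_eventuallyEq (hRf1 0 (by simpa using hδ0))
      · refine DifferentiableAt.congr_of_eventuallyEq ?_ (hRf2 z hz0)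
        have h1 := hΦ.differentiableAt isOpen_ball hz
        have h2 : z ^ j ≠ 0 := pow_ne_zero _ hz0
        fun_prop (disch := assumption)
    · intro z hz
      by_cases hz0 : z = 0
      · subst hz0
        exact (hYat.continuousAt.congr (hRf1 0 (by simpa using hδ0)).symm).continuousWithinAt
      · have h1 := hΦ.continuousOn z hz
        have h2 : z ^ j ≠ 0 := pow_ne_zero _ hz0
        have h3 : ContinuousWithinAt (fun z => Φ z * (z ^ j)⁻¹) (closure (ball (c0:ℂ) r)) z :=
          h1.mul (ContinuousAt.continuousWithinAt (by fun_prop (disch := assumption)))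
        exact h3.congr_of_eventuallyEq ((hRf2 z hz0).filter_mono nhdsWithin_le_nhds)
          (hRfe z hz0)
  have h0b : (0:ℂ) ∈ ball (c0:ℂ) r := by
    rw [mem_ball, dist_eq_norm, zero_sub, norm_neg, Complex.norm_real, Real.norm_of_nonneg hc0p.le]
    exact hd
  have hfin := fc_cauchy hRd h0b
  have hR0 : Rf 0 = (-β : ℂ) ^ M * H 0 := by
    simp [hRf, hδ0, hY]
  rw [← hH0, ← hR0, ← hfin]
  refine fc_congr (fun θ => ?_) 0
  have hz0 : (c0 + r * Complex.exp (θ * Complex.I) : ℂ) ≠ 0 := by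
    intro h0
    have : ‖(0:ℂ) - c0‖ = r := by
      rw [← h0, add_sub_cancel_left, norm_mul, Complex.norm_exp_ofReal_mul_I, Complex.norm_real,
        Real.norm_of_nonneg hrp.le, mul_one]
    rw [zero_sub, norm_neg, Complex.norm_real, Real.norm_of_nonneg hc0p.le] at this
    linarith
  rw [hRfe _ hz0, sub_zero, pow_succ, mul_inv]
  ring

lemma cr_sq {β κ : ℝ} (h0 : 0 ≤ β) (h1 : β ≤ 1) :
    rad β κ ^ 2 - cen β κ ^ 2 = (1 - κ ^ 2 * β ^ 2) / (1 + κ ^ 2) := by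
  have : β ^ 2 ≤ 1 := by nlinarith
  have h3 : 0 ≤ 1 + κ ^ 2 - κ ^ 2 * β ^ 2 := by nlinarith [sq_nonneg κ]
  have h4 : 1 + κ ^ 2 ≠ 0 := by positivity
  rw [rad, div_pow, Real.sq_sqrt h3, cen]
  field_simp
  ring

lemma cen_lt_rad {β κ : ℝ} (h0 : 0 < β) (h1 : β ≤ 1) (hκ : 0 ≤ κ) (hκ1 : κ < 1 / β) :
    cen β κ < rad β κ := by
  have h2 := cr_sq (κ := κ) h0.le h1
  have h3 : κ * β < 1 := by rwa [lt_div_iff₀ h0] at hκ1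
  have h4 : 0 < (1 - κ ^ 2 * β ^ 2) / (1 + κ ^ 2) := by
    have : 0 ≤ κ * β := by positivity
    have : 0 < 1 - κ ^ 2 * β ^ 2 := by nlinarith
    positivity
  have h5 := rad_pos (κ := κ) h0.le h1
  have h6 : 0 ≤ cen β κ := by unfold cen; positivity
  nlinarith

lemma tau_eq {β κ : ℝ} (h0 : 0 < β) (h1 : β ≤ 1) (hκ : 0 < κ) :
    cen β κ - rad β κ ^ 2 / cen β κ = β - β⁻¹ * (κ ^ 2)⁻¹ := by
  have h2 := cr_sq (κ := κ) h0.le h1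
  have h4 : 1 + κ ^ 2 ≠ 0 := by positivity
  have h6 : 0 < cen β κ := by unfold cen; positivity
  have h7 : cen β κ - rad β κ ^ 2 / cen β κ = - ((1 - κ ^ 2 * β ^ 2) / (1 + κ ^ 2)) / cen β κ := by
    rw [← h2]; field_simp; ring
  rw [h7, cen]
  field_simp
  ring

lemma rad_le_one {β κ : ℝ} : rad β κ ≤ 1 := by
  unfold rad
  rw [div_le_one (by positivity), Real.sqrt_le_left (by positivity)]
  nlinarith [sq_nonneg κ, sq_nonneg (κ * β), sq_nonneg (κ^2)]

lemma zc_ne_zero {β κ : ℝ} (h0 : 0 < β) (h1 : β ≤ 1) (hκ : 0 ≤ κ) (hκ1 : κ < 1 / β) (θ : ℝ) :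
    zc β κ θ ≠ 0 := by
  intro h
  have h2 := zc_norm (κ := κ) h0.le h1 θ
  have h3 := cen_lt_rad h0 h1 hκ hκ1
  have h6 : 0 ≤ cen β κ := by unfold cen; positivity
  rw [h, zero_sub, norm_neg, Complex.norm_real, Real.norm_of_nonneg h6] at h2
  linarith

lemma cen_an {E : Type*} [NormedAddCommGroup E] [NormedSpace ℝ E] {X : E → ℝ} {x : E} {β : ℝ}
    (hX : AnalyticAt ℝ (fun y => X y ^ 2) x) : AnalyticAt ℝ (fun y => cen β (X y)) x := by
  unfold cen
  exact (hX.mul analyticAt_const).div (analyticAt_const.add hX) (by positivity)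

lemma rad_an {E : Type*} [NormedAddCommGroup E] [NormedSpace ℝ E] {X : E → ℝ} {x : E} {β : ℝ}
    (h0 : 0 ≤ β) (h1 : β ≤ 1)
    (hX : AnalyticAt ℝ (fun y => X y ^ 2) x) : AnalyticAt ℝ (fun y => rad β (X y)) x := by
  unfold rad
  have h2 : β ^ 2 ≤ 1 := by nlinarith
  have h3 : 0 < 1 + X x ^ 2 - X x ^ 2 * β ^ 2 := by nlinarith [sq_nonneg (X x)]
  refine AnalyticAt.div ?_ (analyticAt_const.add hX) (by positivity)
  exact AnalyticAt.fun_comp (g := Real.sqrt) (analyticAt_rsqrt h3)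
    ((analyticAt_const.add hX).sub (hX.mul analyticAt_const))

lemma zc_an {E : Type*} [NormedAddCommGroup E] [NormedSpace ℝ E] {X : E → ℝ} {x : E} {β : ℝ}
    (h0 : 0 ≤ β) (h1 : β ≤ 1) (θ : ℝ)
    (hX : AnalyticAt ℝ (fun y => X y ^ 2) x) :
    AnalyticAt ℝ (fun p : E × ℝ => zc β (X p.1) p.2) (x, θ) := by
  unfold zc
  have hX' : AnalyticAt ℝ (fun p : E × ℝ => X p.1 ^ 2) (x, θ) :=
    AnalyticAt.fun_comp (g := fun y => X y ^ 2) (f := fun p : E × ℝ => p.1) hX analyticAt_fst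
  exact (cen_an (X := fun p : E × ℝ => X p.1) hX').ofReal'.add
    ((rad_an (X := fun p : E × ℝ => X p.1) h0 h1 hX').ofReal'.mul (analyticAt_expI _ _))

lemma radE_an {E : Type*} [NormedAddCommGroup E] [NormedSpace ℝ E] {X : E → ℝ} {x : E} {β : ℝ}
    (h0 : 0 ≤ β) (h1 : β ≤ 1) (θ : ℝ)
    (hX : AnalyticAt ℝ (fun y => X y ^ 2) x) :
    AnalyticAt ℝ (fun p : E × ℝ => (rad β (X p.1) * Complex.exp (p.2 * Complex.I) : ℂ)) (x, θ) := by
  have hX' : AnalyticAt ℝ (fun p : E × ℝ => X p.1 ^ 2) (x, θ) :=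
    AnalyticAt.fun_comp (g := fun y => X y ^ 2) (f := fun p : E × ℝ => p.1) hX analyticAt_fst
  exact (rad_an (X := fun p : E × ℝ => X p.1) h0 h1 hX').ofReal'.mul (analyticAt_expI _ _)

noncomputable def Tk (h : ℂ → ℂ) (β : ℝ) (M j : ℕ) (κ : ℝ) : ℂ :=
  fc (fun θ => (zc β κ θ - β) ^ M * h (zc β κ θ) * (zc β κ θ ^ (j + 1))⁻¹ *
    (rad β κ * Complex.exp (θ * Complex.I))) 0

lemma Tk_an {h : ℂ → ℂ} (hh : ∀ z : ℂ, ‖z‖ < 1 → AnalyticAt ℝ h z) {β κ : ℝ} (h0 : 0 < β)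
    (h1 : β < 1) (hκ : 0 < κ) (hκ1 : κ < 1 / β) (M j : ℕ) : AnalyticAt ℝ (Tk h β M j) κ := by
  unfold Tk
  refine fc_analyticAt (G := fun p : ℝ × ℝ => (zc β p.1 p.2 - β) ^ M * h (zc β p.1 p.2) *
    (zc β p.1 p.2 ^ (j + 1))⁻¹ * (rad β p.1 * Complex.exp (p.2 * Complex.I))) (fun θ => ?_) 0
  have hX : AnalyticAt ℝ (fun y : ℝ => y ^ 2) κ := analyticAt_id.pow 2
  have hz := zc_an (X := fun y => y) h0.le h1.le θ hX
  have hr := radE_an (X := fun y => y) h0.le h1.le θ hX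
  refine (((((hz.sub analyticAt_const).fun_pow M).mul ?_).mul ((hz.fun_pow (j+1)).fun_inv ?_))).mul hr
  · exact AnalyticAt.fun_comp (g := h) (f := fun p : ℝ × ℝ => zc β p.1 p.2)
      (hh _ (zc_lt_one h0.le h1 hκ θ)) hz
  · exact pow_ne_zero _ (zc_ne_zero h0 h1.le hκ.le hκ1 θ)

lemma core_step {h : ℂ → ℂ} (han : ∀ z : ℂ, ‖z‖ < 1 → AnalyticAt ℝ h z)
    {c : ℕ × ℕ → ℂ} {R : ℝ} (hR : 0 < R)
    (hs : Summable (fun p : ℕ × ℕ => ‖c p‖ * R ^ (p.1 + p.2)))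
    (hh : ∀ v : ℂ, ‖v‖ < R → HasSum (fun p : ℕ × ℕ => c p * (v ^ p.1 * (starRingEnd ℂ v) ^ p.2)) (h v))
    {j K M : ℕ} (hc0 : ∀ i k, i < j → c (i, k) = 0) (hcK : ∀ k, K < k → c (j, k) = 0)
    {β : ℝ} (h0 : 0 < β) (h1 : β < 1)
    (H1 : ∀ κ : ℝ, 0 < κ → ∀ n : ℤ, n < 0 →
      fc (fun θ => (zc β κ θ - β) ^ M * h (zc β κ θ)) n = 0)
    (H2 : ∃ B ε : ℝ, 0 < ε ∧ ∀ κ, 0 < κ → κ < ε → ‖Tk h β M j κ‖ ≤ B) :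
    ∀ k, 1 ≤ k → c (j, k) = 0 := by
  set P : Polynomial ℂ := ∑ k ∈ Finset.range (K + 1), Polynomial.C (c (j, k)) * Polynomial.X ^ k with hP
  have hPe : ∀ w : ℂ, P.eval w = ∑ k ∈ Finset.range (K + 1), c (j, k) * w ^ k := by
    intro w; simp [hP, Polynomial.eval_finsetSum]
  set τ : ℝ → ℝ := fun κ => β - β⁻¹ * (κ ^ 2)⁻¹ with hτ
  set Q : ℝ → ℂ := fun κ => (-β : ℂ) ^ M * ∑ k ∈ Finset.range (K + 1), c (j, k) * ((τ κ : ℝ) : ℂ) ^ k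
    with hQ
  have hβi : 0 < 1 / β := by positivity
  have hconn : IsPreconnected (Ioo (0:ℝ) (1 / β)) := isPreconnected_Ioo
  have hTa : AnalyticOnNhd ℝ (Tk h β M j) (Ioo 0 (1 / β)) := fun κ hκ => Tk_an han h0 h1 hκ.1 hκ.2 M j
  have hQa : AnalyticOnNhd ℝ Q (Ioo 0 (1 / β)) := by
    intro κ hκ
    have h3 : AnalyticAt ℝ τ κ := by
      refine analyticAt_const.sub (analyticAt_const.mul ?_)
      exact (analyticAt_id.fun_pow 2).fun_inv (by simpa using hκ.1.ne')
    refine analyticAt_const.mul ?_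
    refine Finset.analyticAt_fun_sum _ (fun k _ => ?_)
    exact analyticAt_const.mul (h3.ofReal'.fun_pow k)
  -- near 1/β
  have hev : ∀ᶠ κ in nhdsWithin (1 / β) (Iio (1 / β)), Tk h β M j κ = Q κ := by
    set ρ : ℝ := min (β / 8) (R * β / 32) with hρ
    have hρ0 : 0 < ρ := by positivity
    have hX : AnalyticAt ℝ (fun y : ℝ => y ^ 2) (1 / β) := analyticAt_id.pow 2
    have cc : ContinuousAt (fun κ => cen β κ) (1 / β) :=
      (cen_an (X := fun y => y) hX).continuousAt
    have cr : ContinuousAt (fun κ => rad β κ) (1 / β) :=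
      (rad_an (X := fun y => y) h0.le h1.le hX).continuousAt
    have v1 : cen β (1 / β) = β / (1 + β ^ 2) := by unfold cen; field_simp; ring
    have v2 : rad β (1 / β) - cen β (1 / β) = 0 := by
      have e1 := cr_sq (κ := 1 / β) h0.le h1.le
      have e2 : rad β (1 / β) ^ 2 - cen β (1 / β) ^ 2 = 0 := by rw [e1]; field_simp; simp
      have e3 := rad_pos (κ := 1 / β) h0.le h1.le
      have e4 : 0 < cen β (1 / β) := by rw [v1]; positivity
      have : (rad β (1 / β) - cen β (1 / β)) * (rad β (1 / β) + cen β (1 / β)) = 0 := by linarith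
      rcases mul_eq_zero.1 this with h | h
      · exact h
      · linarith
    have w1 : ∀ᶠ κ in nhds (1 / β), β / 2 < cen β κ := by
      refine cc.eventually_const_lt ?_
      show β / 2 < cen β (1 / β)
      rw [v1, div_lt_div_iff₀ (by norm_num) (by positivity)]
      nlinarith
    have w2 : ∀ᶠ κ in nhds (1 / β), rad β κ - cen β κ < ρ / 8 := by
      refine (cr.sub cc).eventually_lt_const ?_
      show rad β (1 / β) - cen β (1 / β) < ρ / 8
      rw [v2]; positivity
    filter_upwards [nhdsWithin_le_nhds w1, nhdsWithin_le_nhds w2,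
      nhdsWithin_le_nhds (lt_mem_nhds hβi), self_mem_nhdsWithin] with κ k1 k2 k3 k4
    have hz := zc_an (X := fun y => y) (x := κ) h0.le h1.le
    have hu : ∀ θ, AnalyticAt ℝ (fun θ => (zc β κ θ - β) ^ M * h (zc β κ θ)) θ := by
      intro θ
      have hz' : AnalyticAt ℝ (fun θ : ℝ => zc β κ θ) θ :=
        AnalyticAt.fun_comp (g := fun p : ℝ × ℝ => zc β p.1 p.2) (f := fun θ => (κ, θ))
          (hz θ (analyticAt_id.pow 2)) (analyticAt_const.prod analyticAt_id)
      exact ((hz'.sub analyticAt_const).fun_pow M).mul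
        (AnalyticAt.fun_comp (g := h) (han _ (zc_lt_one h0.le h1 k3 θ)) hz')
    obtain ⟨Φ, hΦ, hΦe⟩ := fc_ext_disc hu (fun θ => by rw [zc_per]) (H1 κ k3) (cen β κ : ℂ)
      (rad_pos (κ := κ) h0.le h1.le)
    have := core_local (Φ := Φ) (c0 := cen β κ) (r := rad β κ) (ρ := ρ) (β := β) (M := M) hR hs hh
      hc0 hcK hΦ
      (fun z hz => by
        obtain ⟨θ, hθ⟩ := sphere_param hz
        rw [hθ, hΦe θ]; rfl) h0 h1 k1.le rad_le_one
        (cen_lt_rad h0 h1.le k3.le k4) hρ0 (min_le_left _ _) (min_le_right _ _) k2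
    rw [tau_eq h0 h1.le k3] at this
    simp only [hQ, hτ]
    rw [← this, Tk]
    refine fc_congr (fun θ => ?_) 0
    rw [hΦe θ]; rfl
  obtain ⟨κ2, hκ2, hsub⟩ := (mem_nhdsLT_iff_exists_mem_Ico_Ioo_subset hβi).1 hev
  have hEq : EqOn (Tk h β M j) Q (Ioo 0 (1 / β)) := by
    have hmid : (κ2 + 1 / β) / 2 ∈ Ioo κ2 (1 / β) := ⟨by linarith [hκ2.2], by linarith [hκ2.2]⟩
    refine hTa.eqOn_of_preconnected_of_eventuallyEq hQa hconn (z₀ := (κ2 + 1 / β) / 2)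
      ⟨by linarith [hmid.1, hκ2.1], hmid.2⟩ ?_
    filter_upwards [Ioo_mem_nhds hmid.1 hmid.2] with κ hκ using hsub hκ
  -- limit at 0
  obtain ⟨B, ε, hε, hB⟩ := H2
  have hτlim : Filter.Tendsto (fun κ : ℝ => ‖((τ κ : ℝ) : ℂ)‖) (nhdsWithin 0 (Ioi 0)) Filter.atTop := by
    simp only [Complex.norm_real]
    refine Filter.tendsto_abs_atBot_atTop.comp ?_
    simp only [hτ]
    have e1 : Filter.Tendsto (fun κ : ℝ => (κ ^ 2)⁻¹) (nhdsWithin 0 (Ioi 0)) Filter.atTop := by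
      have : Filter.Tendsto (fun κ : ℝ => κ⁻¹ ^ 2) (nhdsWithin 0 (Ioi 0)) Filter.atTop :=
        (Filter.tendsto_pow_atTop two_ne_zero).comp tendsto_inv_nhdsGT_zero
      simpa using this
    have e2 := (e1.const_mul_atTop (inv_pos.2 h0))
    exact Filter.tendsto_atBot_add_const_left _ β (Filter.tendsto_neg_atTop_atBot.comp e2)
  have hdeg : P.degree ≤ 0 := by
    by_contra hd
    have hd' : 0 < P.degree := not_le.1 hd
    have hlim := P.tendsto_norm_atTop hd' hτlim
    have hev2 := hlim.eventually_gt_atTop (B / β ^ M)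
    have hev3 : ∀ᶠ κ in nhdsWithin (0:ℝ) (Ioi 0), κ < min ε (1 / β) :=
      nhdsWithin_le_nhds (gt_mem_nhds (by positivity))
    obtain ⟨κ, hκ1, hκ2, hκ3⟩ := (hev2.and (hev3.and self_mem_nhdsWithin)).exists
    have hκ3' : 0 < κ := hκ3
    have b1 := hB κ hκ3' (hκ2.trans_le (min_le_left _ _))
    rw [hEq ⟨hκ3', hκ2.trans_le (min_le_right _ _)⟩] at b1
    simp only [hQ] at b1
    rw [← hPe, norm_mul, norm_pow, norm_neg, Complex.norm_real, Real.norm_of_nonneg h0.le] at b1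
    rw [div_lt_iff₀ (by positivity)] at hκ1
    linarith
  intro k hk
  by_cases hkK : K < k
  · exact hcK k hkK
  · have h5 : P.coeff k = c (j, k) := by
      simp only [hP, Polynomial.finsetSum_coeff, Polynomial.coeff_C_mul, Polynomial.coeff_X_pow]
      rw [Finset.sum_eq_single k]
      · simp
      · intro b _ hb; simp [hb.symm]
      · intro h; exact absurd (Finset.mem_range.2 (by lia)) h
    rw [← h5]
    refine Polynomial.coeff_eq_zero_of_degree_lt (hdeg.trans_lt ?_)
    exact_mod_cast hk

lemma sphere2_bound {g : ℂ × ℂ → ℂ}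
    (hg : ∀ p : ℂ × ℂ, ‖p.1‖ ^ 2 + ‖p.2‖ ^ 2 = 1 → AnalyticAt ℝ g p) :
    ∃ B : ℝ, 0 ≤ B ∧ ∀ p : ℂ × ℂ, ‖p.1‖ ^ 2 + ‖p.2‖ ^ 2 = 1 → ‖g p‖ ≤ B := by
  have hcl : IsClosed {p : ℂ × ℂ | ‖p.1‖ ^ 2 + ‖p.2‖ ^ 2 = 1} :=
    isClosed_eq (by fun_prop) continuous_const
  have hcomp : IsCompact {p : ℂ × ℂ | ‖p.1‖ ^ 2 + ‖p.2‖ ^ 2 = 1} := by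
    refine (isCompact_closedBall (0 : ℂ × ℂ) 1).of_isClosed_subset hcl ?_
    intro p hp
    have hp' : ‖p.1‖ ^ 2 + ‖p.2‖ ^ 2 = 1 := hp
    rw [mem_closedBall_zero_iff, Prod.norm_def, max_le_iff]
    constructor
    · nlinarith [sq_nonneg ‖p.2‖, norm_nonneg p.1]
    · nlinarith [sq_nonneg ‖p.1‖, norm_nonneg p.2]
  obtain ⟨B, hB⟩ := hcomp.exists_bound_of_continuousOn
    (f := g) (fun p hp => (hg p hp).continuousAt.continuousWithinAt)
  exact ⟨max B 0, le_max_right _ _, fun p hp => (hB p hp).trans (le_max_left _ _)⟩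

lemma zc_half {β κ : ℝ} (h0 : 0 ≤ β) (h1 : β < 1) (hκ : 0 < κ) (hκ1 : κ < 2 / 5) (θ : ℝ) :
    1 / 2 ≤ ‖zc β κ θ‖ ∧ ‖zc β κ θ - β‖ ≤ 2 := by
  have h2 := zc_mem h0 h1.le (κ := κ) θ
  have h3 := zc_lt_one h0 h1 hκ θ
  have h4 : ‖zc β κ θ - β‖ ≤ 2 := by
    refine (norm_sub_le _ _).trans ?_
    rw [Complex.norm_real, Real.norm_of_nonneg h0]; linarith
  refine ⟨?_, h4⟩
  have h5 : ‖zc β κ θ - β‖ ^ 2 ≤ 4 := by nlinarith [norm_nonneg (zc β κ θ - β)]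
  have h6 : κ ^ 2 ≤ 4 / 25 := by nlinarith
  have h7 : κ ^ 2 * ‖zc β κ θ - β‖ ^ 2 ≤ 4 / 25 * 4 := by gcongr
  nlinarith [norm_nonneg (zc β κ θ)]

lemma Tk_bound {h : ℂ → ℂ} {β κ B : ℝ} (h0 : 0 ≤ β) (h1 : β < 1) (hκ : 0 < κ) (hκ1 : κ < 2 / 5)
    (hB : ∀ z : ℂ, ‖z‖ < 1 → ‖h z‖ ≤ B) (M j : ℕ) : ‖Tk h β M j κ‖ ≤ 2 ^ M * B * 2 ^ (j + 1) := by
  have hB0 : 0 ≤ B := (norm_nonneg _).trans (hB 0 (by simp))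
  refine fc_norm_le (fun θ => ?_) 0
  obtain ⟨a1, a2⟩ := zc_half h0 h1 hκ hκ1 θ
  have a3 := hB _ (zc_lt_one h0 h1 hκ θ)
  have a4 : ‖(rad β κ * Complex.exp (θ * Complex.I) : ℂ)‖ ≤ 1 := by
    rw [norm_mul, Complex.norm_exp_ofReal_mul_I, mul_one, Complex.norm_real,
      Real.norm_of_nonneg (rad_pos h0 h1.le).le]
    exact rad_le_one
  have a5 : ‖(zc β κ θ ^ (j+1))⁻¹‖ ≤ 2 ^ (j + 1) := by
    rw [norm_inv, norm_pow, ← inv_pow]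
    gcongr
    rw [inv_le_comm₀ (by linarith) (by norm_num)]
    linarith
  calc _ = ‖zc β κ θ - β‖ ^ M * ‖h (zc β κ θ)‖ * ‖(zc β κ θ ^ (j+1))⁻¹‖ *
        ‖(rad β κ * Complex.exp (θ * Complex.I) : ℂ)‖ := by rw [norm_mul, norm_mul, norm_mul, norm_pow]
    _ ≤ 2 ^ M * B * 2 ^ (j + 1) * 1 := by gcongr
    _ = _ := by ring

lemma hm_H2 {g : ℂ × ℂ → ℂ} (hg : ∀ p : ℂ × ℂ, ‖p.1‖ ^ 2 + ‖p.2‖ ^ 2 = 1 → AnalyticAt ℝ g p)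
    {β : ℝ} (h0 : 0 < β) (h1 : β < 1) (m : ℤ) (j : ℕ) :
    ∃ B ε : ℝ, 0 < ε ∧ ∀ κ, 0 < κ → κ < ε → ‖Tk (hm g m) β m.toNat j κ‖ ≤ B := by
  rcases le_total 0 m with hm0 | hm0
  swap
  · obtain ⟨B, hB0, hB⟩ := sphere2_bound hg
    refine ⟨2 ^ m.toNat * B * 2 ^ (j + 1), 2 / 5, by norm_num, fun κ k1 k2 =>
      Tk_bound h0.le h1 k1 k2 (fun z hz => ?_) _ _⟩
    have hs := sq1_pos hz
    obtain ⟨k, rfl⟩ := Int.exists_eq_neg_ofNat hm0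
    rw [hm, neg_neg, zpow_natCast, norm_mul, norm_pow, Complex.norm_real, Real.norm_of_nonneg hs.le]
    have hs1 : sq1 z ≤ 1 := by
      unfold sq1
      rw [Real.sqrt_le_left (by norm_num)]; nlinarith [norm_nonneg z]
    have : ‖fc (fun φ => g (z, sq1 z * Complex.exp (φ * Complex.I))) (-(k:ℤ))‖ ≤ B := by
      refine fc_norm_le (fun θ => hB _ (sphere_pt hz.le ?_)) _
      rw [norm_mul, Complex.norm_exp_ofReal_mul_I, mul_one, Complex.norm_real, Real.norm_of_nonneg hs.le]
    calc _ ≤ 1 ^ k * B := by gcongr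
      _ = B := by simp
  · lift m to ℕ using hm0
    simp only [Int.toNat_natCast]
    set A : ℂ → ℂ := fun k => fc (fun θ => g (zc β ‖k‖ θ, k * (zc β ‖k‖ θ - β)) *
      ((zc β ‖k‖ θ ^ (j + 1))⁻¹ * (rad β ‖k‖ * Complex.exp (θ * Complex.I)))) 0 with hA
    have hAa : AnalyticAt ℝ A 0 := by
      refine fc_analyticAt (G := fun p : ℂ × ℝ => g (zc β ‖p.1‖ p.2, p.1 * (zc β ‖p.1‖ p.2 - β)) *
        ((zc β ‖p.1‖ p.2 ^ (j + 1))⁻¹ * (rad β ‖p.1‖ * Complex.exp (p.2 * Complex.I)))) (fun θ => ?_) 0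
      have hX := analyticAt_normSq' 0
      have hz := zc_an (X := fun k : ℂ => ‖k‖) h0.le h1.le θ hX
      have hr := radE_an (X := fun k : ℂ => ‖k‖) h0.le h1.le θ hX
      refine AnalyticAt.mul ?_ (((hz.fun_pow (j+1)).fun_inv ?_).mul hr)
      · refine AnalyticAt.fun_comp (g := g)
          (f := fun p : ℂ × ℝ => (zc β ‖p.1‖ p.2, p.1 * (zc β ‖p.1‖ p.2 - β))) (hg _ ?_) ?_
        · simp only [norm_mul, mul_pow]
          exact zc_mem h0.le h1.le θ
        · exact hz.prod (analyticAt_fst.mul (hz.sub analyticAt_const))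
      · exact pow_ne_zero _ (zc_ne_zero h0 h1.le (by simp) (by simp [h0]) θ)
    obtain ⟨R, hR, c, hs, hh⟩ := expand_C hAa
    simp only [zero_add] at hh
    obtain ⟨C, hC⟩ := fc_growth hR hs hh m
    refine ⟨C, min R (1 / β), by positivity, fun κ k1 k2 => ?_⟩
    have k3 := hC κ k1.le (k2.trans_le (min_le_left _ _))
    have hκβ : κ < 1 / β := k2.trans_le (min_le_right _ _)
    have key : fc (fun θ => A (κ * Complex.exp (θ * Complex.I))) m = (κ:ℂ) ^ m * Tk (hm g m) β m j κ := by
      have hsw := fc_swap (G := fun θ φ => g (zc β κ θ, κ * Complex.exp (φ * Complex.I) * (zc β κ θ - β)) *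
        ((zc β κ θ ^ (j + 1))⁻¹ * (rad β κ * Complex.exp (θ * Complex.I))))
        (by
          have hz := zc_continuous β κ
          refine (line_cont hg h0.le h1.le (κ := κ)).mul (Continuous.mul ?_ (by fun_prop))
          exact Continuous.inv₀ (by fun_prop)
            (fun p => pow_ne_zero _ (zc_ne_zero h0 h1.le k1.le hκβ _))) 0 m
      have e1 : fc (fun θ => A (κ * Complex.exp (θ * Complex.I))) m = fc (fun φ : ℝ => fc (fun θ =>
          g (zc β κ θ, κ * Complex.exp (φ * Complex.I) * (zc β κ θ - β)) *
        ((zc β κ θ ^ (j + 1))⁻¹ * (rad β κ * Complex.exp (θ * Complex.I)))) 0) m := by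
        refine fc_congr (fun φ => ?_) m
        have hk : ‖(κ:ℂ) * Complex.exp (φ * Complex.I)‖ = κ := by
          rw [norm_mul, Complex.norm_exp_ofReal_mul_I, mul_one, Complex.norm_real,
            Real.norm_of_nonneg k1.le]
        simp only [hA, hk]
      rw [e1, ← hsw, Tk, ← fc_const_mul]
      refine fc_congr (fun θ => ?_) 0
      have e2 : ∀ φ : ℝ, g (zc β κ θ, κ * Complex.exp (φ * Complex.I) * (zc β κ θ - β)) *
        ((zc β κ θ ^ (j + 1))⁻¹ * (rad β κ * Complex.exp (θ * Complex.I))) =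
        ((zc β κ θ ^ (j + 1))⁻¹ * (rad β κ * Complex.exp (θ * Complex.I))) *
          g (zc β κ θ, κ * (zc β κ θ - β) * Complex.exp (φ * Complex.I)) := by
        intro φ
        rw [mul_comm (g _)]
        congr 3; ring
      rw [fc_congr e2, fc_const_mul,
        fc_slice g m (zc_lt_one h0.le h1 k1 θ) (sq1_zc h0.le h1.le k1.le θ).symm, zpow_natCast, mul_pow]
      ring
    rw [key, norm_mul, norm_pow, Complex.norm_real, Real.norm_of_nonneg k1.le, Int.natAbs_natCast,
      mul_comm] at k3
    exact le_of_mul_le_mul_right k3 (by positivity)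

lemma slice_zero {g : ℂ × ℂ → ℂ} (hg : ∀ p : ℂ × ℂ, ‖p.1‖ ^ 2 + ‖p.2‖ ^ 2 = 1 → AnalyticAt ℝ g p)
    (hL : LineHyp g 0) (m : ℤ) {ρ : ℝ} (hρ : 0 < ρ) (hρ1 : ρ < 1) {l : ℤ} (hl : l < -m.toNat) :
    fc (fun θ => hm g m (ρ * Complex.exp (θ * Complex.I))) l = 0 := by
  set κ := Real.sqrt (1 / ρ ^ 2 - 1) with hκ
  have h1 : 0 < 1 / ρ ^ 2 - 1 := by
    rw [sub_pos, lt_div_iff₀ (by positivity)]; nlinarith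
  have hκ0 : 0 < κ := Real.sqrt_pos.2 h1
  have hκ2 : κ ^ 2 = 1 / ρ ^ 2 - 1 := Real.sq_sqrt h1.le
  have hz : ∀ θ, zc 0 κ θ = ρ * Complex.exp (θ * Complex.I) := by
    intro θ
    have e1 : cen 0 κ = 0 := by simp [cen]
    have e2 : rad 0 κ = ρ := by
      rw [rad, hκ2, show 1 + (1 / ρ ^ 2 - 1) - (1 / ρ ^ 2 - 1) * 0 ^ 2 = (1 / ρ) ^ 2 by
        field_simp; ring, Real.sqrt_sq (by positivity)]
      field_simp
      ring
    rw [zc, e1, e2]; simp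
  have h2 := slice_moment' hg le_rfl one_pos hκ0 hL m (n := l + m.toNat) (by lia)
  have e3 : ∀ θ : ℝ, (zc 0 κ θ - (0:ℝ)) ^ m.toNat * hm g m (zc 0 κ θ) = (ρ:ℂ) ^ m.toNat *
      (hm g m (ρ * Complex.exp (θ * Complex.I)) * Complex.exp ((m.toNat : ℤ) * θ * Complex.I)) := by
    intro θ
    rw [hz, show (((m.toNat : ℤ):ℂ) * θ * Complex.I) = (m.toNat : ℂ) * (θ * Complex.I) by push_cast; ring,
      Complex.exp_nat_mul]
    push_cast; ring
  rw [fc_congr e3, fc_const_mul, fc_mul_exp, add_sub_cancel_right] at h2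
  exact (mul_eq_zero.1 h2).resolve_left (pow_ne_zero _ (by exact_mod_cast hρ.ne'))

lemma interior_hol {g : ℂ × ℂ → ℂ} (hg : ∀ p : ℂ × ℂ, ‖p.1‖ ^ 2 + ‖p.2‖ ^ 2 = 1 → AnalyticAt ℝ g p)
    {β : ℝ} (h0 : 0 < β) (h1 : β < 1) (hL0 : LineHyp g 0) (hL : LineHyp g β) (m : ℤ) :
    DifferentiableOn ℂ (hm g m) (ball 0 1) := by
  have han : ∀ z : ℂ, ‖z‖ < 1 → AnalyticAt ℝ (hm g m) z := fun z hz => hm_analytic hg m hz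
  set M := m.toNat with hM
  obtain ⟨R, hR, c, hs, hh⟩ := expand_C (han 0 (by simp))
  simp only [zero_add] at hh
  have hlow : ∀ p q : ℕ, (p:ℤ) - q < -M → c (p, q) = 0 := by
    intro p q hpq
    refine uniq2 hR (R' := min R 1) (by positivity) hs _ (fun ρ r1 r2 => ?_) p q rfl
    have := fc_expand hs hh ((p:ℤ) - q) r1.le (r2.trans_le (min_le_left _ _))
    rwa [slice_zero hg hL0 m r1 (r2.trans_le (min_le_right _ _)) hpq] at this
  have hmain : ∀ j : ℕ, ∀ i, i < j → ∀ k, 1 ≤ k → c (i, k) = 0 := by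
    intro j
    induction j with
    | zero => intro i hi; lia
    | succ j ih =>
      intro i hi k hk
      rcases Nat.lt_succ_iff_lt_or_eq.1 hi with hi | rfl
      · exact ih i hi k hk
      set p : ℂ → ℂ := fun z => ∑ l ∈ Finset.range i, c (l, 0) * z ^ l with hp
      set c' : ℕ × ℕ → ℂ := fun q => if q.1 < i then 0 else c q with hc'
      have hpd : Differentiable ℂ p := by simp only [hp]; fun_prop
      have hpa : ∀ z, AnalyticAt ℝ p z := fun z => by
        refine Finset.analyticAt_fun_sum _ (fun k _ => ?_)
        exact analyticAt_const.mul (analyticAt_id.fun_pow k)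
      have hs' : Summable (fun p : ℕ × ℕ => ‖c' p‖ * R ^ (p.1 + p.2)) := by
        refine Summable.of_nonneg_of_le (fun p => by positivity) (fun p => ?_) hs
        gcongr
        simp only [hc']
        split_ifs <;> simp
      have hh' : ∀ v : ℂ, ‖v‖ < R → HasSum (fun q : ℕ × ℕ => c' q * (v ^ q.1 * (starRingEnd ℂ v) ^ q.2))
          (hm g m v - p v) := by
        intro v hv
        have e1 : HasSum (fun q : ℕ × ℕ => (if q.1 < i then c q else 0) *
            (v ^ q.1 * (starRingEnd ℂ v) ^ q.2)) (p v) := by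
          have e2 : p v = ∑ q ∈ (Finset.range i).image (fun l => (l, 0)),
              (if q.1 < i then c q else 0) * (v ^ q.1 * (starRingEnd ℂ v) ^ q.2) := by
            rw [Finset.sum_image (by intro x _ y _ h; simpa using h)]
            refine Finset.sum_congr rfl (fun l hl => ?_)
            simp [Finset.mem_range.1 hl]
          rw [e2]
          refine hasSum_sum_of_ne_finset_zero ?_
          rintro ⟨a, b⟩ hab
          by_cases ha : a < i
          · by_cases hb : b = 0
            · exact absurd (Finset.mem_image.2 ⟨a, Finset.mem_range.2 ha, by rw [hb]⟩) hab
            · simp [ih a ha b (by lia)]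
          · simp [ha]
        refine ((hh v hv).sub e1).congr_fun (fun q => ?_)
        simp only [hc']
        split_ifs <;> ring
      have hstep := core_step (h := fun z => hm g m z - p z) (fun z hz => (han z hz).sub (hpa z)) hR hs' hh'
        (j := i) (K := i + M) (M := M) (fun a b ha => by simp [hc', ha])
        (fun b hb => by simp only [hc', lt_irrefl, if_false]; exact hlow i b (by lia)) h0 h1 ?_ ?_ k hk
      · simpa [hc'] using hstep
      · intro κ hκ n hn
        have hz := zc_continuous β κ
        have hmc := hm_zc_continuous hg h0.le h1 hκ m
        have e1 : ∀ θ, (zc β κ θ - β) ^ M * (hm g m (zc β κ θ) - p (zc β κ θ)) =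
          (zc β κ θ - β) ^ M * hm g m (zc β κ θ) - (zc β κ θ - β) ^ M * p (zc β κ θ) := by
          intro θ; ring
        have hpc := hpd.continuous
        rw [fc_congr e1, fc_sub (by fun_prop) (by fun_prop), slice_moment' hg h0.le h1 hκ hL m hn,
          zero_sub, neg_eq_zero]
        exact fc_circle_neg (F := fun z => (z - β) ^ M * p z) (c := cen β κ) (rad_pos h0.le h1.le)
          (Differentiable.diffContOnCl (by fun_prop)) hn
      · obtain ⟨B, ε, hε, hB⟩ := hm_H2 hg h0 h1 m i
        obtain ⟨B', hB'⟩ := (isCompact_closedBall (0:ℂ) 1).exists_bound_of_continuousOn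
          hpd.continuous.continuousOn
        refine ⟨B + 2 ^ M * B' * 2 ^ (i + 1), min ε (min (2 / 5) (1 / β)), by positivity,
          fun κ k1 k2 => ?_⟩
        rw [lt_min_iff, lt_min_iff] at k2
        have hz := zc_continuous β κ
        have hmc := hm_zc_continuous hg h0.le h1 k1 m
        have hpc := hpd.continuous
        have e1 : Tk (fun z => hm g m z - p z) β M i κ = Tk (hm g m) β M i κ - Tk p β M i κ := by
          unfold Tk
          have hzi : Continuous (fun θ => (zc β κ θ ^ (i+1))⁻¹) := Continuous.inv₀ (by fun_prop)
            (fun p => pow_ne_zero _ (zc_ne_zero h0 h1.le k1.le k2.2.2 _))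
          rw [← fc_sub (by fun_prop) (by fun_prop)]
          refine fc_congr (fun θ => ?_) 0
          ring
        rw [e1]
        refine (norm_sub_le _ _).trans (add_le_add (hB κ k1 k2.1) ?_)
        exact Tk_bound h0.le h1 k1 k2.2.1 (fun z hz => hB' z (by simpa using hz.le)) M i
  refine analytic_hol_extend (z0 := 0) (convex_ball (0:ℂ) 1).isPreconnected
    (fun z hz => han z (by simpa using hz)) (by simp) ?_
  have hd : DifferentiableOn ℂ (hm g m) (ball 0 R) := by
    have hinj : Function.Injective (fun i : ℕ => ((i, 0) : ℕ × ℕ)) := fun a b h => by simpa using h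
    have e1 : ∀ z : ℂ, ‖z‖ < R → HasSum (fun i : ℕ => c (i, 0) * z ^ i) (hm g m z) := by
      intro z hz
      have := hh z hz
      rw [← hinj.hasSum_iff] at this
      · simpa [Function.comp_def] using this
      · rintro ⟨a, b⟩ hab
        have : b ≠ 0 := fun h => hab ⟨a, by rw [h]⟩
        rw [hmain (a+1) a (by lia) b (by lia), zero_mul]
    have e2 : Summable (fun i : ℕ => ‖c (i, 0)‖ * R ^ i) := by
      simpa [Function.comp_def] using hs.comp_injective hinj
    have e3 : DifferentiableOn ℂ (fun z => ∑' i : ℕ, c (i, 0) * z ^ i) (ball 0 R) := by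
      refine Complex.differentiableOn_tsum_of_summable_norm e2 (fun i => by fun_prop) isOpen_ball ?_
      intro i w hw
      rw [mem_ball_zero_iff] at hw
      rw [norm_mul, norm_pow]
      gcongr
    refine e3.congr (fun z hz => ((e1 z (by simpa using hz)).tsum_eq).symm)
  filter_upwards [ball_mem_nhds (0:ℂ) hR] with w hw
  exact (hd w hw).differentiableAt (isOpen_ball.mem_nhds hw)

noncomputable def xi (θ : ℝ) : ℂ := Complex.I / 2 * (1 + Complex.exp (θ * Complex.I))

lemma xi_cont : Continuous xi := by unfold xi; fun_prop

lemma xi_conj (θ : ℝ) : (starRingEnd ℂ) (xi θ) * Complex.exp (θ * Complex.I) = - xi θ := by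
  have h1 : Complex.exp (-(θ * Complex.I)) * Complex.exp (θ * Complex.I) = 1 := by
    rw [← Complex.exp_add]; simp
  have h2 : (starRingEnd ℂ) (xi θ) = -Complex.I / 2 * (1 + Complex.exp (-(θ * Complex.I))) := by
    simp only [xi, map_mul, map_div₀, map_add, map_one, Complex.conj_I, ← Complex.exp_conj,
      Complex.conj_ofReal, map_ofNat]
    ring_nf
  rw [h2, xi]
  linear_combination (-Complex.I / 2) * h1

lemma xi_re (θ : ℝ) : ((xi θ).re : ℂ) * (2 * Complex.exp (θ * Complex.I)) =
    xi θ * (Complex.exp (θ * Complex.I) - 1) := by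
  have h := xi_conj θ
  have h2 : ((xi θ).re : ℂ) * 2 = xi θ + (starRingEnd ℂ) (xi θ) := by
    rw [Complex.add_conj]; push_cast; ring
  linear_combination (Complex.exp (θ * Complex.I)) * h2 + h

lemma xi_norm (θ : ℝ) : ‖xi θ‖ ≤ 1 := by
  unfold xi
  rw [norm_mul, norm_div, Complex.norm_I]
  have : ‖(1:ℂ) + Complex.exp (θ * Complex.I)‖ ≤ 1 + 1 := by
    refine (norm_add_le _ _).trans ?_
    rw [Complex.norm_exp_ofReal_mul_I]; simp
  simp; linarith

lemma fc_poly (P : Polynomial ℂ) (n : ℕ) :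
    fc (fun θ => P.eval (Complex.exp (θ * Complex.I))) n = P.coeff n := by
  have h1 : ∀ N : ℕ, ∀ s : Finset ℕ, fc (fun θ => ∑ k ∈ s, P.coeff k * Complex.exp (θ * Complex.I) ^ k) N
      = ∑ k ∈ s, P.coeff k * (if N = k then 1 else 0) := by
    intro N s
    induction s using Finset.induction_on with
    | empty => simp [fc]
    | insert a s ha ih =>
      have e : ∀ θ : ℝ, ∑ k ∈ insert a s, P.coeff k * Complex.exp (θ * Complex.I) ^ k =
        P.coeff a * Complex.exp ((a:ℤ) * θ * Complex.I) +
          ∑ k ∈ s, P.coeff k * Complex.exp (θ * Complex.I) ^ k := by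
        intro θ
        rw [Finset.sum_insert ha, ← Complex.exp_nat_mul]
        congr 3; push_cast; ring
      rw [fc_congr e, fc_add (by fun_prop) (by fun_prop), fc_const_mul, fc_exp, ih, Finset.sum_insert ha]
      norm_cast
  have h2 : ∀ θ : ℝ, P.eval (Complex.exp (θ * Complex.I)) =
      ∑ k ∈ Finset.range (P.natDegree + 1 + n), P.coeff k * Complex.exp (θ * Complex.I) ^ k := by
    intro θ
    rw [Polynomial.eval_eq_sum_range' (n := P.natDegree + 1 + n) (by lia)]
  rw [fc_congr h2, h1, Finset.sum_eq_single n]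
  · simp
  · intro b _ hb; simp [hb.symm]
  · intro h; exact absurd (Finset.mem_range.2 (by lia)) h

lemma trig_poly {c : ℕ → ℂ} {p q : ℕ} (hc : ∀ α, p < α → c α = 0)
    (hneg : ∀ n : ℤ, n < 0 → fc (fun θ => ∑ α ∈ Finset.range (q + 1),
      c α * (((xi θ).re : ℂ) ^ α * xi θ ^ (p - α) * (starRingEnd ℂ) (xi θ) ^ (q - α))) n = 0) :
    ∃ C : ℂ, ∀ θ, ∑ α ∈ Finset.range (q + 1),
      c α * (((xi θ).re : ℂ) ^ α * xi θ ^ (p - α) * (starRingEnd ℂ) (xi θ) ^ (q - α)) = C * xi θ ^ p := by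
  set L : Polynomial ℂ := Polynomial.C (Complex.I / 2) * (1 + Polynomial.X) with hL
  set S : Polynomial ℂ := ∑ α ∈ Finset.range (q + 1),
    Polynomial.C (c α * (1 / 2) ^ α * (-1) ^ (q - α)) * (L ^ (q - α) * (Polynomial.X - 1) ^ α) with hS
  have hLe : ∀ θ : ℝ, L.eval (Complex.exp (θ * Complex.I)) = xi θ := by
    intro θ; simp [hL, xi]
  set Q : ℝ → ℂ := fun θ => ∑ α ∈ Finset.range (q + 1),
      c α * (((xi θ).re : ℂ) ^ α * xi θ ^ (p - α) * (starRingEnd ℂ) (xi θ) ^ (q - α)) with hQ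
  have hkey : ∀ θ, Q θ * Complex.exp (θ * Complex.I) ^ q = (L ^ p * S).eval (Complex.exp (θ * Complex.I)) := by
    intro θ
    simp only [Polynomial.eval_mul, Polynomial.eval_pow, hLe, hS, Polynomial.eval_finsetSum,
      Polynomial.eval_C, Polynomial.eval_sub, Polynomial.eval_X, Polynomial.eval_one, hQ]
    rw [Finset.sum_mul, Finset.mul_sum]
    refine Finset.sum_congr rfl (fun α hα => ?_)
    have hαq : α ≤ q := by have := Finset.mem_range.1 hα; lia
    by_cases hαp : p < α
    · rw [hc α hαp]; ring
    have hαp' : α ≤ p := not_lt.1 hαp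
    have e1 := xi_conj θ
    have e2 : ((xi θ).re : ℂ) * Complex.exp (θ * Complex.I) =
      xi θ * ((1 / 2) * (Complex.exp (θ * Complex.I) - 1)) := by
      linear_combination (1/2) * xi_re θ
    set E := Complex.exp (θ * Complex.I)
    calc _ = c α * ((((xi θ).re : ℂ) * E) ^ α * xi θ ^ (p - α) *
          ((starRingEnd ℂ) (xi θ) * E) ^ (q - α)) := by
          rw [mul_pow, mul_pow]
          conv_lhs => rw [show q = α + (q - α) by lia, pow_add, Nat.add_sub_cancel_left]
          ring
      _ = _ := by
          rw [e1, e2, mul_pow, neg_pow, mul_pow]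
          conv_rhs => rw [show p = α + (p - α) by lia, pow_add]
          ring
  have hQc : Continuous Q := by
    have := xi_cont
    simp only [hQ]
    fun_prop
  have hco : ∀ k, k < q → (L ^ p * S).coeff k = 0 := by
    intro k hk
    rw [← fc_poly, ← fc_congr hkey]
    have e : ∀ θ : ℝ, Q θ * Complex.exp (θ * Complex.I) ^ q = Q θ * Complex.exp ((q:ℤ) * θ * Complex.I) := by
      intro θ
      rw [← Complex.exp_nat_mul]; congr 2; push_cast; ring
    rw [fc_congr e, fc_mul_exp]
    exact hneg _ (by lia)
  have hdvd : Polynomial.X ^ q ∣ L ^ p * S := Polynomial.X_pow_dvd_iff.2 hco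
  have hcop : IsCoprime (Polynomial.X ^ q) (L ^ p) := by
    refine IsCoprime.pow ?_
    refine ⟨-1, Polynomial.C (Complex.I / 2)⁻¹, ?_⟩
    rw [hL, ← mul_assoc, ← Polynomial.C_mul, inv_mul_cancel₀ (by simp)]
    simp
  obtain ⟨T, hT⟩ := hcop.dvd_of_dvd_mul_left hdvd
  have hLdeg : L.natDegree ≤ 1 := by
    rw [hL]
    refine (Polynomial.natDegree_C_mul_le _ _).trans ?_
    refine (Polynomial.natDegree_add_le _ _).trans ?_
    simp
  have hXdeg : (Polynomial.X - 1 : Polynomial ℂ).natDegree ≤ 1 := by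
    refine (Polynomial.natDegree_sub_le _ _).trans ?_
    simp
  have hdeg : S.natDegree ≤ q := by
    rw [hS]
    refine Polynomial.natDegree_sum_le_of_forall_le _ _ (fun α hα => ?_)
    have hαq : α ≤ q := by have := Finset.mem_range.1 hα; lia
    refine (Polynomial.natDegree_C_mul_le _ _).trans ?_
    refine (Polynomial.natDegree_mul_le).trans ?_
    have e1 := Polynomial.natDegree_pow_le_of_le (q - α) hLdeg
    have e2 := Polynomial.natDegree_pow_le_of_le α hXdeg
    lia
  have hTdeg : T.natDegree = 0 := by
    by_cases hT0 : T = 0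
    · simp [hT0]
    rw [hT, Polynomial.natDegree_mul (pow_ne_zero _ Polynomial.X_ne_zero) hT0,
      Polynomial.natDegree_X_pow] at hdeg
    lia
  obtain ⟨C, hC⟩ := Polynomial.natDegree_eq_zero.1 hTdeg
  refine ⟨C, fun θ => ?_⟩
  have hE : Complex.exp (θ * Complex.I) ^ q ≠ 0 := pow_ne_zero _ (Complex.exp_ne_zero _)
  apply mul_right_cancel₀ hE
  have := hkey θ
  rw [hT, ← hC] at this
  simp only [Polynomial.eval_mul, Polynomial.eval_pow, hLe, Polynomial.eval_X, Polynomial.eval_C] at this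
  rw [show (∑ α ∈ Finset.range (q + 1),
      c α * (((xi θ).re : ℂ) ^ α * xi θ ^ (p - α) * (starRingEnd ℂ) (xi θ) ^ (q - α))) = Q θ from rfl, this]
  ring

noncomputable def cz (w : ℂ) : ℂ := (1 + Complex.I * w) / (1 - Complex.I * w)
noncomputable def Gf (g : ℂ × ℂ → ℂ) (p : ℝ × ℂ) : ℂ :=
  g (cz (p.1 + Complex.I * (‖p.2‖ ^ 2 : ℝ)), 2 * p.2 / (1 - Complex.I * (p.1 + Complex.I * (‖p.2‖ ^ 2 : ℝ))))

lemma cz_den {w : ℂ} (hw : 0 ≤ w.im) : 1 - Complex.I * w ≠ 0 := by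
  intro h
  have := congrArg Complex.re h
  simp at this; linarith

lemma cz_sub (w : ℂ) (hw : 0 ≤ w.im) : cz w - 1 = 2 * Complex.I * w / (1 - Complex.I * w) := by
  have := cz_den hw
  unfold cz; field_simp; ring

lemma cz_id {w : ℂ} (hw : 0 ≤ w.im) (k : ℂ) :
    ‖cz w‖ ^ 2 + ‖k‖ ^ 2 * ‖cz w - (1:ℝ)‖ ^ 2 - 1 =
      4 * (‖k‖ ^ 2 * ‖w‖ ^ 2 - w.im) / ‖1 - Complex.I * w‖ ^ 2 := by
  have h := cz_den hw
  have h' : ‖1 - Complex.I * w‖ ^ 2 ≠ 0 := by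
    have := norm_pos_iff.2 h; positivity
  rw [Complex.ofReal_one, cz_sub w hw, cz, norm_div, norm_div, div_pow, div_pow]
  field_simp
  rw [norm_mul, norm_mul, Complex.norm_I, ← Complex.normSq_eq_norm_sq (1 + Complex.I * w),
    ← Complex.normSq_eq_norm_sq (1 - Complex.I * w)]
  simp [Complex.normSq_apply]; ring

lemma Gf_sphere (t : ℝ) (u : ℂ) :
    ‖cz (t + Complex.I * (‖u‖ ^ 2 : ℝ))‖ ^ 2 +
      ‖2 * u / (1 - Complex.I * (t + Complex.I * (‖u‖ ^ 2 : ℝ)))‖ ^ 2 = 1 := by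
  set w : ℂ := t + Complex.I * (‖u‖ ^ 2 : ℝ) with hw
  have hi : w.im = ‖u‖ ^ 2 := by simp [hw, -Complex.ofReal_pow]
  have hi0 : 0 ≤ w.im := by rw [hi]; positivity
  have h1 := cz_id hi0 0
  have h := cz_den hi0
  have h' : ‖1 - Complex.I * w‖ ^ 2 ≠ 0 := by
    have := norm_pos_iff.2 h; positivity
  simp at h1
  rw [norm_div, norm_mul, div_pow, mul_pow]
  rw [hi] at h1
  have : ‖cz w‖ ^ 2 = 1 + -(4 * ‖u‖ ^ 2) / ‖1 - Complex.I * w‖ ^ 2 := by linarith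
  rw [this]
  field_simp
  simp; ring

lemma Gf_analytic {g : ℂ × ℂ → ℂ} (hg : ∀ p : ℂ × ℂ, ‖p.1‖ ^ 2 + ‖p.2‖ ^ 2 = 1 → AnalyticAt ℝ g p)
    (x : ℝ × ℂ) : AnalyticAt ℝ (Gf g) x := by
  have h0 : AnalyticAt ℝ (fun p : ℝ × ℂ => ‖p.2‖ ^ 2) x :=
    (analyticAt_normSq' x.2).fun_comp analyticAt_snd
  have h1 : AnalyticAt ℝ (fun p : ℝ × ℂ => (p.1:ℂ) + Complex.I * (‖p.2‖ ^ 2 : ℝ)) x :=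
    (analyticAt_fst.ofReal').fun_add (analyticAt_const.fun_mul h0.ofReal')
  have hi : 0 ≤ ((x.1:ℂ) + Complex.I * (‖x.2‖ ^ 2 : ℝ)).im := by
    simp [-Complex.ofReal_pow]
  have hd := cz_den hi
  have h2 : AnalyticAt ℝ (fun p : ℝ × ℂ => 1 - Complex.I * ((p.1:ℂ) + Complex.I * (‖p.2‖ ^ 2 : ℝ))) x :=
    analyticAt_const.fun_sub (analyticAt_const.fun_mul h1)
  have h3 : AnalyticAt ℝ (fun p : ℝ × ℂ => (cz ((p.1:ℂ) + Complex.I * (‖p.2‖ ^ 2 : ℝ)),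
      2 * p.2 / (1 - Complex.I * (p.1 + Complex.I * (‖p.2‖ ^ 2 : ℝ))))) x := by
    refine AnalyticAt.prod ?_ ?_
    · unfold cz
      exact (analyticAt_const.fun_add (analyticAt_const.fun_mul h1)).fun_div h2 hd
    · exact (analyticAt_const.fun_mul analyticAt_snd).fun_div h2 hd
  exact (hg _ (Gf_sphere x.1 x.2)).fun_comp (g := g) (f := fun p : ℝ × ℂ => (cz ((p.1:ℂ) + Complex.I * (‖p.2‖ ^ 2 : ℝ)),
      2 * p.2 / (1 - Complex.I * (p.1 + Complex.I * (‖p.2‖ ^ 2 : ℝ))))) h3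

lemma circ_im (ξ : ℂ) : ‖ξ - Complex.I / 2‖ ^ 2 - (1 / 2) ^ 2 = ‖ξ‖ ^ 2 - ξ.im := by
  rw [← Complex.normSq_eq_norm_sq, ← Complex.normSq_eq_norm_sq]
  simp [Complex.normSq_apply]; ring

lemma xi_circ (θ : ℝ) : xi θ = Complex.I / 2 + ((1 / 2 : ℝ) : ℂ) * Complex.exp ((θ + Real.pi / 2 : ℝ) * Complex.I) := by
  have : Complex.exp ((θ + Real.pi / 2 : ℝ) * Complex.I) = Complex.I * Complex.exp (θ * Complex.I) := by
    push_cast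
    rw [add_mul, Complex.exp_add, Complex.exp_pi_div_two_mul_I]; ring
  rw [this, xi]; push_cast; ring

lemma xi_im (θ : ℝ) : ‖xi θ‖ ^ 2 = (xi θ).im := by
  have h := circ_im (xi θ)
  have h2 : ‖xi θ - Complex.I / 2‖ = 1 / 2 := by
    rw [xi_circ, add_sub_cancel_left, norm_mul, Complex.norm_exp_ofReal_mul_I, Complex.norm_real]
    norm_num
  rw [h2] at h; linarith

lemma xi_surj {ξ : ℂ} (h : ‖ξ‖ ^ 2 = ξ.im) : ∃ θ, ξ = xi θ := by
  have h1 : ‖ξ - Complex.I / 2‖ = 1 / 2 := by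
    have h := circ_im ξ
    have h2 : ‖ξ - Complex.I / 2‖ ^ 2 = (1 / 2) ^ 2 := by linarith
    exact (pow_left_inj₀ (norm_nonneg _) (by norm_num) two_ne_zero).1 h2
  obtain ⟨θ, hθ⟩ := sphere_param h1
  refine ⟨θ - Real.pi / 2, ?_⟩
  rw [xi_circ, hθ]; congr 4; push_cast; ring_nf

lemma Gf_line {g : ℂ × ℂ → ℂ} (hL : LineHyp g 1) (ε : ℂ) {n : ℤ} (hn : n < 0) :
    fc (fun θ => Gf g (‖ε‖ ^ 2 * (xi θ).re, ε * xi θ)) n = 0 := by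
  by_cases hε : ε = 0
  · subst hε
    have : ∀ θ : ℝ, Gf g (‖(0:ℂ)‖ ^ 2 * (xi θ).re, 0 * xi θ) = Gf g (0, 0) * 1 := by intro θ; simp
    rw [fc_congr this, fc_const_mul]
    have h1 := fc_exp 0 n
    simp only [Int.cast_zero, zero_mul, Complex.exp_zero] at h1
    rw [h1, if_neg (by lia), mul_zero]
  have hc : (starRingEnd ℂ) ε ≠ 0 := by simpa using hε
  have hε' : 0 < ‖ε‖ := norm_pos_iff.2 hε
  obtain ⟨F, hF1, hF2, hF3⟩ := hL (-Complex.I / (starRingEnd ℂ) ε)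
  have hk : ‖-Complex.I / (starRingEnd ℂ) ε‖ = 1 / ‖ε‖ := by simp
  set k := -Complex.I / (starRingEnd ℂ) ε with hkd
  have him : ∀ ξ : ℂ, ((‖ε‖ ^ 2 : ℝ) * ξ).im = ‖ε‖ ^ 2 * ξ.im := by
    intro ξ; rw [Complex.im_ofReal_mul]
  have hid : ∀ ξ : ℂ, 0 ≤ ξ.im → ∃ P > 0, ‖cz ((‖ε‖ ^ 2 : ℝ) * ξ)‖ ^ 2 + ‖k‖ ^ 2 * ‖cz ((‖ε‖ ^ 2 : ℝ) * ξ) - (1:ℝ)‖ ^ 2 - 1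
      = P * (‖ξ‖ ^ 2 - ξ.im) := by
    intro ξ hξ
    have h0 : 0 ≤ ((‖ε‖ ^ 2 : ℝ) * ξ).im := by rw [him]; positivity
    have := norm_pos_iff.2 (cz_den h0)
    refine ⟨4 * ‖ε‖ ^ 2 / ‖1 - Complex.I * ((‖ε‖ ^ 2 : ℝ) * ξ)‖ ^ 2, by positivity, ?_⟩
    rw [cz_id h0, hk, him, norm_mul, Complex.norm_real, Real.norm_of_nonneg (by positivity)]
    field_simp
  have hcl : ∀ ξ ∈ closedBall (Complex.I / 2) (1 / 2), ‖ξ‖ ^ 2 ≤ ξ.im := by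
    intro ξ hξ
    rw [mem_closedBall, dist_eq_norm] at hξ
    have h1 := circ_im ξ
    have h2 := pow_le_pow_left₀ (norm_nonneg _) hξ 2
    linarith
  have hop : ∀ ξ ∈ ball (Complex.I / 2) (1 / 2), ‖ξ‖ ^ 2 < ξ.im := by
    intro ξ hξ
    rw [mem_ball, dist_eq_norm] at hξ
    have h1 := circ_im ξ
    have h2 := pow_lt_pow_left₀ hξ (norm_nonneg _) two_ne_zero
    linarith
  have hczd : ∀ ξ : ℂ, 0 ≤ ξ.im → DifferentiableAt ℂ (fun ξ : ℂ => cz ((‖ε‖ ^ 2 : ℝ) * ξ)) ξ := by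
    intro ξ hξ
    have h0 : 0 ≤ ((‖ε‖ ^ 2 : ℝ) * ξ).im := by rw [him]; positivity
    have := cz_den h0
    unfold cz
    exact DifferentiableAt.fun_div (by fun_prop) (by fun_prop) this
  have hD : DiffContOnCl ℂ (fun ξ => F (cz ((‖ε‖ ^ 2 : ℝ) * ξ))) (ball (Complex.I / 2) (1 / 2)) := by
    constructor
    · refine hF2.comp (fun ξ hξ => ?_) (fun ξ hξ => ?_)
      · have := hop ξ hξ
        exact (hczd ξ (by nlinarith [norm_nonneg ξ])).differentiableWithinAt
      · have := hop ξ hξ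
        obtain ⟨P, hP, h⟩ := hid ξ (by nlinarith [norm_nonneg ξ])
        rw [mem_ofPred_eq]; nlinarith
    · rw [closure_ball _ (by norm_num)]
      refine hF1.comp (fun ξ hξ => ?_) (fun ξ hξ => ?_)
      · have := hcl ξ hξ
        exact (hczd ξ (by nlinarith [norm_nonneg ξ])).continuousAt.continuousWithinAt
      · have := hcl ξ hξ
        obtain ⟨P, hP, h⟩ := hid ξ (by nlinarith [norm_nonneg ξ])
        rw [mem_ofPred_eq]; nlinarith
  have h1 := fc_circle_neg (by norm_num) hD hn
  have h2 : ∀ θ : ℝ, Gf g (‖ε‖ ^ 2 * (xi θ).re, ε * xi θ) =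
      F (cz ((‖ε‖ ^ 2 : ℝ) * xi θ)) := by
    intro θ
    have hx := xi_im θ
    have hi : 0 ≤ (xi θ).im := by rw [← hx]; positivity
    obtain ⟨P, hP, h⟩ := hid (xi θ) hi
    have h0 : 0 ≤ ((‖ε‖ ^ 2 : ℝ) * xi θ).im := by rw [him]; positivity
    rw [hF3 _ (by rw [hx, sub_self, mul_zero] at h; linarith), Gf]
    have e : (((‖ε‖ ^ 2 * (xi θ).re : ℝ) : ℂ) + Complex.I * (‖ε * xi θ‖ ^ 2 : ℝ)) = (‖ε‖ ^ 2 : ℝ) * xi θ := by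
      rw [norm_mul, mul_pow, hx]
      apply Complex.ext <;> simp [-Complex.ofReal_pow]
    dsimp only
    rw [e, Complex.ofReal_one, cz_sub _ h0]
    congr 2
    rw [hkd]
    have hcc : ((‖ε‖ ^ 2 : ℝ) : ℂ) = ε * (starRingEnd ℂ) ε := by
      rw [Complex.mul_conj']; push_cast; rfl
    have := cz_den h0
    rw [hcc] at this ⊢
    rw [show 2 * Complex.I * (ε * (starRingEnd ℂ) ε * xi θ) = (starRingEnd ℂ) ε * (2 * Complex.I * ε * xi θ) by ring]
    rw [mul_div_assoc ((starRingEnd ℂ) ε), ← mul_assoc (-Complex.I / _), div_mul_cancel₀ _ hc, ← mul_div_assoc]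
    congr 1
    linear_combination (2 * ε * xi θ) * Complex.I_sq
  rw [fc_congr h2]
  have h3 := fc_translate (u := fun θ => F (cz ((‖ε‖ ^ 2 : ℝ) * (Complex.I / 2 + ((1 / 2 : ℝ) : ℂ) * Complex.exp (θ * Complex.I)))))
    (fun θ => by rw [exp_per]) (Real.pi / 2) n
  rw [h1, mul_zero] at h3
  rw [← h3]
  exact fc_congr (fun θ => by rw [xi_circ]) n

lemma bd_coeff {G : ℝ × ℂ → ℂ} (hG : AnalyticAt ℝ G 0)
    (hline : ∀ (ε : ℂ) (n : ℤ), n < 0 → fc (fun θ => G (‖ε‖ ^ 2 * (xi θ).re, ε * xi θ)) n = 0) :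
    ∃ R0 > 0, ∃ C : ℕ × ℕ → ℂ, Summable (fun j : ℕ × ℕ => ‖C j‖ * R0 ^ (j.1 + j.2)) ∧
      ∀ ε : ℂ, ‖ε‖ < R0 → ∀ θ, HasSum (fun j : ℕ × ℕ => C j * xi θ ^ j.1 * (ε ^ j.1 * (starRingEnd ℂ ε) ^ j.2))
        (G (‖ε‖ ^ 2 * (xi θ).re, ε * xi θ)) := by
  obtain ⟨R, hR, c, hcs, hch⟩ := expand_RC hG
  set R0 := min R 1 with hR0d
  have hR0 : 0 < R0 := lt_min hR one_pos
  have hR1 : R0 ≤ 1 := min_le_right _ _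
  have hRR : R0 ≤ R := min_le_left _ _
  let c' : (ℕ × ℕ) × ℕ → ℂ := fun x =>
    if x.2 ≤ x.1.1 ∧ x.2 ≤ x.1.2 then c (x.2, x.1.1 - x.2, x.1.2 - x.2) else 0
  let e : ℕ × ℕ × ℕ → (ℕ × ℕ) × ℕ := fun j => ((j.1 + j.2.1, j.1 + j.2.2), j.1)
  have he : Function.Injective e := by
    rintro ⟨a, b, d⟩ ⟨a', b', d'⟩ h
    simp only [e, Prod.mk.injEq] at h
    obtain ⟨⟨h1, h2⟩, h3⟩ := h
    subst h3
    simp; omega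
  have hc0 : ∀ x, x ∉ range e → c' x = 0 := by
    rintro ⟨⟨p, q⟩, α⟩ hx
    by_contra h
    apply hx
    simp only [c', ite_eq_right_iff, not_forall] at h
    obtain ⟨⟨h1, h2⟩, _⟩ := h
    exact ⟨(α, p - α, q - α), by simp only [e]; congr <;> omega⟩
  have hce : ∀ j, c' (e j) = c j := by
    rintro ⟨a, b, d⟩
    simp [c', e]
  have hS : Summable (fun x : (ℕ × ℕ) × ℕ => ‖c' x‖ * R0 ^ (x.1.1 + x.1.2)) := by
    rw [← he.summable_iff (fun x hx => by simp [hc0 x hx])]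
    refine Summable.of_nonneg_of_le (fun j => by simp only [Function.comp]; positivity) (fun j => ?_) hcs
    simp only [Function.comp, hce]
    gcongr
    refine (pow_le_pow_of_le_one hR0.le hR1 (m := j.1 + j.2.1 + j.2.2) (by simp only [e]; omega)).trans ?_
    gcongr
  let X : ℕ × ℕ → ℝ → ℂ := fun j θ => ∑ α ∈ Finset.range (j.2 + 1), c' (j, α) *
    (((xi θ).re : ℂ) ^ α * xi θ ^ (j.1 - α) * (starRingEnd ℂ (xi θ)) ^ (j.2 - α))
  have hXc : ∀ j, Continuous (X j) := by
    intro j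
    have := xi_cont
    have h2 : Continuous fun θ => ((xi θ).re : ℂ) := by fun_prop
    have h3 : Continuous fun θ => (starRingEnd ℂ) (xi θ) := by fun_prop
    simp only [X]
    fun_prop
  let b : ℕ × ℕ → ℝ := fun j => ∑' α, ‖c' (j, α)‖ * R0 ^ (j.1 + j.2)
  have hb : Summable b := hS.prod
  have hbt : ∀ (j : ℕ × ℕ) α θ, ‖((xi θ).re : ℂ) ^ α * xi θ ^ (j.1 - α) * (starRingEnd ℂ (xi θ)) ^ (j.2 - α)‖ ≤ 1 := by
    intro j α θ
    have h1 := xi_norm θ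
    have h2 : ‖((xi θ).re : ℂ)‖ ≤ 1 := by
      rw [Complex.norm_real]; exact (Complex.abs_re_le_norm _).trans h1
    rw [norm_mul, norm_mul, norm_pow, norm_pow, norm_pow, Complex.norm_conj]
    have := pow_le_one₀ (norm_nonneg _) h2 (n := α)
    have := pow_le_one₀ (norm_nonneg _) h1 (n := j.1 - α)
    have := pow_le_one₀ (norm_nonneg _) h1 (n := j.2 - α)
    exact mul_le_one₀ (mul_le_one₀ (by assumption) (by positivity) (by assumption)) (by positivity) (by assumption)
  have hXb : ∀ j θ, ‖X j θ‖ * R0 ^ (j.1 + j.2) ≤ b j := by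
    intro j θ
    have h1 : ‖X j θ‖ ≤ ∑ α ∈ Finset.range (j.2 + 1), ‖c' (j, α)‖ := by
      refine (norm_sum_le _ _).trans (Finset.sum_le_sum fun α _ => ?_)
      rw [norm_mul]
      exact mul_le_of_le_one_right (norm_nonneg _) (hbt j α θ)
    refine (mul_le_mul_of_nonneg_right h1 (by positivity)).trans ?_
    rw [Finset.sum_mul]
    exact (hS.prod_factor j).sum_le_tsum _ (fun _ _ => by positivity)
  have hnorm : ∀ ε : ℂ, ‖ε‖ < R0 → ∀ j : ℕ × ℕ, ‖ε ^ j.1 * (starRingEnd ℂ ε) ^ j.2‖ ≤ R0 ^ (j.1 + j.2) := by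
    intro ε hε j
    rw [norm_mul, norm_pow, norm_pow, Complex.norm_conj, ← pow_add]
    gcongr
  have hX : ∀ ε : ℂ, ‖ε‖ < R0 → ∀ θ, HasSum (fun j : ℕ × ℕ => X j θ * (ε ^ j.1 * (starRingEnd ℂ ε) ^ j.2))
        (G (‖ε‖ ^ 2 * (xi θ).re, ε * xi θ)) := by
    intro ε hε θ
    have h1 := xi_norm θ
    have h2 : |(xi θ).re| ≤ 1 := (Complex.abs_re_le_norm _).trans h1
    have h3 := hch (‖ε‖ ^ 2 * (xi θ).re, ε * xi θ) (by
      rw [Prod.norm_def, max_lt_iff]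
      constructor
      · simp only [Real.norm_eq_abs, abs_mul, abs_pow, abs_norm]
        have : ‖ε‖ ^ 2 * |(xi θ).re| ≤ ‖ε‖ ^ 2 := mul_le_of_le_one_right (by positivity) h2
        nlinarith [norm_nonneg ε]
      · simp only [norm_mul]
        have : ‖ε‖ * ‖xi θ‖ ≤ ‖ε‖ := mul_le_of_le_one_right (by positivity) h1
        linarith)
    rw [zero_add] at h3
    have h4 : HasSum (fun x : (ℕ × ℕ) × ℕ => c' x * (((xi θ).re : ℂ) ^ x.2 * xi θ ^ (x.1.1 - x.2) *
        (starRingEnd ℂ (xi θ)) ^ (x.1.2 - x.2)) * (ε ^ x.1.1 * (starRingEnd ℂ ε) ^ x.1.2))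
        (G (‖ε‖ ^ 2 * (xi θ).re, ε * xi θ)) := by
      rw [← he.hasSum_iff (fun x hx => by simp [hc0 x hx])]
      convert h3 using 1
      funext j
      simp only [Function.comp, hce]
      simp only [e, Nat.add_sub_cancel_left]
      have : ((‖ε‖ ^ 2 * (xi θ).re : ℝ) : ℂ) = ε * (starRingEnd ℂ) ε * (xi θ).re := by
        rw [Complex.mul_conj']; push_cast; rfl
      rw [this, map_mul]
      ring
    refine h4.prod_fiberwise (fun j => ?_)
    simp only [X, Finset.sum_mul]
    refine hasSum_sum_of_ne_finset_zero (f := fun α => c' (j, α) * (((xi θ).re : ℂ) ^ α * xi θ ^ (j.1 - α) *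
        (starRingEnd ℂ (xi θ)) ^ (j.2 - α)) * (ε ^ j.1 * (starRingEnd ℂ ε) ^ j.2)) (fun α hα => ?_)
    have : c' (j, α) = 0 := by
      simp only [c']
      rw [if_neg]
      rintro ⟨_, h⟩
      exact hα (Finset.mem_range.2 (by omega))
    rw [this]; ring
  have hfc : ∀ (j : ℕ × ℕ) (n : ℤ), n < 0 → fc (X j) n = 0 := by
    intro j n hn
    have hs2 : Summable (fun j : ℕ × ℕ => ‖fc (X j) n‖ * R0 ^ (j.1 + j.2)) := by
      refine Summable.of_nonneg_of_le (fun j => by positivity) (fun j => ?_) hb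
      have : ‖fc (X j) n‖ ≤ b j / R0 ^ (j.1 + j.2) :=
        fc_norm_le (fun θ => by rw [le_div_iff₀ (by positivity)]; exact hXb j θ) n
      rwa [le_div_iff₀ (by positivity)] at this
    refine uniq2 (R' := R0) hR0 hR0 hs2 ((j.1:ℤ) - j.2) (fun ρ hρ0 hρ => ?_) j.1 j.2 rfl
    have h1 := fc_expand hs2 (h := fun _ => 0) (fun ε hε => ?_) ((j.1:ℤ) - j.2) hρ0.le hρ
    · have : fc (fun _ => (0:ℂ)) ((j.1:ℤ) - j.2) = 0 := by simp [fc]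
      rwa [this] at h1
    · have h2 := fc_hasSum (U := fun j θ => X j θ * (ε ^ j.1 * (starRingEnd ℂ ε) ^ j.2)) (b := b)
        (fun j => by have := hXc j; fun_prop)
        (fun j θ => by
          rw [norm_mul]
          exact (mul_le_mul_of_nonneg_left (hnorm ε hε j) (norm_nonneg _)).trans (hXb j θ)) hb (hX ε hε) n
      rw [hline ε n hn] at h2
      convert h2 using 1
      funext j
      rw [fc_congr (v := fun θ => (ε ^ j.1 * (starRingEnd ℂ ε) ^ j.2) * X j θ) (fun θ => mul_comm _ _), fc_const_mul, mul_comm]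
  have hC : ∀ j : ℕ × ℕ, ∃ C, ∀ θ, X j θ = C * xi θ ^ j.1 := by
    intro j
    refine trig_poly (c := fun α => c' (j, α)) (fun α hα => ?_) (fun n hn => hfc j n hn)
    simp only [c']
    rw [if_neg]
    rintro ⟨h, _⟩
    omega
  choose C hC using hC
  refine ⟨R0, hR0, C, ?_, fun ε hε θ => ?_⟩
  · refine Summable.of_nonneg_of_le (fun j => by positivity) (fun j => ?_) hb
    have h1 := hXb j 0
    have h2 : ‖X j 0‖ = ‖C j‖ := by
      rw [hC, norm_mul, norm_pow, show xi 0 = Complex.I by simp [xi]; ring, Complex.norm_I, one_pow, mul_one]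
    rwa [h2] at h1
  · have := hX ε hε θ
    simp only [hC] at this
    exact this

noncomputable def wz (z : ℂ) : ℂ := Complex.I * (1 - z) / (1 + z)

lemma one_add_ne {z : ℂ} (hz : ‖z‖ < 1) : 1 + z ≠ 0 := by
  intro h
  have : z = -1 := by linear_combination h
  rw [this] at hz; simp at hz

lemma wz_im {z : ℂ} (hz : ‖z‖ < 1) : (wz z).im = (1 - ‖z‖ ^ 2) / ‖1 + z‖ ^ 2 := by
  have h := one_add_ne hz
  rw [wz, mul_div_assoc, Complex.I_mul_im, Complex.div_re, ← Complex.normSq_eq_norm_sq (1 + z),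
    ← Complex.normSq_eq_norm_sq z]
  have h' : Complex.normSq (1 + z) ≠ 0 := by simpa using h
  field_simp
  simp [Complex.normSq_apply]; ring

lemma wz_den {z : ℂ} (hz : ‖z‖ < 1) : 1 - Complex.I * wz z = 2 / (1 + z) := by
  have h := one_add_ne hz
  rw [wz]; field_simp
  linear_combination (-(1 - z)) * Complex.I_sq

lemma cz_wz {z : ℂ} (hz : ‖z‖ < 1) : cz (wz z) = z := by
  have h := one_add_ne hz
  rw [cz, wz_den hz, wz]; field_simp
  linear_combination ((1 - z)) * Complex.I_sq

lemma wz_cz {w : ℂ} (hw : 0 ≤ w.im) : wz (cz w) = w := by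
  have h := cz_den hw
  have e1 : 1 + cz w = 2 / (1 - Complex.I * w) := by rw [cz]; field_simp; ring
  have e2 : 1 - cz w = -(2 * Complex.I * w) / (1 - Complex.I * w) := by rw [cz]; field_simp; ring
  rw [wz, e1, e2]; field_simp
  linear_combination (-w) * Complex.I_sq

lemma Gf_series {G : ℝ × ℂ → ℂ} {R0 : ℝ} {C : ℕ × ℕ → ℂ}
    (hC : ∀ ε : ℂ, ‖ε‖ < R0 → ∀ θ, HasSum (fun j : ℕ × ℕ => C j * xi θ ^ j.1 * (ε ^ j.1 * (starRingEnd ℂ ε) ^ j.2))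
        (G (‖ε‖ ^ 2 * (xi θ).re, ε * xi θ))) {w u : ℂ} (hu : u ≠ 0) (hwu : w.im = ‖u‖ ^ 2)
    (hw : ‖w‖ < R0 * ‖u‖) :
    HasSum (fun j : ℕ × ℕ => C j * (u ^ j.1 * (w / u) ^ j.2)) (G (w.re, u)) := by
  have hu' : 0 < ‖u‖ := norm_pos_iff.2 hu
  have hw0 : w ≠ 0 := by
    rintro rfl
    simp at hwu; exact hu (by simpa using hwu.symm)
  have hwc : (starRingEnd ℂ) w ≠ 0 := by simpa using hw0
  have huc : (starRingEnd ℂ) u ≠ 0 := by simpa using hu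
  have hw' : 0 < ‖w‖ := norm_pos_iff.2 hw0
  have hns : ‖w‖ ^ 2 = w.re * w.re + w.im * w.im := by
    rw [← Complex.normSq_eq_norm_sq, Complex.normSq_apply]
  obtain ⟨θ, hθ⟩ := xi_surj (ξ := (‖u‖ ^ 2 : ℝ) / (starRingEnd ℂ) w) (by
    rw [norm_div, Complex.norm_conj, Complex.norm_real, Complex.div_im, Complex.normSq_conj,
      Complex.normSq_eq_norm_sq]
    simp only [Complex.ofReal_im, Complex.ofReal_re, Complex.conj_im, Complex.conj_re, hwu,
      Real.norm_of_nonneg (by positivity : 0 ≤ ‖u‖ ^ 2)]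
    field_simp; ring)
  have h := hC ((starRingEnd ℂ) w / (starRingEnd ℂ) u) (by
    rw [norm_div, Complex.norm_conj, Complex.norm_conj, div_lt_iff₀ hu']; exact hw) θ
  have huu : ((‖u‖ ^ 2 : ℝ) : ℂ) = u * (starRingEnd ℂ) u := by
      rw [Complex.mul_conj']; push_cast; rfl
  have e1 : (starRingEnd ℂ) w / (starRingEnd ℂ) u * xi θ = u := by
    rw [← hθ, huu]; field_simp
  have e2 : ‖(starRingEnd ℂ) w / (starRingEnd ℂ) u‖ ^ 2 * (xi θ).re = w.re := by
    rw [← hθ, norm_div, Complex.norm_conj, Complex.norm_conj, Complex.div_re, Complex.normSq_conj,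
      Complex.normSq_eq_norm_sq]
    simp only [Complex.ofReal_im, Complex.ofReal_re, Complex.conj_im, Complex.conj_re]
    field_simp; ring
  rw [e1, e2] at h
  convert h using 1
  funext j
  rw [map_div₀, Complex.conj_conj, Complex.conj_conj]
  rw [show C j * xi θ ^ j.1 * (((starRingEnd ℂ) w / (starRingEnd ℂ) u) ^ j.1 * (w / u) ^ j.2)
    = C j * (((starRingEnd ℂ) w / (starRingEnd ℂ) u * xi θ) ^ j.1 * (w / u) ^ j.2) by ring, e1]

lemma Gf_wz (g : ℂ × ℂ → ℂ) {z v : ℂ} (hz : ‖z‖ < 1) (hv : ‖v‖ = sq1 z) :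
    Gf g ((wz z).re, v / (1 + z)) = g (z, v) := by
  have h := one_add_ne hz
  have h' := norm_pos_iff.2 h
  have e : ((wz z).re : ℂ) + Complex.I * (‖v / (1 + z)‖ ^ 2 : ℝ) = wz z := by
    rw [norm_div, hv, div_pow, sq1, Real.sq_sqrt (by nlinarith [norm_nonneg z]), ← wz_im hz, mul_comm]
    exact Complex.re_add_im _
  simp only [Gf]
  rw [e, cz_wz hz, wz_den hz]
  congr 2
  field_simp

lemma boundary_hol {g : ℂ × ℂ → ℂ} (hg : ∀ p : ℂ × ℂ, ‖p.1‖ ^ 2 + ‖p.2‖ ^ 2 = 1 → AnalyticAt ℝ g p)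
    (hL : LineHyp g 1) (m : ℤ) : DifferentiableOn ℂ (hm g m) (ball 0 1) := by
  obtain ⟨R0, hR0, C, hCs, hC⟩ := bd_coeff (Gf_analytic hg 0) (fun ε n hn => Gf_line hL ε hn)
  have key : ∀ z : ℂ, ‖z‖ < 1 → ‖wz z‖ ^ 2 < R0 ^ 2 * (wz z).im →
      HasSum (fun j : ℕ × ℕ => (if (j.1:ℤ) - j.2 = m then C j else 0) * wz z ^ j.2) ((1 + z) ^ m * hm g m z) := by
    intro z hz hw
    have h := one_add_ne hz
    have hs := sq1_pos hz
    have hs' : (sq1 z : ℂ) ≠ 0 := by exact_mod_cast hs.ne'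
    set u0 : ℂ := sq1 z / (1 + z) with hu0
    have hu0' : u0 ≠ 0 := div_ne_zero hs' h
    have hup := norm_pos_iff.2 hu0'
    have hwu : (wz z).im = ‖u0‖ ^ 2 := by
      rw [hu0, norm_div, Complex.norm_real, Real.norm_of_nonneg hs.le, div_pow, wz_im hz, sq1,
        Real.sq_sqrt (by nlinarith [norm_nonneg z])]
    have hwlt : ‖wz z‖ < R0 * ‖u0‖ := by
      rw [hwu, ← mul_pow] at hw
      exact lt_of_pow_lt_pow_left₀ 2 (by positivity) hw
    have hult : ‖u0‖ ≤ R0 := by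
      have h1 : (wz z).im ≤ ‖wz z‖ := (le_abs_self _).trans (Complex.abs_im_le_norm _)
      nlinarith
    have h1 : ∀ φ : ℝ, HasSum (fun j : ℕ × ℕ => (C j * (u0 ^ j.1 * (wz z / u0) ^ j.2)) *
        Complex.exp (((j.1:ℤ) - (j.2:ℤ) : ℤ) * φ * Complex.I)) (g (z, sq1 z * Complex.exp (φ * Complex.I))) := by
      intro φ
      have he : ‖Complex.exp (φ * Complex.I)‖ = 1 := Complex.norm_exp_ofReal_mul_I φ
      have := Gf_series hC (w := wz z) (u := u0 * Complex.exp (φ * Complex.I))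
        (mul_ne_zero hu0' (Complex.exp_ne_zero _)) (by rw [norm_mul, he, mul_one, hwu])
        (by rw [norm_mul, he, mul_one]; exact hwlt)
      rw [show u0 * Complex.exp (φ * Complex.I) = (sq1 z * Complex.exp (φ * Complex.I)) / (1 + z) by
        rw [hu0]; ring, Gf_wz g hz (by rw [norm_mul, he, mul_one, Complex.norm_real, Real.norm_of_nonneg hs.le])] at this
      convert this using 1
      funext j
      have e1 : Complex.exp (((j.1:ℤ) - (j.2:ℤ) : ℤ) * φ * Complex.I) =
          Complex.exp (φ * Complex.I) ^ j.1 * (Complex.exp (φ * Complex.I) ^ j.2)⁻¹ := by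
        rw [← Complex.exp_nat_mul, ← Complex.exp_nat_mul, ← Complex.exp_neg, ← Complex.exp_add]
        congr 1; push_cast; ring
      rw [e1, hu0]
      have := Complex.exp_ne_zero (φ * Complex.I)
      simp only [div_pow, mul_pow]
      field_simp
    have h2 := fc_hasSum (b := fun j : ℕ × ℕ => ‖C j‖ * R0 ^ (j.1 + j.2)) (fun j => by fun_prop) (fun j φ => by
      have : ‖Complex.exp (((j.1:ℤ) - (j.2:ℤ) : ℤ) * φ * Complex.I)‖ = 1 := by
        rw [show (((j.1:ℤ) - (j.2:ℤ) : ℤ) * φ * Complex.I : ℂ) = (((j.1:ℤ) - (j.2:ℤ) : ℤ) * φ : ℝ) * Complex.I by push_cast; ring]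
        exact Complex.norm_exp_ofReal_mul_I _
      rw [norm_mul, this, mul_one, norm_mul, norm_mul, norm_pow, norm_pow, pow_add]
      have : ‖wz z / u0‖ ≤ R0 := by rw [norm_div, div_le_iff₀ hup]; exact hwlt.le
      gcongr) hCs h1 m
    have h3 : fc (fun φ => g (z, sq1 z * Complex.exp (φ * Complex.I))) m = u0 ^ m * ((1 + z) ^ m * hm g m z) := by
      rw [fc_slice g m hz (by rw [Complex.norm_real, Real.norm_of_nonneg hs.le]), ← mul_assoc, ← mul_zpow, hu0,
        div_mul_cancel₀ _ h]
    rw [h3] at h2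
    have h4 := h2.mul_left ((u0 ^ m)⁻¹)
    rw [inv_mul_cancel_left₀ (zpow_ne_zero _ hu0')] at h4
    refine h4.congr_fun (fun j => ?_)
    rw [fc_const_mul, fc_exp]
    by_cases hj : (j.1:ℤ) - j.2 = m
    · rw [if_pos hj, if_pos hj.symm, ← hj, zpow_sub₀ hu0', zpow_natCast, zpow_natCast, div_pow (wz z) u0]
      field_simp
    · rw [if_neg hj, if_neg (fun h => hj h.symm)]; ring
  set O : Set ℂ := ball 0 1 ∩ wz ⁻¹' {w | ‖w‖ ^ 2 < R0 ^ 2 * w.im} with hOd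
  have hwd : DifferentiableOn ℂ wz (ball 0 1) := by
    intro z hz
    have := one_add_ne (mem_ball_zero_iff.1 hz)
    unfold wz
    exact (DifferentiableAt.fun_div (by fun_prop) (by fun_prop) this).differentiableWithinAt
  have hO : IsOpen O := by
    refine hwd.continuousOn.isOpen_inter_preimage isOpen_ball ?_
    exact isOpen_lt (by fun_prop) (by fun_prop)
  have hT : DifferentiableOn ℂ (fun z => ∑' j : ℕ × ℕ, (if (j.1:ℤ) - j.2 = m then C j else 0) * wz z ^ j.2) O := by
    refine Complex.differentiableOn_tsum_of_summable_norm (u := fun j : ℕ × ℕ => R0 ^ (-m) * (‖C j‖ * R0 ^ (j.1 + j.2)))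
      (hCs.mul_left _) (fun j => ?_) hO (fun j z hz => ?_)
    · have := hwd.mono (inter_subset_left (t := wz ⁻¹' {w | ‖w‖ ^ 2 < R0 ^ 2 * w.im}))
      exact (differentiableOn_const _).mul (this.pow _)
    · have hz2 : ‖wz z‖ ^ 2 < R0 ^ 2 * (wz z).im := hz.2
      have h1 : (wz z).im ≤ ‖wz z‖ := (le_abs_self _).trans (Complex.abs_im_le_norm _)
      have h2 : ‖wz z‖ ≤ R0 ^ 2 := by
        by_contra hcon
        have h3 := mul_le_mul_of_nonneg_left h1 (sq_nonneg R0)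
        nlinarith [norm_nonneg (wz z)]
      rw [norm_mul, norm_pow]
      split_ifs with hj
      · rw [mul_left_comm]
        gcongr
        rw [← hj]
        refine (pow_le_pow_left₀ (norm_nonneg _) h2 _).trans (le_of_eq ?_)
        rw [neg_sub, zpow_sub₀ hR0.ne', zpow_natCast, zpow_natCast, pow_add, ← pow_mul]
        field_simp
        ring
      · simp; positivity
  have hOm : DifferentiableOn ℂ (hm g m) O := by
    have h1 : DifferentiableOn ℂ (fun z => (1 + z) ^ (-m) *
        ∑' j : ℕ × ℕ, (if (j.1:ℤ) - j.2 = m then C j else 0) * wz z ^ j.2) O := by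
      refine DifferentiableOn.mul (fun z hz => ?_) hT
      have := one_add_ne (mem_ball_zero_iff.1 hz.1)
      exact (DifferentiableAt.zpow (by fun_prop) (Or.inl this)).differentiableWithinAt
    refine h1.congr (fun z hz => ?_)
    have h0 := one_add_ne (mem_ball_zero_iff.1 hz.1)
    rw [(key z (mem_ball_zero_iff.1 hz.1) hz.2).tsum_eq, ← mul_assoc, ← zpow_add₀ h0, neg_add_cancel, zpow_zero, one_mul]
  have hw0 : (Complex.I * (R0 ^ 2 / 2 : ℝ)).im = R0 ^ 2 / 2 := by
    rw [Complex.I_mul_im, Complex.ofReal_re]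
  have hw0' : 0 ≤ (Complex.I * (R0 ^ 2 / 2 : ℝ)).im := by rw [hw0]; positivity
  have hz0 : cz (Complex.I * (R0 ^ 2 / 2 : ℝ)) ∈ O := by
    constructor
    · have h1 := cz_id hw0' 0
      have h2 := norm_pos_iff.2 (cz_den hw0')
      rw [hw0] at h1
      simp only [norm_zero, ne_eq, OfNat.ofNat_ne_zero, not_false_eq_true, zero_pow, zero_mul, add_zero, zero_sub] at h1
      have h3 : 4 * -(R0 ^ 2 / 2) / ‖1 - Complex.I * (Complex.I * (R0 ^ 2 / 2 : ℝ))‖ ^ 2 < 0 :=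
        div_neg_of_neg_of_pos (by nlinarith [pow_pos hR0 2]) (by positivity)
      rw [mem_ball_zero_iff]
      nlinarith [norm_nonneg (cz (Complex.I * (R0 ^ 2 / 2 : ℝ)))]
    · rw [mem_preimage, wz_cz hw0', mem_ofPred_eq, hw0, norm_mul, Complex.norm_I, one_mul, Complex.norm_real,
        Real.norm_of_nonneg (by positivity)]
      nlinarith [pow_pos hR0 2]
  refine analytic_hol_extend (convex_ball 0 1).isPreconnected
    (fun z hz => hm_analytic hg m (mem_ball_zero_iff.1 hz)) hz0.1 ?_
  filter_upwards [hO.mem_nhds hz0] with z hz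
  exact (hOm z hz).differentiableAt (hO.mem_nhds hz)

lemma hol_fc {h : ℂ → ℂ} (hh : DifferentiableOn ℂ h (ball 0 1)) :
    ∃ a : ℕ → ℂ, ∀ z : ℂ, ‖z‖ < 1 → ∀ l : ℤ, fc (fun θ => h (Complex.exp (θ * Complex.I) * z)) l =
      if 0 ≤ l then a l.toNat * z ^ l.toNat else 0 := by
  obtain ⟨a, h1⟩ : ∃ a : ℕ → ℂ, ∀ z : ℂ, ‖z‖ < 1 → HasSum (fun n : ℕ => a n * z ^ n) (h z) := by
    refine ⟨fun n => (n.factorial : ℂ)⁻¹ * iteratedDeriv n h 0, fun z hz => ?_⟩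
    have := Complex.hasSum_taylorSeries_on_ball (f := h) (c := 0) (r := 1) (z := z) (by simpa using hh) (by simpa using hz)
    refine this.congr_fun (fun n => ?_)
    simp only [smul_eq_mul, sub_zero]; ring
  refine ⟨a, fun z hz l => ?_⟩
  have h2 := fc_hasSum (U := fun n θ => a n * z ^ n * Complex.exp ((n:ℤ) * θ * Complex.I))
    (u := fun θ => h (Complex.exp (θ * Complex.I) * z)) (b := fun n => ‖a n * z ^ n‖) (fun n => by fun_prop)
    (fun n θ => by
      rw [norm_mul, show ((n:ℤ) * θ * Complex.I : ℂ) = ((n:ℤ) * θ : ℝ) * Complex.I by push_cast; ring,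
        Complex.norm_exp_ofReal_mul_I, mul_one]) (h1 z hz).summable.norm (fun θ => by
      have := h1 (Complex.exp (θ * Complex.I) * z) (by rw [norm_mul, Complex.norm_exp_ofReal_mul_I, one_mul]; exact hz)
      refine this.congr_fun (fun n => ?_)
      rw [mul_pow, ← Complex.exp_nat_mul, show ((n:ℕ):ℂ) * (θ * Complex.I) = (n:ℤ) * θ * Complex.I by push_cast; ring]
      ring) l
  simp only [fc_const_mul, fc_exp] at h2
  refine h2.unique ?_
  split_ifs with hl
  · lift l to ℕ using hl
    simp only [Int.toNat_natCast, Nat.cast_inj]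
    convert hasSum_ite_eq l (a l * z ^ l) using 2 with n
    by_cases hn : l = n
    · subst hn; simp
    · simp [hn, Ne.symm hn]
  · convert hasSum_zero (α := ℂ) using 2 with n
    rw [if_neg (by lia)]; simp

lemma fN_analytic {g : ℂ × ℂ → ℂ} (hg : ∀ p : ℂ × ℂ, ‖p.1‖ ^ 2 + ‖p.2‖ ^ 2 = 1 → AnalyticAt ℝ g p)
    (N : ℤ) {p : ℂ × ℂ} (hp : ‖p.1‖ ^ 2 + ‖p.2‖ ^ 2 = 1) :
    AnalyticAt ℝ (fun p : ℂ × ℂ => fc (fun θ => g (Complex.exp (θ * Complex.I) * p.1, Complex.exp (θ * Complex.I) * p.2)) N) p := by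
  refine fc_analyticAt (G := fun q : (ℂ × ℂ) × ℝ => g (Complex.exp (q.2 * Complex.I) * q.1.1, Complex.exp (q.2 * Complex.I) * q.1.2)) ?_ N
  intro θ
  have h1 := analyticAt_expI (ℂ × ℂ) (p, θ)
  have h2 : AnalyticAt ℝ (fun q : (ℂ × ℂ) × ℝ => (Complex.exp (q.2 * Complex.I) * q.1.1, Complex.exp (q.2 * Complex.I) * q.1.2)) (p, θ) :=
    AnalyticAt.prod (h1.fun_mul (analyticAt_fst.fun_comp analyticAt_fst)) (h1.fun_mul (analyticAt_snd.fun_comp analyticAt_fst))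
  exact (hg (Complex.exp (θ * Complex.I) * p.1, Complex.exp (θ * Complex.I) * p.2) (by simp only [norm_mul, Complex.norm_exp_ofReal_mul_I, one_mul]; exact hp)).fun_comp (g := g)
    (f := fun q : (ℂ × ℂ) × ℝ => (Complex.exp (q.2 * Complex.I) * q.1.1, Complex.exp (q.2 * Complex.I) * q.1.2)) h2

lemma slice_poly {g : ℂ × ℂ → ℂ} (hg : ∀ p : ℂ × ℂ, ‖p.1‖ ^ 2 + ‖p.2‖ ^ 2 = 1 → AnalyticAt ℝ g p)
    (hol : ∀ m, DifferentiableOn ℂ (hm g m) (ball 0 1)) (N : ℤ) :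
    ∃ c : ℕ → ℂ, ∀ p : ℂ × ℂ, ‖p.1‖ ^ 2 + ‖p.2‖ ^ 2 = 1 →
      fc (fun θ => g (Complex.exp (θ * Complex.I) * p.1, Complex.exp (θ * Complex.I) * p.2)) N =
        ∑ m ∈ Finset.range (N + 1).toNat, c m * (p.1 ^ (N - m).toNat * p.2 ^ m) := by
  set fN : ℂ × ℂ → ℂ := fun p => fc (fun θ => g (Complex.exp (θ * Complex.I) * p.1, Complex.exp (θ * Complex.I) * p.2)) N with hfN
  have hfa : ∀ p : ℂ × ℂ, ‖p.1‖ ^ 2 + ‖p.2‖ ^ 2 = 1 → AnalyticAt ℝ fN p := fun p hp => fN_analytic hg N hp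
  obtain ⟨B, hB0, hB⟩ := sphere2_bound hfa
  choose a ha using fun m => hol_fc (hol m)
  have hsp : ∀ z : ℂ, ‖z‖ < 1 → ∀ φ : ℝ, ‖z‖ ^ 2 + ‖(sq1 z : ℂ) * Complex.exp (φ * Complex.I)‖ ^ 2 = 1 := by
    intro z hz φ
    exact sphere_pt hz.le (by rw [norm_mul, Complex.norm_exp_ofReal_mul_I, mul_one, Complex.norm_real, Real.norm_of_nonneg (sq1_pos hz).le])
  -- Fourier coefficients of the slices
  have hcoef : ∀ z : ℂ, ‖z‖ < 1 → ∀ m : ℤ, fc (fun φ => fN (z, sq1 z * Complex.exp (φ * Complex.I))) m =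
      (sq1 z : ℂ) ^ m * (if 0 ≤ N - m then a m (N - m).toNat * z ^ (N - m).toNat else 0) := by
    intro z hz m
    have hs := sq1_pos hz
    have hsw := fc_swap (G := fun θ φ => g (Complex.exp (θ * Complex.I) * z, Complex.exp (θ * Complex.I) * (sq1 z * Complex.exp (φ * Complex.I))))
      (by
        rw [continuous_iff_continuousAt]
        intro q
        refine ContinuousAt.comp (g := g) (hg _ ?_).continuousAt (by fun_prop)
        have := hsp z hz q.2
        simpa only [norm_mul, Complex.norm_exp_ofReal_mul_I, one_mul] using this) N m
    simp only [hfN]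
    rw [← hsw, ← ha m z hz, ← fc_mul_exp, ← fc_const_mul]
    refine fc_congr (fun θ => ?_) N
    have he : ‖Complex.exp (θ * Complex.I)‖ = 1 := Complex.norm_exp_ofReal_mul_I θ
    have hse : sq1 (Complex.exp (θ * Complex.I) * z) = sq1 z := by rw [sq1, norm_mul, he, one_mul, sq1]
    have := fc_slice g m (z := Complex.exp (θ * Complex.I) * z) (w := Complex.exp (θ * Complex.I) * sq1 z)
      (by rw [norm_mul, he, one_mul]; exact hz)
      (by rw [hse, norm_mul, he, one_mul, Complex.norm_real, Real.norm_of_nonneg hs.le])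
    simp only [mul_assoc] at this
    rw [this, mul_zpow, ← Complex.exp_int_mul, mul_assoc (m:ℂ)]
    ring
  -- negative coefficients vanish
  have hneg : ∀ m : ℤ, m < 0 → 0 ≤ N - m → a m (N - m).toNat = 0 := by
    intro m hm hNm
    have h1 : ∀ r ∈ Ico (0:ℝ) 1, ‖a m (N - m).toNat‖ * r ^ (N - m).toNat ≤ B * Real.sqrt (1 - r ^ 2) ^ (-m).toNat := by
      intro r hr
      have hr' : ‖(r:ℂ)‖ = r := by rw [Complex.norm_real, Real.norm_of_nonneg hr.1]
      have hz : ‖(r:ℂ)‖ < 1 := by rw [hr']; exact hr.2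
      have hs := sq1_pos hz
      have h2 := hcoef r hz m
      have h3 : ‖fc (fun φ => fN (r, sq1 r * Complex.exp (φ * Complex.I))) m‖ ≤ B :=
        fc_norm_le (fun φ => hB _ (hsp r hz φ)) m
      rw [h2, if_pos hNm, norm_mul, norm_mul, norm_pow, hr', norm_zpow, Complex.norm_real, Real.norm_of_nonneg hs.le] at h3
      have e : sq1 r ^ m = (sq1 r ^ (-m).toNat)⁻¹ := by
        rw [← zpow_natCast, Int.toNat_of_nonneg (by lia), zpow_neg, inv_inv]
      rw [e, inv_mul_le_iff₀ (by positivity), mul_comm _ B] at h3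
      simpa only [sq1, hr'] using h3
    have h2 := le_on_closure h1 (by fun_prop) (by fun_prop) (x := 1) (by rw [closure_Ico (by norm_num)]; simp)
    have h3 : (-m).toNat ≠ 0 := by lia
    simp [h3] at h2
    exact h2
  refine ⟨fun m => a m (N - m).toNat, ?_⟩
  have hin : ∀ z : ℂ, ‖z‖ < 1 → ∀ φ : ℝ, fN (z, sq1 z * Complex.exp (φ * Complex.I)) =
      ∑ m ∈ Finset.range (N + 1).toNat, a m (N - m).toNat * (z ^ (N - m).toNat * ((sq1 z : ℂ) * Complex.exp (φ * Complex.I)) ^ m) := by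
    intro z hz φ
    set S : Finset ℤ := (Finset.range (N + 1).toNat).map Nat.castEmbedding with hS
    have hz0 : ∀ m : ℤ, m ∉ S → fc (fun φ => fN (z, sq1 z * Complex.exp (φ * Complex.I))) m = 0 := by
      intro m hm
      rw [hcoef z hz m]
      split_ifs with h
      · have : m < 0 := by
          by_contra hcon
          apply hm
          rw [hS, Finset.mem_map]
          exact ⟨m.toNat, Finset.mem_range.2 (by lia), by simp; lia⟩
        rw [hneg m this h]; ring
      · ring
    have h1 := fc_series (u := fun φ => fN (z, sq1 z * Complex.exp (φ * Complex.I))) (by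
        rw [continuous_iff_continuousAt]
        intro q
        exact ContinuousAt.comp (g := fN) (hfa _ (hsp z hz q)).continuousAt (by fun_prop))
      (fun θ => by rw [exp_per]) (summable_of_ne_finset_zero (s := S) (fun m hm => by rw [hz0 m hm, norm_zero])) φ
    have h2 := hasSum_sum_of_ne_finset_zero (L := .unconditional ℤ) (s := S) (f := fun m : ℤ => fc (fun φ => fN (z, sq1 z * Complex.exp (φ * Complex.I))) m
      * Complex.exp (m * φ * Complex.I)) (fun m hm => by rw [hz0 m hm, zero_mul])
    have h3 := HasSum.unique h1 h2
    rw [h3, hS, Finset.sum_map]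
    refine Finset.sum_congr rfl (fun m hm => ?_)
    have hm' := Finset.mem_range.1 hm
    rw [hcoef z hz, if_pos (by simp; lia)]
    simp only [Nat.castEmbedding_apply]
    rw [mul_pow, zpow_natCast, ← Complex.exp_nat_mul, show ((m:ℕ):ℂ) * (φ * Complex.I) = ((m:ℤ):ℂ) * φ * Complex.I by push_cast; ring]
    ring
  have hin' : ∀ p : ℂ × ℂ, ‖p.1‖ ^ 2 + ‖p.2‖ ^ 2 = 1 → ‖p.1‖ < 1 → fN p =
      ∑ m ∈ Finset.range (N + 1).toNat, a m (N - m).toNat * (p.1 ^ (N - m).toNat * p.2 ^ m) := by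
    rintro ⟨z, w⟩ hp hz
    have e : w = sq1 z * Complex.exp (w.arg * Complex.I) := by
      have : sq1 z = ‖w‖ := by
        rw [sq1, Real.sqrt_eq_iff_mul_self_eq (by nlinarith [norm_nonneg z]) (norm_nonneg _)]
        dsimp only at hp; nlinarith
      rw [this, Complex.norm_mul_exp_arg_mul_I]
    have := hin z hz w.arg
    rw [← e] at this
    exact this
  intro p hp
  change fN p = _
  by_cases hz : ‖p.1‖ < 1
  · exact hin' p hp hz
  obtain ⟨z, w⟩ := p
  dsimp only at hp hz ⊢
  have hz1 : ‖z‖ = 1 := by nlinarith [norm_nonneg z, sq_nonneg ‖w‖]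
  have hw : w = 0 := by
    rw [hz1] at hp
    have : ‖w‖ ^ 2 = 0 := by linarith
    simpa using this
  subst hw
  have hsp2 : ∀ r ∈ Icc (0:ℝ) 1, ‖(r:ℂ) * z‖ ^ 2 + ‖(Real.sqrt (1 - r ^ 2) : ℂ)‖ ^ 2 = 1 := by
    intro r hr
    rw [norm_mul, hz1, mul_one, Complex.norm_real, Complex.norm_real, Real.norm_of_nonneg hr.1,
      Real.norm_of_nonneg (Real.sqrt_nonneg _), Real.sq_sqrt (by nlinarith [hr.1, hr.2])]
    ring
  have hE : EqOn (fun r : ℝ => fN ((r:ℂ) * z, (Real.sqrt (1 - r ^ 2) : ℂ)))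
      (fun r : ℝ => ∑ m ∈ Finset.range (N + 1).toNat, a m (N - m).toNat * (((r:ℂ) * z) ^ (N - m).toNat * (Real.sqrt (1 - r ^ 2) : ℂ) ^ m)) (Ico 0 1) := by
    intro r hr
    exact hin' ((r:ℂ) * z, (Real.sqrt (1 - r ^ 2) : ℂ)) (hsp2 r ⟨hr.1, hr.2.le⟩)
      (by simp only [norm_mul, hz1, mul_one, Complex.norm_real, Real.norm_of_nonneg hr.1]; exact hr.2)
  have hE2 := hE.of_subset_closure (t := Icc 0 1) (fun r hr => by
      refine ContinuousAt.continuousWithinAt ?_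
      exact ContinuousAt.comp (g := fN) (f := fun r : ℝ => ((r:ℂ) * z, (Real.sqrt (1 - r ^ 2) : ℂ)))
        (hfa _ (hsp2 r hr)).continuousAt (by fun_prop)) (by fun_prop) Ico_subset_Icc_self
    (by rw [closure_Ico (by norm_num)]) (show (1:ℝ) ∈ Icc (0:ℝ) 1 by simp)
  simpa using hE2

lemma homog_hol {E : Type*} [NormedAddCommGroup E] [InnerProductSpace ℂ E] {q : E → ℂ} {m : ℕ}
    (hq : ∀ x, AnalyticAt ℝ q x) (hh : ∀ (l : ℂ) x, q (l • x) = l ^ m * q x) : Differentiable ℂ q := by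
  have hd : ∀ x, HasFDerivAt q (fderiv ℝ q x) x := fun x => (hq x).differentiableAt.hasFDerivAt
  have hs : ∀ (l : ℂ), ∀ x v, fderiv ℝ q (l • x) (l • v) = l ^ m * fderiv ℝ q x v := by
    intro l x v
    let L : E →L[ℝ] E := (l • ContinuousLinearMap.id ℂ E).restrictScalars ℝ
    have h1 : HasFDerivAt (fun x => q (l • x)) ((fderiv ℝ q (l • x)).comp L) x :=
      HasFDerivAt.comp x (g := q) (f := fun x => l • x) (hd _) L.hasFDerivAt
    have h2 : HasFDerivAt (fun x => q (l • x)) ((l ^ m) • fderiv ℝ q x) x := by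
      have : (fun x => q (l • x)) = fun x => l ^ m * q x := funext (hh l)
      rw [this]
      exact (hd x).const_mul (l ^ m)
    have h3 := congrArg (fun T : E →L[ℝ] ℂ => T v) (h1.unique h2)
    simpa [L] using h3
  have hB : ∀ x v, fderiv ℝ q x (Complex.I • v) = Complex.I * fderiv ℝ q x v := by
    intro k v
    let B : E → E → ℂ := fun x v => fderiv ℝ q x (Complex.I • v) - Complex.I * fderiv ℝ q x v
    have hBs : ∀ x (μ : ℂ) v, B x (μ • v) = (starRingEnd ℂ) μ * B x v := by
      intro x μ v
      have e1 : μ • v = μ.re • v + μ.im • (Complex.I • v) := by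
        conv_lhs => rw [← Complex.re_add_im μ]
        rw [add_smul, mul_smul, Complex.coe_smul, Complex.coe_smul]
      have e2 : Complex.I • μ • v = μ.re • (Complex.I • v) - μ.im • v := by
        conv_lhs => rw [← Complex.re_add_im μ]
        rw [smul_smul, show Complex.I * ((μ.re:ℂ) + μ.im * Complex.I) = μ.re * Complex.I - μ.im by
          linear_combination (μ.im:ℂ) * Complex.I_sq, sub_smul, mul_smul, Complex.coe_smul, Complex.coe_smul]
      have e3 : (starRingEnd ℂ) μ = μ.re - μ.im * Complex.I := by
        apply Complex.ext <;> simp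
      simp only [B]
      rw [e2, e1, e3]
      simp only [map_add, map_sub, map_smul, Complex.real_smul]
      linear_combination (-(μ.im:ℂ) * fderiv ℝ q x v) * Complex.I_sq
    have hBl : ∀ l : ℂ, l ≠ 0 → B (l • k) v = l ^ m * ((starRingEnd ℂ) l⁻¹ * B k v) := by
      intro l hl
      have h1 : ∀ w, fderiv ℝ q (l • k) w = l ^ m * fderiv ℝ q k (l⁻¹ • w) := by
        intro w
        rw [← hs, smul_smul, mul_inv_cancel₀ hl, one_smul]
      rw [← hBs]
      simp only [B]
      rw [h1, h1, smul_comm]; ring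
    have hBa : AnalyticAt ℝ (fun l : ℂ => B (l • k) v) 0 := by
      have h0 : AnalyticAt ℝ (fun l : ℂ => l • k) 0 :=
        (((ContinuousLinearMap.id ℂ ℂ).smulRight k).restrictScalars ℝ).analyticAt 0
      have h1 : AnalyticAt ℝ (fun l : ℂ => fderiv ℝ q (l • k)) 0 :=
        AnalyticAt.fun_comp (g := fderiv ℝ q) (f := fun l : ℂ => l • k) (x := 0) ((hq _).fderiv) h0
      have h2 : ∀ w : E, AnalyticAt ℝ (fun l : ℂ => fderiv ℝ q (l • k) w) 0 := fun w =>
        ((ContinuousLinearMap.apply ℝ ℂ w).analyticAt _).fun_comp h1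
      exact (h2 _).fun_sub (analyticAt_const.fun_mul (h2 _))
    obtain ⟨R, hR, c, hcs, hch⟩ := expand_C hBa
    simp only [zero_add] at hch
    obtain ⟨C, hC⟩ := fc_growth hR hcs hch ((m:ℤ) + 1)
    have key : ∀ ρ ∈ Ioo 0 R, ‖B k v‖ ≤ C * ρ ^ 2 := by
      intro ρ hρ
      have hρ0 : (ρ:ℂ) ≠ 0 := by exact_mod_cast hρ.1.ne'
      have h1 := hC ρ hρ.1.le hρ.2
      have h2 : ∀ θ : ℝ, B (((ρ:ℂ) * Complex.exp (θ * Complex.I)) • k) v =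
          ((ρ:ℂ) ^ m * (ρ:ℂ)⁻¹ * B k v) * Complex.exp (((m:ℤ) + 1 : ℤ) * θ * Complex.I) := by
        intro θ
        rw [hBl _ (mul_ne_zero hρ0 (Complex.exp_ne_zero _)), mul_inv, map_mul, ← Complex.exp_neg, ← Complex.exp_conj,
          map_neg, map_mul, Complex.conj_I, Complex.conj_ofReal, map_inv₀, Complex.conj_ofReal, mul_pow,
          ← Complex.exp_nat_mul]
        have : Complex.exp (((m:ℤ) + 1 : ℤ) * θ * Complex.I) =
            Complex.exp (m * (θ * Complex.I)) * Complex.exp (-(θ * -Complex.I)) := by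
          rw [← Complex.exp_add]; congr 1; push_cast; ring
        rw [this]; ring
      rw [fc_congr h2, fc_const_mul, fc_exp, if_pos rfl, mul_one] at h1
      rw [norm_mul, norm_mul, norm_pow, norm_inv, Complex.norm_real, Real.norm_of_nonneg hρ.1.le,
        show ((m:ℤ) + 1).natAbs = m + 1 by lia] at h1
      have hp := hρ.1
      have h3 : ‖B k v‖ = (ρ ^ m * ρ⁻¹ * ‖B k v‖) * ρ / ρ ^ m := by field_simp
      rw [h3, div_le_iff₀ (by positivity)]
      calc _ ≤ C * ρ ^ (m + 1) * ρ := by gcongr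
        _ = _ := by ring
    have h0 := le_on_closure key (by fun_prop) (by fun_prop) (x := 0) (by rw [closure_Ioo hR.ne]; exact ⟨le_rfl, hR.le⟩)
    have h1 : B k v = 0 := by simpa using h0
    exact sub_eq_zero.1 h1
  intro x
  rw [differentiableAt_iff_restrictScalars ℝ (hd x).differentiableAt]
  refine ⟨⟨⟨(fderiv ℝ q x).toAddHom, fun μ v => ?_⟩, (fderiv ℝ q x).cont⟩, ?_⟩
  · have e1 : μ • v = μ.re • v + μ.im • (Complex.I • v) := by
      conv_lhs => rw [← Complex.re_add_im μ]
      rw [add_smul, mul_smul, Complex.coe_smul, Complex.coe_smul]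
    change fderiv ℝ q x (μ • v) = μ • fderiv ℝ q x v
    rw [e1, map_add, map_smul, map_smul, hB, smul_eq_mul, Complex.real_smul, Complex.real_smul]
    conv_rhs => rw [← Complex.re_add_im μ]
    ring
  · ext v; rfl

lemma fc_sum_exp (N : ℕ) (c : ℕ → ℂ) {m : ℕ} (hm : m ∈ Finset.range (N + 1)) :
    fc (fun φ : ℝ => ∑ k ∈ Finset.range (N + 1), c k * Complex.exp (φ * Complex.I) ^ k) m = c m := by
  have h : ∀ (s : Finset ℕ), fc (fun φ : ℝ => ∑ k ∈ s, c k * Complex.exp (φ * Complex.I) ^ k) m =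
      ∑ k ∈ s, if k = m then c k else 0 := by
    intro s
    induction s using Finset.induction_on with
    | empty => simp [fc]
    | insert a s ha ih =>
      simp only [Finset.sum_insert ha]
      rw [fc_add (by fun_prop) (by fun_prop), ih, fc_const_mul]
      congr 1
      rw [fc_congr (v := fun φ : ℝ => Complex.exp ((a:ℤ) * φ * Complex.I))
        (fun φ => by rw [← Complex.exp_nat_mul]; congr 1; push_cast; ring), fc_exp]
      by_cases h : a = m
      · simp [h]
      · rw [if_neg (by lia), if_neg h, mul_zero]
  rw [h, Finset.sum_ite_eq' , if_pos hm]

lemma poly_ext {E : Type*} [NormedAddCommGroup E] [InnerProductSpace ℂ E] {e : E} (he : ‖e‖ = 1)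
    {N : ℕ} {f : E → ℂ} (hf : ∀ x, ‖x‖ = 1 → AnalyticAt ℝ f x)
    (hω : ∃ ω : E, ‖ω‖ = 1 ∧ inner ℂ e ω = 0)
    (hp : ∀ ω : E, ‖ω‖ = 1 → inner ℂ e ω = 0 → ∃ c : ℕ → ℂ, ∀ z1 z2 : ℂ, ‖z1‖ ^ 2 + ‖z2‖ ^ 2 = 1 →
      f (z1 • e + z2 • ω) = ∑ m ∈ Finset.range (N + 1), c m * (z1 ^ (N - m) * z2 ^ m)) :
    ∃ P : E → ℂ, Differentiable ℂ P ∧ (∀ x, ‖x‖ = 1 → P x = f x) ∧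
      ∀ (l : ℂ) x, P (l • x) = l ^ N * P x := by
  have hee : inner ℂ e e = 1 := by rw [inner_self_eq_norm_sq_to_K, he]; simp
  let ip : E →L[ℂ] ℂ := innerSL ℂ e
  have hip : ∀ z, ip z = inner ℂ e z := fun z => rfl
  let pr : E →L[ℂ] E := ContinuousLinearMap.id ℂ E - ip.smulRight e
  have hpr : ∀ z, pr z = z - ip z • e := fun z => rfl
  have hor : ∀ z, inner ℂ e (pr z) = 0 := fun z => by
    rw [hpr, inner_sub_right, inner_smul_right, hee, hip]; ring
  have hn : ∀ (a b : ℂ) (ω : E), inner ℂ e ω = 0 → ‖ω‖ = 1 → ‖a • e + b • ω‖ ^ 2 = ‖a‖ ^ 2 + ‖b‖ ^ 2 := by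
    intro a b ω h h1
    have := norm_add_sq_eq_norm_sq_add_norm_sq_of_inner_eq_zero (𝕜 := ℂ) (a • e) (b • ω)
      (by rw [inner_smul_left, inner_smul_right, h]; ring)
    rw [norm_smul, norm_smul, he, h1, mul_one, mul_one] at this
    rw [sq, this]; ring
  let w : E → E := fun z => e + pr z
  have hw0 : ∀ z, w z ≠ 0 := fun z h => by
    have h1 : inner ℂ e (w z) = 1 := by simp only [w]; rw [inner_add_right, hor, hee, add_zero]
    rw [h, inner_zero_right] at h1; exact zero_ne_one h1
  let p : E → ℂ := fun z => ((‖w z‖ : ℝ) : ℂ) ^ N * f ((‖w z‖⁻¹ : ℝ) • w z)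
  have hwa : ∀ x, AnalyticAt ℝ w x := fun x => analyticAt_const.fun_add ((pr.restrictScalars ℝ).analyticAt x)
  have hpa : ∀ x, AnalyticAt ℝ p x := by
    intro x
    have h1 : AnalyticAt ℝ (fun z => ‖w z‖) x :=
      AnalyticAt.fun_comp (g := fun y => ‖y‖) (f := w) (contDiffAt_norm ℂ (hw0 x)).analyticAt (hwa x)
    refine AnalyticAt.fun_mul (h1.ofReal'.fun_pow N) ?_
    refine AnalyticAt.fun_comp (g := f) (f := fun z => (‖w z‖⁻¹ : ℝ) • w z) (hf _ ?_) ?_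
    · rw [norm_smul, norm_inv, norm_norm, inv_mul_cancel₀ (norm_ne_zero_iff.2 (hw0 x))]
    · exact (h1.fun_inv (norm_ne_zero_iff.2 (hw0 x))).fun_smul (hwa x)
  have key : ∀ z, ∃ c : ℕ → ℂ, (∀ l : ℂ, p (l • z) = ∑ m ∈ Finset.range (N + 1), c m * l ^ m) ∧
      (‖z‖ = 1 → f z = ∑ m ∈ Finset.range (N + 1), c m * ip z ^ (N - m)) := by
    intro z
    obtain ⟨ω, hω1, hω2, hz⟩ : ∃ ω : E, ‖ω‖ = 1 ∧ inner ℂ e ω = 0 ∧ pr z = ((‖pr z‖ : ℝ) : ℂ) • ω := by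
      by_cases h : pr z = 0
      · obtain ⟨ω, h1, h2⟩ := hω
        exact ⟨ω, h1, h2, by simp [h]⟩
      · refine ⟨((‖pr z‖ : ℝ) : ℂ)⁻¹ • pr z, ?_, ?_, ?_⟩
        · rw [norm_smul, norm_inv, Complex.norm_real, norm_norm, inv_mul_cancel₀ (norm_ne_zero_iff.2 h)]
        · rw [inner_smul_right, hor, mul_zero]
        · rw [smul_smul, mul_inv_cancel₀ (by exact_mod_cast norm_ne_zero_iff.2 h), one_smul]
    obtain ⟨c, hc⟩ := hp ω hω1 hω2
    set ρ : ℝ := ‖pr z‖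
    refine ⟨fun m => c m * (ρ:ℂ) ^ m, fun l => ?_, fun h1 => ?_⟩
    · have e1 : w (l • z) = (1:ℂ) • e + (l * ρ) • ω := by
        simp only [w]; rw [map_smul, hz, one_smul, smul_smul]
      have hs0 : (‖w (l • z)‖ : ℝ) ≠ 0 := norm_ne_zero_iff.2 (hw0 _)
      have hsn : ‖w (l • z)‖ ^ 2 = 1 + ‖l * (ρ:ℂ)‖ ^ 2 := by rw [e1, hn _ _ _ hω2 hω1]; simp
      simp only [p]
      set s : ℝ := ‖w (l • z)‖
      have hs' : (s:ℂ) ≠ 0 := by exact_mod_cast hs0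
      have e2 : (s⁻¹ : ℝ) • w (l • z) = (s:ℂ)⁻¹ • e + ((s:ℂ)⁻¹ * (l * ρ)) • ω := by
        rw [e1, ← Complex.coe_smul, smul_add, smul_smul, smul_smul, mul_one, Complex.ofReal_inv]
      rw [e2, hc _ _ (by
        rw [norm_mul, mul_pow, norm_inv, Complex.norm_real, norm_norm]
        field_simp; rw [hsn]; exact div_self (by positivity)), Finset.mul_sum]
      refine Finset.sum_congr rfl fun m hm => ?_
      have hm' : m ≤ N := by simpa [Nat.lt_succ_iff] using hm
      obtain ⟨k, rfl⟩ := Nat.exists_eq_add_of_le hm'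
      rw [Nat.add_sub_cancel_left, mul_pow, mul_pow, inv_pow, inv_pow, pow_add]
      field_simp
    · have e1 : z = ip z • e + (ρ:ℂ) • ω := by rw [← hz, hpr]; abel
      have e2 : ‖ip z‖ ^ 2 + ‖(ρ:ℂ)‖ ^ 2 = 1 := by
        rw [← hn _ _ _ hω2 hω1, ← e1, h1]; norm_num
      conv_lhs => rw [e1]
      rw [hc _ _ e2]
      exact Finset.sum_congr rfl fun m _ => by ring
  choose c hc1 hc2 using key
  have hfc : ∀ m ∈ Finset.range (N + 1), ∀ (l : ℂ) z,
      fc (fun φ : ℝ => p (Complex.exp (φ * Complex.I) • (l • z))) m = l ^ m * c z m := by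
    intro m hm l z
    rw [fc_congr (v := fun φ : ℝ => ∑ k ∈ Finset.range (N + 1), (l ^ k * c z k) * Complex.exp (φ * Complex.I) ^ k)
      (fun φ => by
        rw [smul_smul, hc1]
        exact Finset.sum_congr rfl fun k _ => by rw [mul_pow]; ring), fc_sum_exp N _ hm]
  have hfc1 : ∀ m ∈ Finset.range (N + 1), ∀ z,
      fc (fun φ : ℝ => p (Complex.exp (φ * Complex.I) • z)) m = c z m := by
    intro m hm z
    have := hfc m hm 1 z
    simpa using this
  have hch : ∀ m ∈ Finset.range (N + 1), ∀ (l : ℂ) z, c (l • z) m = l ^ m * c z m := by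
    intro m hm l z
    rw [← hfc1 m hm, hfc m hm]
  have hcd : ∀ m ∈ Finset.range (N + 1), Differentiable ℂ (fun z => c z m) := by
    intro m hm
    refine homog_hol (m := m) (fun x => ?_) (hch m hm)
    have := fc_analyticAt (G := fun q : E × ℝ => p (Complex.exp (q.2 * Complex.I) • q.1)) (x0 := x)
      (fun θ => AnalyticAt.fun_comp (g := p) (f := fun q : E × ℝ => Complex.exp (q.2 * Complex.I) • q.1)
        (hpa _) ((analyticAt_expI E (x, θ)).fun_smul analyticAt_fst)) m
    simpa only [hfc1 m hm] using this
  refine ⟨fun z => ∑ m ∈ Finset.range (N + 1), c z m * ip z ^ (N - m), ?_, fun x hx => (hc2 x hx).symm, ?_⟩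
  · exact Differentiable.fun_sum fun m hm => (hcd m hm).mul (ip.differentiable.pow _)
  · intro l x
    rw [Finset.mul_sum]
    refine Finset.sum_congr rfl fun m hm => ?_
    have hm' : m ≤ N := by simpa [Nat.lt_succ_iff] using hm
    obtain ⟨k, rfl⟩ := Nat.exists_eq_add_of_le hm'
    rw [hch m hm, map_smul, smul_eq_mul, Nat.add_sub_cancel_left]
    ring

lemma exists_decomp {E : Type*} [NormedAddCommGroup E] [InnerProductSpace ℂ E] {e : E} (he : ‖e‖ = 1)
    (hω : ∃ ω : E, ‖ω‖ = 1 ∧ inner ℂ e ω = 0) (z : E) :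
    ∃ (ω : E) (z1 z2 : ℂ), ‖ω‖ = 1 ∧ inner ℂ e ω = 0 ∧ z = z1 • e + z2 • ω := by
  have hee : inner ℂ e e = 1 := by rw [inner_self_eq_norm_sq_to_K, he]; simp
  set w := z - (inner ℂ e z : ℂ) • e with hw
  by_cases h : w = 0
  · obtain ⟨ω, h1, h2⟩ := hω
    exact ⟨ω, inner ℂ e z, 0, h1, h2, by rw [zero_smul, add_zero]; exact sub_eq_zero.1 h⟩
  · refine ⟨((‖w‖ : ℝ) : ℂ)⁻¹ • w, inner ℂ e z, (‖w‖ : ℝ), ?_, ?_, ?_⟩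
    · rw [norm_smul, norm_inv, Complex.norm_real, norm_norm, inv_mul_cancel₀ (norm_ne_zero_iff.2 h)]
    · rw [inner_smul_right, hw, inner_sub_right, inner_smul_right, hee]; ring
    · rw [smul_smul, mul_inv_cancel₀ (by exact_mod_cast norm_ne_zero_iff.2 h), one_smul, hw]; abel

lemma norm_slice {E : Type*} [NormedAddCommGroup E] [InnerProductSpace ℂ E] {e ω : E} (he : ‖e‖ = 1)
    (h1 : ‖ω‖ = 1) (h : inner ℂ e ω = 0) (a b : ℂ) : ‖a • e + b • ω‖ ^ 2 = ‖a‖ ^ 2 + ‖b‖ ^ 2 := by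
  have := norm_add_sq_eq_norm_sq_add_norm_sq_of_inner_eq_zero (𝕜 := ℂ) (a • e) (b • ω)
    (by rw [inner_smul_left, inner_smul_right, h]; ring)
  rw [norm_smul, norm_smul, he, h1, mul_one, mul_one] at this
  rw [sq, this]; ring

lemma slice_analytic {E : Type*} [NormedAddCommGroup E] [InnerProductSpace ℂ E] {e ω : E} (he : ‖e‖ = 1)
    (h1 : ‖ω‖ = 1) (h : inner ℂ e ω = 0) {g : E → ℂ} (hg : ∀ x, ‖x‖ = 1 → AnalyticAt ℝ g x) :
    ∀ p : ℂ × ℂ, ‖p.1‖ ^ 2 + ‖p.2‖ ^ 2 = 1 → AnalyticAt ℝ (fun p : ℂ × ℂ => g (p.1 • e + p.2 • ω)) p := by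
  intro p hp
  refine AnalyticAt.fun_comp (g := g) (f := fun p : ℂ × ℂ => p.1 • e + p.2 • ω) (hg _ ?_) ?_
  · rw [← norm_slice he h1 h] at hp
    exact (pow_eq_one_iff_of_nonneg (norm_nonneg _) two_ne_zero).1 hp
  · exact (analyticAt_fst.fun_smul analyticAt_const).fun_add (analyticAt_snd.fun_smul analyticAt_const)

lemma assemble {E : Type*} [NormedAddCommGroup E] [InnerProductSpace ℂ E] [ProperSpace E] {e : E}
    (he : ‖e‖ = 1) (hω : ∃ ω : E, ‖ω‖ = 1 ∧ inner ℂ e ω = 0)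
    {g : E → ℂ} (hg : ∀ x, ‖x‖ = 1 → AnalyticAt ℝ g x)
    (hs : ∀ ω : E, ‖ω‖ = 1 → inner ℂ e ω = 0 → ∀ m : ℤ,
      DifferentiableOn ℂ (hm (fun p : ℂ × ℂ => g (p.1 • e + p.2 • ω)) m) (ball 0 1)) :
    ∃ F : E → ℂ, ContinuousOn F (closedBall 0 1) ∧ DifferentiableOn ℂ F (ball 0 1) ∧
      ∀ x, ‖x‖ = 1 → F x = g x := by
  have hrot : ∀ (θ : ℝ) (x : E), ‖Complex.exp (θ * Complex.I) • x‖ = ‖x‖ := fun θ x => by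
    rw [norm_smul, Complex.norm_exp_ofReal_mul_I, one_mul]
  have hper : ∀ θ : ℝ, Complex.exp ((θ + 2 * Real.pi : ℝ) * Complex.I) = Complex.exp (θ * Complex.I) := by
    intro θ
    rw [Complex.ofReal_add, add_mul, Complex.exp_add]
    push_cast
    rw [Complex.exp_two_pi_mul_I, mul_one]
  let fN : ℤ → E → ℂ := fun N x => fc (fun θ : ℝ => g (Complex.exp (θ * Complex.I) • x)) N
  have hfa : ∀ N x, ‖x‖ = 1 → AnalyticAt ℝ (fN N) x := by
    intro N x hx
    exact fc_analyticAt (G := fun q : E × ℝ => g (Complex.exp (q.2 * Complex.I) • q.1))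
      (fun θ => AnalyticAt.fun_comp (g := g) (f := fun q : E × ℝ => Complex.exp (q.2 * Complex.I) • q.1)
        (hg _ (by rw [hrot, hx])) ((analyticAt_expI E (x, θ)).fun_smul analyticAt_fst)) N
  have hsl : ∀ (N : ℤ) (ω : E), ‖ω‖ = 1 → inner ℂ e ω = 0 → ∃ c : ℕ → ℂ, ∀ z1 z2 : ℂ,
      ‖z1‖ ^ 2 + ‖z2‖ ^ 2 = 1 → fN N (z1 • e + z2 • ω) =
        ∑ m ∈ Finset.range (N + 1).toNat, c m * (z1 ^ (N - m).toNat * z2 ^ m) := by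
    intro N ω h1 h2
    obtain ⟨c, hc⟩ := slice_poly (slice_analytic he h1 h2 hg) (hs ω h1 h2) N
    refine ⟨c, fun z1 z2 h => ?_⟩
    rw [← hc (z1, z2) h]
    refine fc_congr (fun θ => ?_) N
    rw [smul_add, smul_smul, smul_smul]
  have hpol : ∀ N : ℕ, ∃ P : E → ℂ, Differentiable ℂ P ∧ (∀ x, ‖x‖ = 1 → P x = fN N x) ∧
      ∀ (l : ℂ) x, P (l • x) = l ^ N * P x := by
    intro N
    refine poly_ext he (hfa N) hω fun ω h1 h2 => ?_
    obtain ⟨c, hc⟩ := hsl N ω h1 h2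
    refine ⟨c, fun z1 z2 h => ?_⟩
    rw [hc z1 z2 h, show ((N:ℤ) + 1).toNat = N + 1 by lia]
    refine Finset.sum_congr rfl fun m _ => ?_
    rw [show ((N:ℤ) - m).toNat = N - m by lia]
  have hneg : ∀ (N : ℤ) x, ‖x‖ = 1 → N < 0 → fN N x = 0 := by
    intro N x hx hN
    obtain ⟨ω, z1, z2, h1, h2, rfl⟩ := exists_decomp he hω x
    obtain ⟨c, hc⟩ := hsl N ω h1 h2
    rw [hc z1 z2 (by rw [← norm_slice he h1 h2, hx, one_pow]), show (N + 1).toNat = 0 by lia]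
    simp
  -- bounds
  let D : (E → ℂ) → E → ℂ := fun g x => fderiv ℝ g x (Complex.I • x)
  have hDa : ∀ {g : E → ℂ}, (∀ x, ‖x‖ = 1 → AnalyticAt ℝ g x) → ∀ x, ‖x‖ = 1 → AnalyticAt ℝ (D g) x := by
    intro g hg x hx
    have h1 : AnalyticAt ℝ (fun x : E => Complex.I • x) x :=
      ((Complex.I • ContinuousLinearMap.id ℂ E).restrictScalars ℝ).analyticAt x
    exact AnalyticAt.fun_comp (g := fun q : (E →L[ℝ] ℂ) × E => q.1 q.2) (f := fun x => (fderiv ℝ g x, Complex.I • x))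
      ((ContinuousLinearMap.id ℝ (E →L[ℝ] ℂ)).analyticAt_bilinear _) ((hg x hx).fderiv.prod h1)
  have hDd : ∀ {g : E → ℂ}, (∀ x, ‖x‖ = 1 → AnalyticAt ℝ g x) → ∀ x, ‖x‖ = 1 → ∀ θ : ℝ,
      HasDerivAt (fun θ : ℝ => g (Complex.exp (θ * Complex.I) • x)) (D g (Complex.exp (θ * Complex.I) • x)) θ := by
    intro g hg x hx θ
    have h1 : HasDerivAt (fun θ : ℝ => Complex.exp (θ * Complex.I))
        (Complex.exp (θ * Complex.I) * Complex.I) θ := by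
      have := ((hasDerivAt_id (θ:ℂ)).mul_const Complex.I).cexp.comp_ofReal
      simpa using this
    have h2 := h1.smul_const x
    have h3 := (hg _ ((hrot θ x).trans hx)).differentiableAt.hasFDerivAt.comp_hasDerivAt θ h2
    rw [mul_comm (Complex.exp _), mul_smul] at h3
    exact h3
  have hbd : ∀ {g : E → ℂ}, (∀ x, ‖x‖ = 1 → AnalyticAt ℝ g x) → ∃ B, ∀ x, ‖x‖ = 1 → ‖g x‖ ≤ B := by
    intro g hg
    obtain ⟨B, hB⟩ := (isCompact_sphere (0:E) 1).exists_bound_of_continuousOn (f := g)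
      fun x hx => (hg x (by simpa using hx)).continuousAt.continuousWithinAt
    exact ⟨B, fun x hx => hB x (by simpa using hx)⟩
  obtain ⟨B0, hB0⟩ := hbd hg
  obtain ⟨B, hB⟩ := hbd (hDa (hDa hg))
  have hbN : ∀ (N : ℤ) x, ‖x‖ = 1 → (N:ℝ) ^ 2 * ‖fN N x‖ ≤ B := by
    intro N x hx
    refine fc_bound (u1 := fun θ : ℝ => D g (Complex.exp (θ * Complex.I) • x))
      (u2 := fun θ : ℝ => D (D g) (Complex.exp (θ * Complex.I) • x)) (hDd hg x hx) (hDd (hDa hg) x hx)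
      ?_ ?_ ?_ (fun θ => hB _ ((hrot θ x).trans hx)) N
    · exact continuous_iff_continuousAt.2 fun θ => (hDd (hDa (hDa hg)) x hx θ).continuousAt
    · have := hper 0
      simp only [zero_add] at this
      rw [this]
    · have := hper 0
      simp only [zero_add] at this
      rw [this]
  choose P hPd hPe hPh using hpol
  let b : ℕ → ℝ := fun N => (if N = 0 then B0 else 0) + B * (1 / (N:ℝ) ^ 2)
  have hb : Summable b := (hasSum_ite_eq 0 B0).summable.add
    ((Real.summable_one_div_nat_pow.2 one_lt_two).mul_left B)
  have hPs : ∀ N x, ‖x‖ = 1 → ‖P N x‖ ≤ b N := by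
    intro N x hx
    rw [hPe N x hx]
    rcases Nat.eq_zero_or_pos N with rfl | hN
    · simpa [b] using fc_norm_le (fun θ => hB0 _ ((hrot θ x).trans hx)) 0
    · have h1 := hbN N x hx
      have hN' : (0:ℝ) < (N:ℝ) ^ 2 := by positivity
      simp only [b, if_neg hN.ne', zero_add, mul_one_div]
      rw [le_div_iff₀ hN', mul_comm]
      exact_mod_cast h1
  have hPb : ∀ N, ∀ x ∈ closedBall (0:E) 1, ‖P N x‖ ≤ b N := by
    intro N x hx
    obtain ⟨y, hy, hxy⟩ : ∃ y : E, ‖y‖ = 1 ∧ x = ((‖x‖:ℝ):ℂ) • y := by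
      by_cases h : x = 0
      · exact ⟨e, he, by simp [h]⟩
      · refine ⟨((‖x‖:ℝ):ℂ)⁻¹ • x, ?_, ?_⟩
        · rw [norm_smul, norm_inv, Complex.norm_real, norm_norm, inv_mul_cancel₀ (norm_ne_zero_iff.2 h)]
        · rw [smul_smul, mul_inv_cancel₀ (by exact_mod_cast norm_ne_zero_iff.2 h), one_smul]
    rw [hxy, hPh, norm_mul, norm_pow, Complex.norm_real, norm_norm]
    rw [mem_closedBall_zero_iff] at hx
    calc _ ≤ 1 * ‖P N y‖ := by gcongr; exact pow_le_one₀ (norm_nonneg _) hx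
      _ ≤ b N := by rw [one_mul]; exact hPs N y hy
  refine ⟨fun x => ∑' N, P N x, ?_, ?_, ?_⟩
  · exact continuousOn_tsum (fun N => (hPd N).continuous.continuousOn) hb hPb
  · intro x hx
    rw [mem_ball_zero_iff] at hx
    set r := (1 - ‖x‖) / 2 with hr
    have hr0 : 0 < r := by linarith
    have hxr : x ∈ ball x r := mem_ball_self hr0
    refine (hasFDerivAt_tsum_of_isPreconnected (𝕜 := ℂ) (f := P) (f' := fun N y => fderiv ℂ (P N) y)
      (u := fun N => 2 * b N / r) (s := ball x r) (x₀ := x) ((hb.mul_left 2).div_const r) isOpen_ball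
      (convex_ball x r).isPreconnected (fun N y _ => (hPd N y).hasFDerivAt) ?_ hxr ?_ hxr).differentiableAt.differentiableWithinAt
    · intro N y hy
      have hsub : ∀ z ∈ ball y r, ‖P N z‖ ≤ b N := by
        intro z hz
        refine hPb N z (mem_closedBall_zero_iff.2 ?_)
        rw [mem_ball_iff_norm] at hz hy
        calc ‖z‖ = ‖(z - y) + (y - x) + x‖ := by congr 1; abel
          _ ≤ ‖z - y‖ + ‖y - x‖ + ‖x‖ := norm_add₃_le
          _ ≤ 1 := by linarith
      refine Complex.norm_fderiv_le_div_of_mapsTo_ball (hPd N).differentiableOn (fun z hz => ?_) hr0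
      rw [mem_closedBall_iff_norm]
      have h1 := hsub z hz
      have h2 := hsub y (mem_ball_self hr0)
      linarith [norm_sub_le (P N z) (P N y)]
    · exact Summable.of_norm_bounded hb fun N => hPb N x (mem_closedBall_zero_iff.2 hx.le)
  · intro x hx
    have h1 := fc_series (u := fun θ : ℝ => g (Complex.exp (θ * Complex.I) • x))
      (continuous_iff_continuousAt.2 fun θ => (hDd hg x hx θ).continuousAt)
      (fun θ => by simp only [hper θ]) (summable_of_sq_bound fun N => hbN N x hx) 0
    simp only [Complex.ofReal_zero, mul_zero, zero_mul, Complex.exp_zero, mul_one, one_smul] at h1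
    have h2 : HasSum ((fun N : ℤ => fN N x) ∘ (fun n : ℕ => (n:ℤ))) (g x) := by
      rw [Function.Injective.hasSum_iff Nat.cast_injective]
      · exact h1
      · intro N hN
        refine hneg N x hx ?_
        by_contra hh
        exact hN ⟨N.toNat, by simp; lia⟩
    have h3 : (fun N => P N x) = ((fun N : ℤ => fN N x) ∘ (fun n : ℕ => (n:ℤ))) :=
      funext fun N => hPe N x hx
    simp only [h3]
    exact h2.tsum_eq

/-- one-dimensional extension property along all lines through `c` -/
def ExtAt {E : Type*} [NormedAddCommGroup E] [InnerProductSpace ℂ E] (f : E → ℂ) (c : E) : Prop :=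
  ∀ v : E, v ≠ 0 → ∃ F : ℂ → ℂ, ContinuousOn F {t : ℂ | ‖c + t • v‖ ≤ 1} ∧
    DifferentiableOn ℂ F {t : ℂ | ‖c + t • v‖ < 1} ∧ ∀ t : ℂ, ‖c + t • v‖ = 1 → F t = f (c + t • v)

section
variable {E : Type*} [NormedAddCommGroup E] [InnerProductSpace ℂ E]

lemma lineHyp_of_ext {e ω : E} (he : ‖e‖ = 1) (h1 : ‖ω‖ = 1) (h : inner ℂ e ω = 0) {β : ℝ} {g : E → ℂ}
    (hx : ExtAt g ((β:ℂ) • e)) : LineHyp (fun p : ℂ × ℂ => g (p.1 • e + p.2 • ω)) β := by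
  intro k
  have hv : e + k • ω ≠ 0 := by
    intro h0
    have := norm_slice he h1 h 1 k
    rw [one_smul, h0, norm_zero, norm_one] at this
    nlinarith [sq_nonneg ‖k‖]
  obtain ⟨F, hF1, hF2, hF3⟩ := hx _ hv
  have e1 : ∀ z : ℂ, (β:ℂ) • e + (z - β) • (e + k • ω) = z • e + (k * (z - β)) • ω := by
    intro z; module
  have e2 : ∀ z : ℂ, ‖(β:ℂ) • e + (z - β) • (e + k • ω)‖ ^ 2 = ‖z‖ ^ 2 + ‖k‖ ^ 2 * ‖z - β‖ ^ 2 := by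
    intro z; rw [e1, norm_slice he h1 h, norm_mul, mul_pow]
  refine ⟨fun z => F (z - β), ?_, ?_, ?_⟩
  · refine hF1.comp (by fun_prop) fun z hz => ?_
    rw [mem_ofPred_eq] at hz ⊢
    rw [← e2] at hz
    exact (sq_le_one_iff₀ (norm_nonneg _)).1 hz
  · refine hF2.comp (by fun_prop) fun z hz => ?_
    rw [mem_ofPred_eq] at hz ⊢
    rw [← e2] at hz
    exact (sq_lt_one_iff₀ (norm_nonneg _)).1 hz
  · intro z hz
    rw [← e2] at hz
    change F (z - β) = _
    rw [hF3 _ ((pow_eq_one_iff_of_nonneg (norm_nonneg _) two_ne_zero).1 hz), e1]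

/-- ball automorphism -/
noncomputable def mob (e : E) (r s : ℝ) (z : E) : E :=
  (1 + r * inner ℂ e z : ℂ)⁻¹ • ((inner ℂ e z + r : ℂ) • e + (s:ℂ) • (z - (inner ℂ e z : ℂ) • e))

variable {e : E} {r s : ℝ}

lemma inner_ee (he : ‖e‖ = 1) : inner ℂ e e = (1:ℂ) := by rw [inner_self_eq_norm_sq_to_K, he]; simp

lemma mob_den (he : ‖e‖ = 1) (hr : |r| < 1) {z : E} (hz : ‖z‖ ≤ 1) : (1 + r * inner ℂ e z : ℂ) ≠ 0 := by
  intro h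
  have h1 : ‖(r * inner ℂ e z : ℂ)‖ = 1 := by
    rw [show (r * inner ℂ e z : ℂ) = -1 by linear_combination h]; simp
  rw [norm_mul, Complex.norm_real, Real.norm_eq_abs] at h1
  have h2 : ‖(inner ℂ e z : ℂ)‖ ≤ 1 := (norm_inner_le_norm e z).trans (by rw [he, one_mul]; exact hz)
  nlinarith [abs_nonneg r, norm_nonneg (inner ℂ e z : ℂ)]

lemma mob_inner (he : ‖e‖ = 1) (z : E) : inner ℂ e (mob e r s z) = ((inner ℂ e z + r) / (1 + r * inner ℂ e z) : ℂ) := by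
  rw [mob, inner_smul_right, inner_add_right, inner_smul_right, inner_smul_right, inner_sub_right,
    inner_smul_right, inner_ee he]
  ring

lemma mob_norm (he : ‖e‖ = 1) (hs : s ^ 2 = 1 - r ^ 2) {z : E} (hD : (1 + r * inner ℂ e z : ℂ) ≠ 0) :
    ‖(1 + r * inner ℂ e z : ℂ)‖ ^ 2 * (1 - ‖mob e r s z‖ ^ 2) = s ^ 2 * (1 - ‖z‖ ^ 2) := by
  have hor : ∀ a b : ℂ, ‖a • e + b • (z - (inner ℂ e z : ℂ) • e)‖ ^ 2 =
      ‖a‖ ^ 2 + ‖b‖ ^ 2 * ‖z - (inner ℂ e z : ℂ) • e‖ ^ 2 := by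
    intro a b
    have := norm_add_sq_eq_norm_sq_add_norm_sq_of_inner_eq_zero (𝕜 := ℂ) (a • e) (b • (z - (inner ℂ e z : ℂ) • e))
      (by rw [inner_smul_left, inner_smul_right, inner_sub_right, inner_smul_right, inner_ee he]; ring)
    rw [norm_smul, norm_smul, he, mul_one] at this
    rw [sq, this]; ring
  have h1 : ‖z‖ ^ 2 = ‖(inner ℂ e z : ℂ)‖ ^ 2 + ‖z - (inner ℂ e z : ℂ) • e‖ ^ 2 := by
    have := hor (inner ℂ e z) 1
    rw [norm_one, one_pow, one_mul, one_smul, add_sub_cancel] at this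
    exact this
  have h2 := hor (inner ℂ e z + r) s
  rw [mob, norm_smul, norm_inv, mul_pow, h2, mul_sub, inv_pow, mul_inv_cancel_left₀ (by simpa using hD), h1]
  rw [Complex.norm_real, Real.norm_eq_abs, sq_abs, hs]
  simp only [Complex.sq_norm, Complex.normSq_apply]
  simp
  ring

lemma mob_norms (he : ‖e‖ = 1) (hr : |r| < 1) (hs : s ^ 2 = 1 - r ^ 2) {z : E} (hz : ‖z‖ ≤ 1) : ‖mob e r s z‖ ≤ 1 ∧ (‖z‖ < 1 → ‖mob e r s z‖ < 1) ∧
    (‖z‖ = 1 → ‖mob e r s z‖ = 1) := by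
  have hD := mob_den he hr hz
  have h := mob_norm he hs hD
  have hD' : 0 < ‖(1 + r * inner ℂ e z : ℂ)‖ ^ 2 := by positivity
  have hs0 : 0 < s ^ 2 := by rw [hs, sub_pos]; exact (sq_lt_one_iff_abs_lt_one r).2 hr
  have hz2 : ‖z‖ ^ 2 ≤ 1 := pow_le_one₀ (norm_nonneg _) hz
  refine ⟨?_, fun h1 => ?_, fun h1 => ?_⟩
  · refine (sq_le_one_iff₀ (norm_nonneg _)).1 (sub_nonneg.1 (nonneg_of_mul_nonneg_right (b := _) ?_ hD'))
    rw [h]; exact mul_nonneg hs0.le (by linarith)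
  · refine (sq_lt_one_iff₀ (norm_nonneg _)).1 (sub_pos.1 (pos_of_mul_pos_right (a := ‖(1 + r * inner ℂ e z : ℂ)‖ ^ 2) ?_ hD'.le))
    rw [h]; exact mul_pos hs0 (sub_pos.2 ((sq_lt_one_iff₀ (norm_nonneg _)).2 h1))
  · rw [h1, one_pow, sub_self, mul_zero] at h
    rcases mul_eq_zero.1 h with h2 | h2
    · exact absurd h2 hD'.ne'
    · exact (pow_eq_one_iff_of_nonneg (norm_nonneg _) two_ne_zero).1 (sub_eq_zero.1 h2).symm

lemma mob_inv (he : ‖e‖ = 1) (hr : |r| < 1) (hs : s ^ 2 = 1 - r ^ 2) {z : E} (hz : ‖z‖ ≤ 1) : mob e (-r) s (mob e r s z) = z := by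
  have hD := mob_den he hr hz
  have hs0 : 0 < s ^ 2 := by rw [hs, sub_pos]; exact (sq_lt_one_iff_abs_lt_one r).2 hr
  have hsc : (s:ℂ) ^ 2 = 1 - (r:ℂ) ^ 2 := by exact_mod_cast hs
  have hs0' : (1 - (r:ℂ) ^ 2) ≠ 0 := by rw [← hsc]; exact_mod_cast hs0.ne'
  rw [mob, mob_inner he, Complex.ofReal_neg]
  have e1 : (1 + -(r:ℂ) * ((inner ℂ e z + r) / (1 + r * inner ℂ e z))) = (1 - (r:ℂ) ^ 2) / (1 + r * inner ℂ e z) := by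
    field_simp; ring
  have e2 : ((inner ℂ e z + r) / (1 + r * inner ℂ e z) + -(r:ℂ) : ℂ) =
      (1 - (r:ℂ) ^ 2) * inner ℂ e z / (1 + r * inner ℂ e z) := by
    rw [eq_div_iff hD, add_mul, div_mul_cancel₀ _ hD]; ring
  have e3 : mob e r s z - ((inner ℂ e z + r) / (1 + r * inner ℂ e z) : ℂ) • e =
      ((s:ℂ) / (1 + r * inner ℂ e z)) • (z - (inner ℂ e z : ℂ) • e) := by
    rw [mob, smul_add, smul_smul, smul_smul, div_eq_inv_mul, div_eq_inv_mul]; abel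
  rw [e1, e2, e3, smul_add, smul_smul, smul_smul, smul_smul]
  have e4 : ((1 - (r:ℂ) ^ 2) / (1 + r * inner ℂ e z))⁻¹ * ((1 - (r:ℂ) ^ 2) * inner ℂ e z / (1 + r * inner ℂ e z)) =
      inner ℂ e z := by field_simp
  have e5 : ((1 - (r:ℂ) ^ 2) / (1 + r * inner ℂ e z))⁻¹ * (s * (s / (1 + r * inner ℂ e z))) = 1 := by
    rw [show (s:ℂ) * (s / (1 + r * inner ℂ e z)) = s ^ 2 / (1 + r * inner ℂ e z) by ring, hsc]
    field_simp
  rw [e4, ← mul_assoc] at *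
  rw [e5, one_smul]; abel

lemma mob_analytic (he : ‖e‖ = 1) (hr : |r| < 1) {z : E} (hz : ‖z‖ ≤ 1) : AnalyticAt ℂ (mob e r s) z := by
  have h1 : AnalyticAt ℂ (fun z => (inner ℂ e z : ℂ)) z := (innerSL ℂ e).analyticAt z
  refine AnalyticAt.fun_smul ((analyticAt_const.fun_add (analyticAt_const.fun_mul h1)).fun_inv (mob_den he hr hz)) ?_
  exact ((h1.fun_add analyticAt_const).fun_smul analyticAt_const).fun_add
    (analyticAt_const.fun_smul (analyticAt_id.fun_sub (h1.fun_smul analyticAt_const)))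

lemma mob_ext (he : ‖e‖ = 1) (hr : |r| < 1) (hs : s ^ 2 = 1 - r ^ 2) {g : E → ℂ} {c : E} (hc : ‖c‖ < 1) (hx : ExtAt g (mob e r s c)) :
    ExtAt (fun z => g (mob e r s z)) c := by
  intro v hv
  let v' : E := ((inner ℂ e v : ℂ) • e + (s:ℂ) • (v - (inner ℂ e v : ℂ) • e)) - (r * inner ℂ e v : ℂ) • mob e r s c
  have key : ∀ t : ℂ, ‖c + t • v‖ ≤ 1 →
      mob e r s (c + t • v) = mob e r s c + (t / (1 + r * inner ℂ e (c + t • v))) • v' := by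
    intro t ht
    have hD' := mob_den he hr ht
    have hDc := mob_den he hr hc.le
    have h1 : (1 + r * inner ℂ e c : ℂ) • mob e r s c =
        ((inner ℂ e c + r : ℂ) • e + (s:ℂ) • (c - (inner ℂ e c : ℂ) • e)) := by
      rw [mob, smul_smul, mul_inv_cancel₀ hDc, one_smul]
    have h2 : (1 + r * inner ℂ e (c + t • v) : ℂ) • mob e r s (c + t • v) =
        ((inner ℂ e (c + t • v) + r : ℂ) • e + (s:ℂ) • (c + t • v - (inner ℂ e (c + t • v) : ℂ) • e)) := by
      rw [mob, smul_smul, mul_inv_cancel₀ hD', one_smul]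
    have hi : (inner ℂ e (c + t • v) : ℂ) = inner ℂ e c + t * inner ℂ e v := by
      rw [inner_add_right, inner_smul_right]
    refine smul_right_injective E hD' ?_
    change (1 + r * inner ℂ e (c + t • v) : ℂ) • mob e r s (c + t • v) =
      (1 + r * inner ℂ e (c + t • v) : ℂ) • (mob e r s c + (t / (1 + r * inner ℂ e (c + t • v))) • v')
    rw [h2, smul_add, smul_smul, mul_div_cancel₀ _ hD', hi,
      show (1 + r * (inner ℂ e c + t * inner ℂ e v) : ℂ) = (1 + r * inner ℂ e c) + t * (r * inner ℂ e v) by ring,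
      add_smul (1 + r * inner ℂ e c : ℂ), h1]
    simp only [v']
    module
  have hv' : v' ≠ 0 := by
    intro h0
    have hvn : 0 < ‖v‖ := norm_pos_iff.2 hv
    set t : ℝ := (1 - ‖c‖) / ‖v‖ with ht
    have ht0 : 0 < t := div_pos (by linarith) hvn
    have h1 : ‖c + (t:ℂ) • v‖ ≤ 1 := by
      refine (norm_add_le _ _).trans ?_
      rw [norm_smul, Complex.norm_real, Real.norm_of_nonneg ht0.le, ht, div_mul_cancel₀ _ hvn.ne']
      linarith
    have h2 := key t h1
    rw [h0, smul_zero, add_zero] at h2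
    have h3 := congrArg (mob e (-r) s) h2
    rw [mob_inv he hr hs h1, mob_inv he hr hs hc.le, add_eq_left, smul_eq_zero] at h3
    rcases h3 with h3 | h3
    · exact ht0.ne' (by exact_mod_cast h3)
    · exact hv h3
  obtain ⟨F, h1, h2, h3⟩ := hx v' hv'
  have hd : ∀ t : ℂ, ‖c + t • v‖ ≤ 1 →
      DifferentiableAt ℂ (fun t : ℂ => t / (1 + r * inner ℂ e (c + t • v))) t := by
    intro t ht
    refine differentiableAt_id.fun_div ?_ (mob_den he hr ht)
    simp only [inner_add_right, inner_smul_right]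
    fun_prop
  refine ⟨fun t => F (t / (1 + r * inner ℂ e (c + t • v))), ?_, ?_, ?_⟩
  · refine h1.comp (fun t ht => (hd t ht).continuousAt.continuousWithinAt) fun t ht => ?_
    rw [mem_ofPred_eq] at ht ⊢
    rw [← key t ht]
    exact (mob_norms he hr hs ht).1
  · refine h2.comp (fun t ht => (hd t (le_of_lt ht)).differentiableWithinAt) fun t ht => ?_
    rw [mem_ofPred_eq] at ht ⊢
    rw [← key t ht.le]
    exact (mob_norms he hr hs ht.le).2.1 ht
  · intro t ht
    have := (mob_norms he hr hs ht.le).2.2 ht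
    beta_reduce
    rw [key t ht.le] at this ⊢
    exact h3 _ this

end

section
variable {E : Type*} [NormedAddCommGroup E] [InnerProductSpace ℂ E] [ProperSpace E]

lemma main_boundary (hω : ∀ e : E, ‖e‖ = 1 → ∃ ω : E, ‖ω‖ = 1 ∧ inner ℂ e ω = 0)
    {g : E → ℂ} (hg : ∀ x, ‖x‖ = 1 → AnalyticAt ℝ g x) {c : E} (hc : ‖c‖ = 1) (hx : ExtAt g c) :
    ∃ F : E → ℂ, ContinuousOn F (closedBall 0 1) ∧ DifferentiableOn ℂ F (ball 0 1) ∧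
      ∀ x, ‖x‖ = 1 → F x = g x := by
  refine assemble hc (hω c hc) hg fun ω h1 h2 m => boundary_hol (slice_analytic hc h1 h2 hg) ?_ m
  exact lineHyp_of_ext hc h1 h2 (by simpa using hx)

lemma main_zero (hω : ∀ e : E, ‖e‖ = 1 → ∃ ω : E, ‖ω‖ = 1 ∧ inner ℂ e ω = 0)
    {g : E → ℂ} (hg : ∀ x, ‖x‖ = 1 → AnalyticAt ℝ g x) {b : E} (hb0 : b ≠ 0) (hb : ‖b‖ < 1)
    (hx0 : ExtAt g 0) (hx : ExtAt g b) :
    ∃ F : E → ℂ, ContinuousOn F (closedBall 0 1) ∧ DifferentiableOn ℂ F (ball 0 1) ∧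
      ∀ x, ‖x‖ = 1 → F x = g x := by
  have hn : ‖b‖ ≠ 0 := norm_ne_zero_iff.2 hb0
  have he : ‖((‖b‖:ℝ):ℂ)⁻¹ • b‖ = 1 := by
    rw [norm_smul, norm_inv, Complex.norm_real, norm_norm, inv_mul_cancel₀ hn]
  have heb : ((‖b‖:ℝ):ℂ) • ((‖b‖:ℝ):ℂ)⁻¹ • b = b := by
    rw [smul_smul, mul_inv_cancel₀ (by exact_mod_cast hn), one_smul]
  refine assemble he (hω _ he) hg fun ω h1 h2 m => interior_hol (β := ‖b‖) (slice_analytic he h1 h2 hg)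
    (norm_pos_iff.2 hb0) hb ?_ ?_ m
  · exact lineHyp_of_ext he h1 h2 (by simpa using hx0)
  · exact lineHyp_of_ext he h1 h2 (by rwa [heb])

lemma main_abs (hω : ∀ e : E, ‖e‖ = 1 → ∃ ω : E, ‖ω‖ = 1 ∧ inner ℂ e ω = 0)
    {g : E → ℂ} (hg : ∀ x, ‖x‖ = 1 → AnalyticAt ℝ g x) {a b : E} (ha : ‖a‖ ≤ 1) (hb : ‖b‖ ≤ 1) (hab : a ≠ b)
    (hxa : ExtAt g a) (hxb : ExtAt g b) :
    ∃ F : E → ℂ, ContinuousOn F (closedBall 0 1) ∧ DifferentiableOn ℂ F (ball 0 1) ∧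
      ∀ x, ‖x‖ = 1 → F x = g x := by
  rcases ha.eq_or_lt with ha | ha
  · exact main_boundary hω hg ha hxa
  rcases hb.eq_or_lt with hb | hb
  · exact main_boundary hω hg hb hxb
  by_cases h0 : a = 0
  · subst h0
    exact main_zero hω hg hab.symm hb hxa hxb
  have hn : ‖a‖ ≠ 0 := norm_ne_zero_iff.2 h0
  obtain ⟨r, hrdef⟩ : ∃ r : ℝ, r = ‖a‖ := ⟨_, rfl⟩
  obtain ⟨e, hedef⟩ : ∃ e : E, e = ((‖a‖:ℝ):ℂ)⁻¹ • a := ⟨_, rfl⟩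
  have he : ‖e‖ = 1 := by
    rw [hedef, norm_smul, norm_inv, Complex.norm_real, norm_norm, inv_mul_cancel₀ hn]
  have hea : (r:ℂ) • e = a := by
    rw [hedef, hrdef, smul_smul, mul_inv_cancel₀ (by exact_mod_cast hn), one_smul]
  have hr : |r| < 1 := by rw [hrdef, abs_norm]; exact ha
  have hr' : |-r| < 1 := by rwa [abs_neg]
  have hs : √(1 - r ^ 2) ^ 2 = 1 - r ^ 2 :=
    Real.sq_sqrt (sub_nonneg.2 ((sq_lt_one_iff_abs_lt_one r).2 hr).le)
  have hs' : √(1 - r ^ 2) ^ 2 = 1 - (-r) ^ 2 := by rw [neg_sq]; exact hs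
  set s := √(1 - r ^ 2)
  have hm0 : mob e r s 0 = a := by simp [mob, hea]
  have inv1 : ∀ {z : E}, ‖z‖ ≤ 1 → mob e r s (mob e (-r) s z) = z := by
    intro z hz
    simpa using mob_inv he hr' hs' hz
  have hb' := (mob_norms he hr' hs' hb.le).2.1 hb
  have hb0 : mob e (-r) s b ≠ 0 := by
    intro h
    have := inv1 hb.le
    rw [h, hm0] at this
    exact hab this
  have hg' : ∀ x, ‖x‖ = 1 → AnalyticAt ℝ (fun z => g (mob e r s z)) x := fun x hx =>
    AnalyticAt.fun_comp (g := g) (hg _ ((mob_norms he hr hs hx.le).2.2 hx)) (mob_analytic he hr hx.le).restrictScalars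
  obtain ⟨F, h1, h2, h3⟩ := main_zero hω hg' hb0 hb'
    (mob_ext he hr hs (by simp) (by rwa [hm0])) (mob_ext he hr hs hb' (by rwa [inv1 hb.le]))
  refine ⟨fun z => F (mob e (-r) s z), ?_, ?_, ?_⟩
  · refine h1.comp (fun z hz => ?_) fun z hz => ?_
    · exact (mob_analytic he hr' (by simpa using hz)).continuousAt.continuousWithinAt
    · rw [mem_closedBall_zero_iff] at hz ⊢
      exact (mob_norms he hr' hs' hz).1
  · refine h2.comp (fun z hz => ?_) fun z hz => ?_
    · rw [mem_ball_zero_iff] at hz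
      exact (mob_analytic he hr' hz.le).differentiableAt.differentiableWithinAt
    · rw [mem_ball_zero_iff] at hz ⊢
      exact (mob_norms he hr' hs' hz.le).2.1 hz
  · intro x hx
    beta_reduce
    rw [h3 _ ((mob_norms he hr' hs' hx.le).2.2 hx), inv1 hx.le]

end

lemma exists_perp {n : ℕ} (hn : 2 ≤ n) (e : EuclideanSpace ℂ (Fin n)) :
    ∃ ω : EuclideanSpace ℂ (Fin n), ‖ω‖ = 1 ∧ inner ℂ e ω = 0 := by
  have hne : (Submodule.span ℂ {e})ᗮ ≠ ⊥ := by
    intro h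
    rw [Submodule.orthogonal_eq_bot_iff] at h
    have h1 := finrank_span_le_card (R := ℂ) ({e} : Set (EuclideanSpace ℂ (Fin n)))
    rw [h, finrank_top, finrank_euclideanSpace_fin] at h1
    simp at h1
    lia
  obtain ⟨x, hx, hx0⟩ := (Submodule.ne_bot_iff _).1 hne
  have hx' : inner ℂ e x = 0 := Submodule.mem_orthogonal_singleton_iff_inner_right.1 hx
  refine ⟨((‖x‖:ℝ):ℂ)⁻¹ • x, ?_, ?_⟩
  · rw [norm_smul, norm_inv, Complex.norm_real, norm_norm, inv_mul_cancel₀ (norm_ne_zero_iff.2 hx0)]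
  · rw [inner_smul_right, hx', mul_zero]

/-- **Theorem (main).** Let `n ≥ 2` and let `a, b` be two distinct points of the closed unit
ball of `ℂⁿ`.  If `f` is a real-analytic function on the unit sphere (i.e. the restriction to
the sphere of a function real-analytic in a neighborhood of the sphere) which, on every
complex line `L` through `a` or through `b`, agrees on `L ∩ ∂Bⁿ` with a function continuous
on `L ∩ cl Bⁿ` and holomorphic on `L ∩ Bⁿ`, then `f` is the boundary value of a function
continuous on the closed ball and holomorphic in the open ball. -/
theorem holomorphic_extension_from_two_bunches
    (n : ℕ) (hn : 2 ≤ n)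
    (a b : EuclideanSpace ℂ (Fin n))
    (ha : a ∈ closedBall (0 : EuclideanSpace ℂ (Fin n)) 1)
    (hb : b ∈ closedBall (0 : EuclideanSpace ℂ (Fin n)) 1)
    (hab : a ≠ b)
    (f : EuclideanSpace ℂ (Fin n) → ℂ)
    -- `f` is real-analytic on the sphere: it is the restriction of a function
    -- real-analytic in a neighborhood of the sphere
    (hf : ∃ (U : Set (EuclideanSpace ℂ (Fin n))) (g : EuclideanSpace ℂ (Fin n) → ℂ),
      IsOpen U ∧ sphere (0 : EuclideanSpace ℂ (Fin n)) 1 ⊆ U ∧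
      AnalyticOnNhd ℝ g U ∧ EqOn f g (sphere (0 : EuclideanSpace ℂ (Fin n)) 1))
    -- one-dimensional holomorphic extension along every complex line through `a` or `b`
    (hext : ∀ c ∈ ({a, b} : Set (EuclideanSpace ℂ (Fin n))),
      ∀ v : EuclideanSpace ℂ (Fin n), v ≠ 0 →
      ∃ F : ℂ → ℂ,
        ContinuousOn F {t : ℂ | ‖c + t • v‖ ≤ 1} ∧
        DifferentiableOn ℂ F {t : ℂ | ‖c + t • v‖ < 1} ∧
        ∀ t : ℂ, ‖c + t • v‖ = 1 → F t = f (c + t • v)) :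
    ∃ F : EuclideanSpace ℂ (Fin n) → ℂ,
      ContinuousOn F (closedBall (0 : EuclideanSpace ℂ (Fin n)) 1) ∧
      DifferentiableOn ℂ F (ball (0 : EuclideanSpace ℂ (Fin n)) 1) ∧
      EqOn F f (sphere (0 : EuclideanSpace ℂ (Fin n)) 1) := by
  obtain ⟨U, g, _, hU, hg, hfg⟩ := hf
  have hx : ∀ c ∈ ({a, b} : Set (EuclideanSpace ℂ (Fin n))), ExtAt g c := by
    intro c hc v hv
    obtain ⟨F, h1, h2, h3⟩ := hext c hc v hv
    exact ⟨F, h1, h2, fun t ht => (h3 t ht).trans (hfg (by simpa using ht))⟩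
  obtain ⟨F, h1, h2, h3⟩ := main_abs (fun e _ => exists_perp hn e) (g := g)
    (fun x hx => hg x (hU (by simpa using hx))) (by simpa using ha) (by simpa using hb) hab
    (hx a (by simp)) (hx b (by simp))
  exact ⟨F, h1, h2, fun x hx => (h3 x (by simpa using hx)).trans (hfg hx).symm⟩
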